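/- Let q be a bounded measurable function on Ω and let u ∈ C²(Ω) be a classical solution of L_q u = 0 that is not identically zero on Ω. Then for every compact set K ⊂ Ω there exists r > 0 (depending on K and u) such that the function x ↦ |u(x)|^{−2r} is Lebesgue integrable on K. -/

import Mathlib

open MeasureTheory Metric Set
open scoped RealInnerProductSpace

noncomputable section

/-- The `i`-th partial derivative of a real-valued function on `ℝⁿ`. -/
noncomputable def pd {n : ℕ} (i : Fin n) (f : EuclideanSpace ℝ (Fin n) → ℝ)
    (x : EuclideanSpace ℝ (Fin n)) : ℝ :=
  fderiv ℝ f x (EuclideanSpace.single i 1)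

/-- `u` is a classical solution of `L_q u = ∑ᵢⱼ ∂ᵢ (aⁱʲ ∂ⱼ u) + q u = 0` pointwise in `Ω`. -/
def IsSolution {n : ℕ} (A : Fin n → Fin n → EuclideanSpace ℝ (Fin n) → ℝ)
    (q u : EuclideanSpace ℝ (Fin n) → ℝ) (Ω : Set (EuclideanSpace ℝ (Fin n))) : Prop :=
  ∀ x ∈ Ω, (∑ i, ∑ j, pd i (fun y => A i j y * pd j u y) x) + q x * u x = 0

/-- The `H¹(D)` norm `(∫_D (w² + ‖∇w‖²))^{1/2}`. -/
noncomputable def H1Norm {n : ℕ} (D : Set (EuclideanSpace ℝ (Fin n)))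
    (w : EuclideanSpace ℝ (Fin n) → ℝ) : ℝ :=
  (∫ x in D, ((w x) ^ 2 + ‖fderiv ℝ w x‖ ^ 2)) ^ (1 / 2 : ℝ)

/-- `A = (aⁱʲ)` is symmetric, has `C¹` entries on `closure Ω`, and is uniformly elliptic. -/
def EllipticSym {n : ℕ} (Ω : Set (EuclideanSpace ℝ (Fin n)))
    (A : Fin n → Fin n → EuclideanSpace ℝ (Fin n) → ℝ) : Prop :=
  (∀ i j, ∀ x ∈ closure Ω, A i j x = A j i x) ∧
  (∀ i j, ContDiffOn ℝ 1 (A i j) (closure Ω)) ∧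
  (∃ lam > 0, ∀ x ∈ Ω, ∀ ξ : EuclideanSpace ℝ (Fin n),
    lam * ‖ξ‖ ^ 2 ≤ ∑ i, ∑ j, A i j x * ξ i * ξ j)


abbrev EE (n : ℕ) := EuclideanSpace ℝ (Fin n)

/-- divergence -/
def dv {n : ℕ} (F : EE n → EE n) (x : EE n) : ℝ :=
  ∑ i, (fderiv ℝ F x (EuclideanSpace.single i 1)) i

/-- trace -/
def tr {n : ℕ} (T : EE n →L[ℝ] EE n) : ℝ := ∑ i, (T (EuclideanSpace.single i 1)) i

lemma dv_eq_tr {n : ℕ} (F : EE n → EE n) (x : EE n) : dv F x = tr (fderiv ℝ F x) := rfl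

lemma tr_add {n : ℕ} (S T : EE n →L[ℝ] EE n) : tr (S + T) = tr S + tr T := by
  simp [tr, Finset.sum_add_distrib]

lemma tr_sub {n : ℕ} (S T : EE n →L[ℝ] EE n) : tr (S - T) = tr S - tr T := by
  simp [tr, Finset.sum_sub_distrib]

lemma tr_smul {n : ℕ} (c : ℝ) (T : EE n →L[ℝ] EE n) : tr (c • T) = c * tr T := by
  simp [tr, Finset.mul_sum]

lemma tr_id {n : ℕ} : tr (ContinuousLinearMap.id ℝ (EE n)) = n := by
  simp [tr]

lemma abs_tr_le {n : ℕ} (T : EE n →L[ℝ] EE n) : |tr T| ≤ n * ‖T‖ := by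
  unfold tr
  calc |∑ i, (T (EuclideanSpace.single i 1)) i| ≤ ∑ i, |(T (EuclideanSpace.single i 1)) i| :=
        Finset.abs_sum_le_sum_abs _ _
    _ ≤ ∑ i : Fin n, ‖T‖ := by
        apply Finset.sum_le_sum
        intro i _
        have h1 : ‖(T (EuclideanSpace.single i 1)) i‖ ≤ ‖T (EuclideanSpace.single i (1:ℝ))‖ :=
          PiLp.norm_apply_le _ i
        have h2 := T.le_opNorm (EuclideanSpace.single i (1:ℝ))
        have h3 : ‖(EuclideanSpace.single i (1:ℝ) : EE n)‖ = 1 := by simp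
        rw [h3, mul_one] at h2
        exact h1.trans h2
    _ = n * ‖T‖ := by simp

lemma continuous_tr {n : ℕ} : Continuous (tr : (EE n →L[ℝ] EE n) → ℝ) := by
  unfold tr
  fun_prop

lemma sum_single {n : ℕ} (v : EE n) : ∑ i, v i • (EuclideanSpace.single i (1:ℝ) : EE n) = v := by
  ext j
  simp [Finset.sum_apply, Pi.single_apply]

lemma dv_smul {n : ℕ} {f : EE n → ℝ} {F : EE n → EE n} {x : EE n}
    (hf : DifferentiableAt ℝ f x) (hF : DifferentiableAt ℝ F x) :
    dv (fun y => f y • F y) x = fderiv ℝ f x (F x) + f x * dv F x := by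
  unfold dv
  rw [fderiv_fun_smul hf hF]
  simp only [ContinuousLinearMap.add_apply, ContinuousLinearMap.smul_apply,
    ContinuousLinearMap.smulRight_apply, PiLp.add_apply, PiLp.smul_apply, smul_eq_mul,
    Finset.sum_add_distrib, Finset.mul_sum]
  rw [add_comm]
  congr 1
  conv_rhs => rw [← sum_single (F x)]
  rw [map_sum]
  refine Finset.sum_congr rfl fun i _ => ?_
  simp [mul_comm]

lemma dv_sub {n : ℕ} {F G : EE n → EE n} {x : EE n}
    (hF : DifferentiableAt ℝ F x) (hG : DifferentiableAt ℝ G x) :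
    dv (fun y => F y - G y) x = dv F x - dv G x := by
  rw [dv_eq_tr, fderiv_fun_sub hF hG, tr_sub]; rfl

lemma continuous_dv {n : ℕ} {F : EE n → EE n} (hF : ContDiff ℝ 1 F) : Continuous (dv F) := by
  have : dv F = fun x => tr (fderiv ℝ F x) := rfl
  rw [this]
  exact continuous_tr.comp (hF.continuous_fderiv (by norm_num))

lemma integral_dv_eq_zero {n : ℕ} {F : EE n → EE n} (hF : ContDiff ℝ 1 F)
    (hc : HasCompactSupport F) : ∫ x, dv F x = 0 := by
  have hcd : Continuous (fderiv ℝ F) := hF.continuous_fderiv (by norm_num)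
  have hcs : HasCompactSupport (fderiv ℝ F) := hc.fderiv (𝕜 := ℝ)
  have key : ∀ i : Fin n, Integrable (fun x => (fderiv ℝ F x (EuclideanSpace.single i 1)) i) := by
    intro i
    apply Continuous.integrable_of_hasCompactSupport
    · fun_prop
    · exact hcs.comp_left (g := fun T : EE n →L[ℝ] EE n => (T (EuclideanSpace.single i 1)) i)
        (by simp)
  unfold dv
  rw [integral_finsetSum _ (fun i _ => key i)]
  apply Finset.sum_eq_zero
  intro i _
  have hd : ∀ x, fderiv ℝ (fun y => F y i) x (EuclideanSpace.single i 1)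
      = (fderiv ℝ F x (EuclideanSpace.single i 1)) i := by
    intro x
    have h := (hF.differentiable (by norm_num) x).hasFDerivAt
    have h2 := ((EuclideanSpace.proj i : EE n →L[ℝ] ℝ).hasFDerivAt (x := F x)).comp x h
    have h3 := h2.fderiv
    have : (fun y => F y i) = (EuclideanSpace.proj i : EE n →L[ℝ] ℝ) ∘ F := by ext; simp
    rw [this, h3]; simp
  have := integral_mul_fderiv_eq_neg_fderiv_mul_of_integrable (μ := (volume : Measure (EE n)))
    (f := fun _ : EE n => (1:ℝ)) (g := fun y => F y i) (v := EuclideanSpace.single i 1)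
    (by simp) (by simp only [hd, one_mul]; exact key i)
    (by
      simp only [one_mul]
      apply Continuous.integrable_of_hasCompactSupport
      · have := hF.continuous; fun_prop
      · exact hc.comp_left (g := fun v : EE n => v i) (by simp))
    (by intro x _; fun_prop)
    (by
      intro x _
      have := hF.differentiable (by norm_num) x
      fun_prop)
  simpa [hd] using this

lemma ibp {n : ℕ} {φ : EE n → ℝ} {X : EE n → EE n} (hφ : ContDiff ℝ 1 φ)
    (hc : HasCompactSupport φ) (hX : ContDiff ℝ 1 X) :
    ∫ x, dv X x * φ x = - ∫ x, fderiv ℝ φ x (X x) := by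
  have h0 := integral_dv_eq_zero (hφ.smul hX) (hc.smul_right (f' := X))
  have h1 : ∀ x, dv (fun y => φ y • X y) x = fderiv ℝ φ x (X x) + φ x * dv X x := fun x =>
    dv_smul (hφ.differentiable (by norm_num) x) (hX.differentiable (by norm_num) x)
  change ∫ x, dv (fun y => φ y • X y) x = 0 at h0
  simp only [h1] at h0
  rw [integral_add] at h0
  · simp only [mul_comm (dv X _)]; linarith
  · apply Continuous.integrable_of_hasCompactSupport
    · exact (hφ.continuous_fderiv (by norm_num)).clm_apply hX.continuous
    · refine HasCompactSupport.mono (hc.fderiv (𝕜 := ℝ)) ?_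
      intro x hx
      simp only [Function.mem_support] at hx ⊢
      intro h; apply hx; rw [h]; simp
  · apply Continuous.integrable_of_hasCompactSupport
    · exact hφ.continuous.mul (continuous_dv hX)
    · exact hc.mul_right


lemma hasDerivAt_pospow (k : ℕ) (t : ℝ) :
    HasDerivAt (fun t : ℝ => (max t 0) ^ (k+2)) ((k+2) * (max t 0) ^ (k+1)) t := by
  rcases lt_trichotomy t 0 with h | h | h
  · have : (fun t : ℝ => (max t 0) ^ (k+2)) =ᶠ[nhds t] fun _ => 0 := by
      filter_upwards [gt_mem_nhds h] with s hs
      rw [max_eq_right hs.le]; simp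
    rw [max_eq_right h.le]
    simpa using (hasDerivAt_const t (0:ℝ)).congr_of_eventuallyEq this
  · subst h
    simp only [max_self, ne_eq, Nat.add_eq_zero_iff, one_ne_zero, and_false, not_false_eq_true,
      zero_pow, mul_zero]
    rw [hasDerivAt_iff_isLittleO]
    simp only [max_self, ne_eq, Nat.add_eq_zero_iff, OfNat.ofNat_ne_zero, and_false,
      not_false_eq_true, zero_pow, sub_zero, smul_eq_mul, mul_zero]
    have h2 : (fun x : ℝ => x ^ (k+2)) =o[nhds 0] fun x => x := by
      simpa using Asymptotics.isLittleO_pow_id (𝕜 := ℝ) (n := k+2) (by omega)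
    refine Asymptotics.IsBigO.trans_isLittleO (Asymptotics.isBigO_of_le _ fun x => ?_) h2
    rw [norm_pow, norm_pow]
    gcongr
    rw [Real.norm_eq_abs, Real.norm_eq_abs]
    rcases le_total x 0 with h | h
    · rw [max_eq_right h]; simp
    · rw [max_eq_left h]
  · have : (fun t : ℝ => (max t 0) ^ (k+2)) =ᶠ[nhds t] fun t => t ^ (k+2) := by
      filter_upwards [lt_mem_nhds h] with s hs
      rw [max_eq_left hs.le]
    rw [max_eq_left h.le]
    have h3 := (hasDerivAt_pow (k+2) t).congr_of_eventuallyEq this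
    have h4 : ((k:ℝ)+2) * t ^ (k+1) = ((k+2 : ℕ) : ℝ) * t ^ (k+2-1) := by push_cast; rfl
    rw [h4]; exact h3

lemma contDiff_pospow (k : ℕ) : ContDiff ℝ 1 (fun t : ℝ => (max t 0) ^ (k+2)) := by
  rw [contDiff_one_iff_deriv]
  refine ⟨fun t => (hasDerivAt_pospow k t).differentiableAt, ?_⟩
  have : deriv (fun t : ℝ => (max t 0) ^ (k+2)) = fun t : ℝ => (((k:ℝ)+2) * (max t 0) ^ (k+1)) :=
    funext fun t => (hasDerivAt_pospow k t).deriv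
  rw [this]; fun_prop

/-- the weight -/
def WW {n : ℕ} (ρ : EE n → ℝ) (r : ℝ) (x : EE n) : ℝ := max (r^2 - ρ x) 0

section
variable {n : ℕ} {ρ : EE n → ℝ} {K : ℝ}

lemma WW_nonneg (r : ℝ) (x : EE n) : 0 ≤ WW ρ r x := le_max_right _ _

lemma WW_eq_zero {r : ℝ} {x : EE n} (h : r^2 ≤ ρ x) : WW ρ r x = 0 :=
  max_eq_right (by linarith)

lemma WW_le {r : ℝ} {x : EE n} (h : 0 ≤ ρ x) : WW ρ r x ≤ r^2 :=
  max_le (by linarith) (by positivity)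

lemma WW_mul (r : ℝ) (x : EE n) : r^2 * WW ρ r x = WW ρ r x ^ 2 + ρ x * WW ρ r x := by
  unfold WW
  rcases le_total (r^2 - ρ x) 0 with h | h
  · rw [max_eq_right h]; ring
  · rw [max_eq_left h]; ring

lemma continuous_WW (hρ : Continuous ρ) (r : ℝ) : Continuous (WW ρ r) := by
  unfold WW; fun_prop

lemma contDiff_WW (hρ : ContDiff ℝ 1 ρ) (r : ℝ) (k : ℕ) :
    ContDiff ℝ 1 (fun x => WW ρ r x ^ (k+2)) :=
  (contDiff_pospow k).comp (contDiff_const.sub hρ)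

lemma fderiv_WW (hρ : ContDiff ℝ 1 ρ) (r : ℝ) (k : ℕ) (x v : EE n) :
    fderiv ℝ (fun x => WW ρ r x ^ (k+2)) x v = - ((k+2) * WW ρ r x ^ (k+1) * fderiv ℝ ρ x v) := by
  have h1 := (hρ.differentiable (by norm_num) x).hasFDerivAt
  have h2 := (hasDerivAt_pospow k (r^2 - ρ x)).comp_hasFDerivAt x (h1.const_sub (r^2))
  have h3 : HasFDerivAt (fun x => WW ρ r x ^ (k+2)) _ x := h2
  rw [h3.fderiv]
  simp [WW]

lemma WW_support_subset (hlow : ∀ x, ‖x‖^2 ≤ K * ρ x) (hK : 0 < K) {r s : ℝ} (hrs : |r| ≤ s) {x : EE n}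
    (hx : WW ρ r x ≠ 0) : x ∈ closedBall (0 : EE n) (Real.sqrt K * s) := by
  have h : ρ x < r^2 := by
    by_contra hcon
    exact hx (WW_eq_zero (not_lt.mp hcon))
  have h2 : ‖x‖^2 ≤ K * s^2 := by
    have : r^2 ≤ s^2 := sq_le_sq' (by linarith [neg_abs_le r]) ((le_abs_self r).trans hrs)
    nlinarith [hlow x]
  rw [mem_closedBall_zero_iff]
  have hs : 0 ≤ s := (abs_nonneg r).trans hrs
  apply le_of_sq_le_sq _ (by positivity)
  rw [mul_pow, Real.sq_sqrt hK.le]; exact h2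

lemma hasCompactSupport_WW (hlow : ∀ x, ‖x‖^2 ≤ K * ρ x) (hK : 0 < K) (r : ℝ) (k : ℕ) :
    HasCompactSupport (fun x => WW ρ r x ^ (k+1)) := by
  apply HasCompactSupport.intro (isCompact_closedBall (0 : EE n) (Real.sqrt K * |r|))
  intro x hx
  have : WW ρ r x = 0 := by
    by_contra h
    exact hx (WW_support_subset hlow hK le_rfl h)
  simp [this]

lemma integrable_WW (hρ : Continuous ρ) (hlow : ∀ x, ‖x‖^2 ≤ K * ρ x) (hK : 0 < K) (r : ℝ) (k : ℕ)
    {f : EE n → ℝ} (hf : Continuous f) : Integrable (fun x => f x * WW ρ r x ^ (k+1)) := by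
  apply Continuous.integrable_of_hasCompactSupport
  · exact hf.mul ((continuous_WW hρ r).pow _)
  · exact (hasCompactSupport_WW hlow hK r k).mul_left

lemma hasDerivAt_int_WW (hρ : Continuous ρ) (hlow : ∀ x, ‖x‖^2 ≤ K * ρ x) (hK : 0 < K) (k : ℕ)
    {f : EE n → ℝ} (hf : Continuous f) (r : ℝ) :
    HasDerivAt (fun r => ∫ x, f x * WW ρ r x ^ (k+2))
      (∫ x, f x * (2 * r * (k+2) * WW ρ r x ^ (k+1))) r := by
  have h0 : ∀ x, 0 ≤ ρ x := fun x => by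
    have := hlow x
    have h2 : 0 ≤ K * ρ x := (sq_nonneg _).trans this
    exact nonneg_of_mul_nonneg_right h2 hK
  set S := closedBall (0 : EE n) (Real.sqrt K * (|r|+1)) with hS
  set B : ℝ := 2 * (|r|+1) * (k+2) * ((|r|+1)^2)^(k+1) with hB
  refine (hasDerivAt_integral_of_dominated_loc_of_deriv_le (s := ball r 1)
    (F := fun r x => f x * WW ρ r x ^ (k+2))
    (F' := fun r x => f x * (2 * r * (k+2) * WW ρ r x ^ (k+1)))
    (bound := S.indicator fun x => |f x| * B) (ball_mem_nhds r one_pos) ?_ ?_ ?_ ?_ ?_ ?_).2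
  · exact Filter.Eventually.of_forall fun r =>
      (hf.mul ((continuous_WW hρ r).pow _)).aestronglyMeasurable
  · exact integrable_WW hρ hlow hK r (k+1) hf
  · exact (hf.mul (continuous_const.mul ((continuous_WW hρ r).pow _))).aestronglyMeasurable
  · refine Filter.Eventually.of_forall fun x s hs => ?_
    have hs' : |s| ≤ |r| + 1 := by
      have h1 : |s - r| < 1 := by simpa [Real.dist_eq] using hs
      have := abs_sub_abs_le_abs_sub s r
      linarith
    by_cases hx : x ∈ S
    · rw [indicator_of_mem hx, norm_mul, Real.norm_eq_abs]
      gcongr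
      rw [hB, norm_mul, norm_mul, norm_mul, norm_pow]
      simp only [Real.norm_eq_abs]
      rw [abs_of_nonneg (WW_nonneg s x), abs_of_nonneg (by positivity : (0:ℝ) ≤ (k:ℝ)+2)]
      have h3 : WW ρ s x ≤ (|r|+1)^2 := (WW_le (h0 x)).trans (by
        rw [← sq_abs s]; gcongr)
      have := WW_nonneg (ρ := ρ) s x
      norm_num
      gcongr
    · have : WW ρ s x = 0 := by
        by_contra h
        exact hx (WW_support_subset hlow hK hs' h)
      simp [this, indicator_of_notMem hx]
  · rw [integrable_indicator_iff measurableSet_closedBall]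
    exact (hf.abs.mul continuous_const).continuousOn.integrableOn_compact (isCompact_closedBall _ _)
  · refine Filter.Eventually.of_forall fun x s _ => ?_
    have h1 : HasDerivAt (fun s : ℝ => s^2 - ρ x) (2*s) s := by
      simpa using (hasDerivAt_pow 2 s).sub_const (ρ x)
    have h2 := (hasDerivAt_pospow k (s^2 - ρ x)).comp s h1
    have h3 := h2.const_mul (f x)
    have h4 : f x * (2 * s * (k+2) * WW ρ s x ^ (k+1))
        = f x * ((k+2) * (max (s^2 - ρ x) 0) ^ (k+1) * (2*s)) := by
      unfold WW; ring
    rw [h4]; exact h3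
end


section
variable {n : ℕ} {u : EE n → ℝ}

lemma contDiff_gradient (hu : ContDiff ℝ 2 u) : ContDiff ℝ 1 (gradient u) := by
  have h1 : ContDiff ℝ 1 (fderiv ℝ u) := hu.fderiv_right (by norm_num)
  exact (InnerProductSpace.toDual ℝ (EE n)).symm.toContinuousLinearEquiv.contDiff.comp h1

lemma fderiv_gradient_inner (hu : ContDiff ℝ 2 u) (x v w : EE n) :
    ⟪fderiv ℝ (gradient u) x v, w⟫ = fderiv ℝ (fderiv ℝ u) x v w := by
  have h1 : DifferentiableAt ℝ (fderiv ℝ u) x :=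
    (hu.fderiv_right (m := 1) (by norm_num)).differentiable (by norm_num) x
  have h2 : HasFDerivAt (gradient u) _ x :=
    (InnerProductSpace.toDual ℝ (EE n)).symm.toContinuousLinearEquiv.toContinuousLinearMap.hasFDerivAt.comp x
      h1.hasFDerivAt
  rw [h2.fderiv]
  change ⟪(InnerProductSpace.toDual ℝ (EE n)).symm (fderiv ℝ (fderiv ℝ u) x v), w⟫ = _
  rw [InnerProductSpace.toDual_symm_apply]

lemma hess_symm (hu : ContDiff ℝ 2 u) (x v w : EE n) :
    ⟪fderiv ℝ (gradient u) x v, w⟫ = ⟪v, fderiv ℝ (gradient u) x w⟫ := by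
  rw [fderiv_gradient_inner hu, real_inner_comm, fderiv_gradient_inner hu]
  exact (hu.contDiffAt.isSymmSndFDerivAt (by simp)) v w

/-- flux -/
def flux (a : EE n → EE n →L[ℝ] EE n) (u : EE n → ℝ) (x : EE n) : EE n := a x (gradient u x)

variable {a : EE n → EE n →L[ℝ] EE n}

lemma contDiff_flux (ha : ContDiff ℝ 1 a) (hu : ContDiff ℝ 2 u) : ContDiff ℝ 1 (flux a u) :=
  ha.clm_apply (contDiff_gradient hu)

lemma fderiv_flux (ha : ContDiff ℝ 1 a) (hu : ContDiff ℝ 2 u) (x v : EE n) :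
    fderiv ℝ (flux a u) x v =
      fderiv ℝ a x v (gradient u x) + a x (fderiv ℝ (gradient u) x v) := by
  have h1 := ((ha.differentiable (by norm_num) x).hasFDerivAt).clm_apply
    (((contDiff_gradient hu).differentiable (by norm_num) x).hasFDerivAt)
  have h2 : HasFDerivAt (flux a u) _ x := h1
  rw [h2.fderiv]
  simp [add_comm]

/-- energy density -/
def en (a : EE n → EE n →L[ℝ] EE n) (u : EE n → ℝ) (x : EE n) : ℝ := ⟪flux a u x, gradient u x⟫

lemma contDiff_en (ha : ContDiff ℝ 1 a) (hu : ContDiff ℝ 2 u) : ContDiff ℝ 1 (en a u) :=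
  (contDiff_flux ha hu).inner ℝ (contDiff_gradient hu)

lemma fderiv_en (ha : ContDiff ℝ 1 a) (hu : ContDiff ℝ 2 u)
    (hs : ∀ x v w, ⟪a x v, w⟫ = ⟪v, a x w⟫) (x v : EE n) :
    fderiv ℝ (en a u) x v = ⟪fderiv ℝ a x v (gradient u x), gradient u x⟫
      + 2 * ⟪fderiv ℝ (gradient u) x v, flux a u x⟫ := by
  have h := fderiv_inner_apply ℝ ((contDiff_flux ha hu).differentiable (by norm_num) x)
    ((contDiff_gradient hu).differentiable (by norm_num) x) v
  have h2 : fderiv ℝ (en a u) x v = _ := h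
  rw [h2, fderiv_flux ha hu, inner_add_left, hs,
    real_inner_comm (fderiv ℝ (gradient u) x v) (flux a u x)]
  unfold flux
  ring

/-- the Rellich-Pohozaev field -/
def rell (a : EE n → EE n →L[ℝ] EE n) (u : EE n → ℝ) (Z : EE n → EE n) (x : EE n) : EE n :=
  en a u x • Z x - (2 * ⟪Z x, gradient u x⟫) • flux a u x

lemma contDiff_rell (ha : ContDiff ℝ 1 a) (hu : ContDiff ℝ 2 u) {Z : EE n → EE n}
    (hZ : ContDiff ℝ 1 Z) : ContDiff ℝ 1 (rell a u Z) :=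
  ((contDiff_en ha hu).smul hZ).sub
    ((contDiff_const.mul (hZ.inner ℝ (contDiff_gradient hu))).smul (contDiff_flux ha hu))

lemma dv_rell (ha : ContDiff ℝ 1 a) (hu : ContDiff ℝ 2 u)
    (hs : ∀ x v w, ⟪a x v, w⟫ = ⟪v, a x w⟫) {Z : EE n → EE n} (hZ : ContDiff ℝ 1 Z) (x : EE n) :
    dv (rell a u Z) x = ⟪fderiv ℝ a x (Z x) (gradient u x), gradient u x⟫ + en a u x * dv Z x
      - 2 * ⟪fderiv ℝ Z x (flux a u x), gradient u x⟫
      - 2 * ⟪Z x, gradient u x⟫ * dv (flux a u) x := by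
  have dZ := hZ.differentiable (by norm_num) x
  have dg := (contDiff_gradient hu).differentiable (by norm_num) x
  have dfl := (contDiff_flux ha hu).differentiable (by norm_num) x
  have de := (contDiff_en ha hu).differentiable (by norm_num) x
  have dI : DifferentiableAt ℝ (fun x => ⟪Z x, gradient u x⟫) x := dZ.inner ℝ dg
  have h1 : dv (rell a u Z) x = _ := dv_sub (de.smul dZ) ((dI.const_mul 2).smul dfl)
  rw [h1]
  have h2 : dv (fun y => en a u y • Z y) x = _ := dv_smul de dZ
  have h3 : dv (fun y => (2 * ⟪Z y, gradient u y⟫) • flux a u y) x = _ := dv_smul (dI.const_mul 2) dfl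
  rw [h2, h3, fderiv_en ha hu hs, fderiv_const_mul dI, ContinuousLinearMap.smul_apply,
    fderiv_inner_apply ℝ dZ dg, ← hess_symm hu, smul_eq_mul]
  ring

end


lemma integral_add3 {α : Type*} [MeasurableSpace α] {m : Measure α} {f g k : α → ℝ}
    (hf : Integrable f m) (hg : Integrable g m) (hk : Integrable k m) :
    ∫ x, (f x + g x + k x) ∂m = ∫ x, f x ∂m + ∫ x, g x ∂m + ∫ x, k x ∂m := by
  rw [← integral_add hf hg]
  exact integral_add (hf.add hg) hk

structure Fr {n : ℕ} (a : EE n → EE n →L[ℝ] EE n) (b Z : EE n → EE n) (μ ρ u : EE n → ℝ)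
    (K R : ℝ) : Prop where
  K1 : 1 ≤ K
  R0 : 0 < R
  R1 : R ≤ 1
  ha : ContDiff ℝ 1 a
  hu : ContDiff ℝ 2 u
  hN : ContDiff ℝ 1 (fun x => a x (b x))
  hZ : ContDiff ℝ 1 Z
  hb : Continuous b
  hμ : Continuous μ
  hρ : ContDiff ℝ 1 ρ
  dρ : ∀ x v, fderiv ℝ ρ x v = 2 * ⟪b x, v⟫
  ρlow : ∀ x, ‖x‖^2 ≤ K * ρ x
  ρup : ∀ x, ρ x ≤ K * ‖x‖^2
  sym : ∀ x v w, ⟪a x v, w⟫ = ⟪v, a x w⟫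
  ell : ∀ x v, ‖v‖^2 ≤ K * ⟪a x v, v⟫
  bda : ∀ x, ‖a x‖ ≤ K
  muZ : ∀ x, μ x • Z x = a x (b x)
  Zb : ∀ x, ⟪Z x, b x⟫ = ρ x
  dab : ∀ x, ρ x < R^2 → ‖fderiv ℝ a x‖ ≤ K
  eqn : ∀ x, ρ x < R^2 → |dv (flux a u) x| ≤ K * |u x|
  mulow : ∀ x, ρ x < R^2 → 1/2 ≤ μ x
  muup : ∀ x, ρ x < R^2 → μ x ≤ 2
  dN : ∀ x, ρ x < R^2 → |dv (fun x => a x (b x)) x - n * μ x| ≤ K * ‖x‖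
  dZ : ∀ x, ρ x < R^2 → ‖fderiv ℝ Z x - ContinuousLinearMap.id ℝ (EE n)‖ ≤ K * ‖x‖
  Zle : ∀ x, ρ x < R^2 → ‖Z x‖ ≤ K * ‖x‖
  ble : ∀ x, ‖b x‖ ≤ K * ‖x‖

section
variable {n : ℕ} {a : EE n → EE n →L[ℝ] EE n} {b Z : EE n → EE n} {μ ρ u : EE n → ℝ} {K R : ℝ}

def HH (μ ρ u : EE n → ℝ) (r : ℝ) : ℝ := ∫ x, (μ x * u x ^ 2) * WW ρ r x ^ 2
def EN (a : EE n → EE n →L[ℝ] EE n) (ρ u : EE n → ℝ) (r : ℝ) : ℝ := ∫ x, en a u x * WW ρ r x ^ 3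
def DD (a : EE n → EE n →L[ℝ] EE n) (ρ u : EE n → ℝ) (r : ℝ) : ℝ :=
  ∫ x, (en a u x + u x * dv (flux a u) x) * WW ρ r x ^ 3
def JJ (Z : EE n → EE n) (μ ρ u : EE n → ℝ) (r : ℝ) : ℝ :=
  ∫ x, (μ x * ⟪Z x, gradient u x⟫ ^ 2) * WW ρ r x ^ 2

namespace Fr
variable (h : Fr a b Z μ ρ u K R)
include h

lemma K0 : 0 < K := lt_of_lt_of_le one_pos h.K1

lemma intg {f : EE n → ℝ} (hf : Continuous f) (r : ℝ) (k : ℕ) :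
    Integrable (fun x => f x * WW ρ r x ^ (k+1)) :=
  integrable_WW h.hρ.continuous h.ρlow h.K0 r k hf

lemma int_mono {f g : EE n → ℝ} (hf : Continuous f) (hg : Continuous g) (r : ℝ) (k : ℕ)
    (hfg : ∀ x, ρ x < r^2 → f x ≤ g x) :
    ∫ x, f x * WW ρ r x ^ (k+1) ≤ ∫ x, g x * WW ρ r x ^ (k+1) := by
  apply integral_mono (h.intg hf r k) (h.intg hg r k)
  intro x
  by_cases hx : ρ x < r^2
  · exact mul_le_mul_of_nonneg_right (hfg x hx) (pow_nonneg (WW_nonneg r x) _)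
  · simp [WW_eq_zero (not_lt.mp hx)]

lemma cu : Continuous u := h.hu.continuous
lemma cg : Continuous (gradient u) := (contDiff_gradient h.hu).continuous
lemma cen : Continuous (en a u) := (contDiff_en h.ha h.hu).continuous
lemma cdf : Continuous (dv (flux a u)) := continuous_dv (contDiff_flux h.ha h.hu)
lemma cN : Continuous (dv (fun x => a x (b x))) := continuous_dv h.hN
lemma cZg : Continuous (fun x => ⟪Z x, gradient u x⟫) := h.hZ.continuous.inner h.cg

lemma grad_inner (x v : EE n) : fderiv ℝ u x v = ⟪gradient u x, v⟫ := by
  rw [inner_gradient_left]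

lemma ρnn (x : EE n) : 0 ≤ ρ x :=
  nonneg_of_mul_nonneg_right ((sq_nonneg _).trans (h.ρlow x)) h.K0

lemma norm_le {r : ℝ} (hr : 0 < r) {x : EE n} (hx : ρ x < r^2) : ‖x‖ ≤ K * r := by
  apply le_of_sq_le_sq _ (by have := h.K0; positivity)
  have h1 := h.ρlow x
  have h2 := h.K1
  have h3 : K * ρ x ≤ K * r^2 := by gcongr
  have h4 : K * r^2 ≤ (K*r)^2 := by nlinarith [mul_nonneg (sub_nonneg.mpr h2) (mul_nonneg h.K0.le (sq_nonneg r))]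
  linarith

lemma bflux (x : EE n) : ⟪b x, flux a u x⟫ = μ x * ⟪Z x, gradient u x⟫ := by
  unfold flux
  rw [← h.sym, ← h.muZ, inner_smul_left]; simp

lemma DD_eq (r : ℝ) : DD a ρ u r = 6 * ∫ x, (u x * (μ x * ⟪Z x, gradient u x⟫)) * WW ρ r x ^ 2 := by
  have hX : ContDiff ℝ 1 (fun x => u x • flux a u x) :=
    (h.hu.of_le (by norm_num)).smul (contDiff_flux h.ha h.hu)
  have := ibp (contDiff_WW h.hρ r 1) (hasCompactSupport_WW h.ρlow h.K0 r 2) hX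
  have h1 : ∀ x, dv (fun x => u x • flux a u x) x = en a u x + u x * dv (flux a u) x := by
    intro x
    rw [dv_smul (h.hu.differentiable (by norm_num) x)
      ((contDiff_flux h.ha h.hu).differentiable (by norm_num) x), h.grad_inner, real_inner_comm]
    rfl
  simp only [h1, fderiv_WW h.hρ, h.dρ, inner_smul_right, h.bflux] at this
  unfold DD
  rw [this, ← integral_const_mul, ← integral_neg]
  congr 1; ext x
  push_cast; ring

lemma HH_deriv (r : ℝ) : ∃ hh, HasDerivAt (HH μ ρ u) hh r ∧ r * hh = (4 + n) * HH μ ρ u r +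
    (∫ x, (u x ^ 2 * (dv (fun x => a x (b x)) x - n * μ x)) * WW ρ r x ^ 2) + DD a ρ u r / 3 := by
  have hcm : Continuous (fun x => μ x * u x ^ 2) := h.hμ.mul (h.cu.pow 2)
  refine ⟨_, hasDerivAt_int_WW h.hρ.continuous h.ρlow h.K0 0 hcm r, ?_⟩
  have hX : ContDiff ℝ 1 (fun x => (u x ^ 2) • a x (b x)) :=
    ((h.hu.of_le (by norm_num)).pow 2).smul h.hN
  have hi := ibp (contDiff_WW h.hρ r 0) (hasCompactSupport_WW h.ρlow h.K0 r 1) hX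
  have h1 : ∀ x, dv (fun x => (u x ^ 2) • a x (b x)) x
      = 2 * u x * (μ x * ⟪Z x, gradient u x⟫) + u x ^ 2 * dv (fun x => a x (b x)) x := by
    intro x
    have hud := h.hu.differentiable (by norm_num) x
    have h0 : dv (fun x => (u x ^ 2) • a x (b x)) x = _ :=
      dv_smul (f := fun x => u x ^ 2) (hud.pow 2) (h.hN.differentiable (by norm_num) x)
    rw [h0]
    have : fderiv ℝ (fun x => u x ^ 2) x (a x (b x)) = 2 * u x * ⟪gradient u x, a x (b x)⟫ := by
      have h2 := (hud.hasFDerivAt.pow 2).fderiv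
      have h3 : fderiv ℝ (fun x => u x ^ 2) x = _ := h2
      rw [h3, ← h.grad_inner]; simp
    rw [this, ← h.muZ, inner_smul_right, real_inner_comm]
  have h2 : ∀ x, ⟪b x, a x (b x)⟫ = μ x * ρ x := by
    intro x
    rw [← h.muZ, inner_smul_right, real_inner_comm, h.Zb]
  simp only [h1, fderiv_WW h.hρ, h.dρ, inner_smul_right, h2] at hi
  rw [h.DD_eq]
  unfold HH
  have e1 : r * (∫ x, (μ x * u x ^ 2) * (2 * r * ((0:ℕ)+2) * WW ρ r x ^ (0+1))) =
     ∫ x, (4 * ((μ x * u x ^ 2) * WW ρ r x ^ 2) + (4 * (u x ^ 2 * (μ x * ρ x))) * WW ρ r x ^ (0+1)) := by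
    rw [← integral_const_mul]
    congr 1; ext x
    have := WW_mul (ρ := ρ) r x
    push_cast
    linear_combination (4 * (μ x * u x ^ 2)) * this
  have hcρ := h.hρ.continuous
  have hcu := h.cu
  have hcμ := h.hμ
  have hcN := h.cN
  have hZg := h.cZg
  rw [e1, integral_add ((h.intg (by fun_prop) r 1).const_mul 4) (h.intg (by fun_prop) r 0),
    integral_const_mul]
  have e2 : - ∫ x, -(((0:ℕ) + 2) * WW ρ r x ^ (0 + 1) * (2 * (u x ^ 2 * (μ x * ρ x))))
      = ∫ x, (4 * (u x ^ 2 * (μ x * ρ x))) * WW ρ r x ^ (0+1) := by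
    rw [← integral_neg]; congr 1; ext x; push_cast; ring
  rw [e2] at hi
  rw [← hi]
  have e3 : ∀ x, (2 * u x * (μ x * ⟪Z x, gradient u x⟫) + u x ^ 2 * dv (fun x => a x (b x)) x) * WW ρ r x ^ (0+2)
      = (n * ((μ x * u x ^ 2) * WW ρ r x ^ 2) + (u x ^ 2 * (dv (fun x => a x (b x)) x - n * μ x)) * WW ρ r x ^ 2)
      + 2 * ((u x * (μ x * ⟪Z x, gradient u x⟫)) * WW ρ r x ^ 2) := by
    intro x; ring
  simp only [e3]
  have i1 : Integrable (fun x => (n:ℝ) * ((μ x * u x ^ 2) * WW ρ r x ^ 2)) :=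
    (h.intg (by fun_prop) r 1).const_mul _
  have i2 : Integrable (fun x => (u x ^ 2 * (dv (fun x => a x (b x)) x - n * μ x)) * WW ρ r x ^ 2) :=
    h.intg (by fun_prop) r 1
  have i3 : Integrable (fun x => 2 * ((u x * (μ x * ⟪Z x, gradient u x⟫)) * WW ρ r x ^ 2)) :=
    (h.intg (by fun_prop) r 1).const_mul _
  rw [integral_add3 i1 i2 i3, integral_const_mul, integral_const_mul]
  ring

lemma EN_deriv (r : ℝ) : ∃ ee, HasDerivAt (EN a ρ u) ee r ∧ r * ee = 6 * EN a ρ u r +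
    12 * JJ Z μ ρ u r + ∫ x, dv (rell a u Z) x * WW ρ r x ^ 3 := by
  refine ⟨_, hasDerivAt_int_WW h.hρ.continuous h.ρlow h.K0 1 h.cen r, ?_⟩
  have hX := contDiff_rell h.ha h.hu h.hZ
  have hi := ibp (contDiff_WW h.hρ r 1) (hasCompactSupport_WW h.ρlow h.K0 r 2) hX
  have h2 : ∀ x, ⟪b x, rell a u Z x⟫ = en a u x * ρ x - 2 * (μ x * ⟪Z x, gradient u x⟫ ^ 2) := by
    intro x
    unfold rell
    rw [inner_sub_right, inner_smul_right, inner_smul_right, h.bflux, real_inner_comm, h.Zb]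
    ring
  simp only [fderiv_WW h.hρ, h.dρ, h2] at hi
  rw [hi]
  unfold EN JJ
  have hcρ := h.hρ.continuous
  have hcu := h.cu
  have hcμ := h.hμ
  have hce := h.cen
  have hZg := h.cZg
  rw [← integral_const_mul, ← integral_const_mul, ← integral_const_mul, ← integral_neg]
  have i1 : Integrable (fun x => (6:ℝ) * (en a u x * WW ρ r x ^ 3)) :=
    (h.intg (by fun_prop) r 2).const_mul _
  have i2 : Integrable (fun x => (12:ℝ) * ((μ x * ⟪Z x, gradient u x⟫ ^ 2) * WW ρ r x ^ 2)) :=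
    (h.intg (by fun_prop) r 1).const_mul _
  have i3 : Integrable (fun x => - -((((1:ℕ):ℝ) + 2) * WW ρ r x ^ (1 + 1) * (2 * (en a u x * ρ x - 2 * (μ x * ⟪Z x, gradient u x⟫ ^ 2))))) := by
    have := h.intg (f := fun x => 6 * (en a u x * ρ x - 2 * (μ x * ⟪Z x, gradient u x⟫ ^ 2))) (by fun_prop) r 1
    refine this.congr (Filter.Eventually.of_forall fun x => ?_)
    simp only; push_cast; ring
  rw [← integral_add3 i1 i2 i3]
  congr 1; ext x
  have := WW_mul (ρ := ρ) r x
  push_cast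
  linear_combination (6 * en a u x * WW ρ r x) * this

end Fr
end

namespace Fr
variable {n : ℕ} {a : EE n → EE n →L[ℝ] EE n} {b Z : EE n → EE n} {μ ρ u : EE n → ℝ} {K R : ℝ}
variable (h : Fr a b Z μ ρ u K R)
include h

lemma en_nonneg (x : EE n) : 0 ≤ en a u x :=
  nonneg_of_mul_nonneg_right ((sq_nonneg _).trans (h.ell x (gradient u x))) h.K0

lemma grad_le (x : EE n) : ‖gradient u x‖ ^ 2 ≤ K * en a u x := h.ell x (gradient u x)

lemma lt_R {r : ℝ} (hr : 0 < r) (hrR : r ≤ R) {x : EE n} (hx : ρ x < r^2) : ρ x < R^2 :=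
  lt_of_lt_of_le hx (by gcongr)

lemma u_le {x : EE n} (hx : ρ x < R^2) : u x ^ 2 ≤ 2 * (μ x * u x ^ 2) := by
  nlinarith [h.mulow x hx, sq_nonneg (u x)]

lemma HH_nonneg {r : ℝ} (hr : 0 < r) (hrR : r ≤ R) : 0 ≤ HH μ ρ u r := by
  have hcu := h.cu
  have hcμ := h.hμ
  have := h.int_mono (f := fun _ => 0) (g := fun x => μ x * u x ^ 2) (by fun_prop) (by fun_prop) r 1
    (fun x hx => by
      have := h.mulow x (h.lt_R hr hrR hx)
      positivity)
  unfold HH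
  simpa using this

lemma EN_nonneg (r : ℝ) : 0 ≤ EN a ρ u r :=
  integral_nonneg fun x => mul_nonneg (h.en_nonneg x) (pow_nonneg (WW_nonneg r x) _)

/-- `∫ μ u² W³ ≤ r² H`. -/
lemma int3_le {r : ℝ} (hr : 0 < r) (hrR : r ≤ R) :
    ∫ x, (μ x * u x ^ 2) * WW ρ r x ^ 3 ≤ r^2 * HH μ ρ u r := by
  have hcu := h.cu
  have hcμ := h.hμ
  unfold HH
  rw [← integral_const_mul]
  apply integral_mono (h.intg (by fun_prop) r 2) ((h.intg (by fun_prop) r 1).const_mul _)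
  intro x
  simp only
  by_cases hx : ρ x < r^2
  · have h1 := h.mulow x (h.lt_R hr hrR hx)
    have h2 := WW_le (r := r) (h.ρnn x)
    have h3 := WW_nonneg (ρ := ρ) r x
    calc (μ x * u x ^ 2) * WW ρ r x ^ 3 = WW ρ r x * ((μ x * u x ^ 2) * WW ρ r x ^ 2) := by ring
      _ ≤ r^2 * ((μ x * u x ^ 2) * WW ρ r x ^ 2) := by gcongr
  · simp [WW_eq_zero (not_lt.mp hx)]

lemma err1 {r : ℝ} (hr : 0 < r) (hrR : r ≤ R) :
    |∫ x, (u x ^ 2 * (dv (fun x => a x (b x)) x - n * μ x)) * WW ρ r x ^ 2|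
      ≤ (4 + n) * K^4 * r * HH μ ρ u r := by
  have hcu := h.cu
  have hcμ := h.hμ
  have hcN := h.cN
  have hK := h.K1
  have key : ∀ x, ρ x < r^2 → |u x ^ 2 * (dv (fun x => a x (b x)) x - n * μ x)|
      ≤ (4 + n) * K^4 * r * (μ x * u x ^ 2) := by
    intro x hx
    have hx' := h.lt_R hr hrR hx
    have h1 := h.dN x hx'
    have h2 := h.norm_le hr hx
    have h3 := h.u_le hx'
    rw [abs_mul, abs_of_nonneg (sq_nonneg (u x))]
    have hm : 0 ≤ μ x * u x ^ 2 := by have := h.mulow x hx'; positivity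
    calc u x ^ 2 * |dv (fun x => a x (b x)) x - n * μ x| ≤ (2 * (μ x * u x ^ 2)) * (K * (K * r)) := by
          gcongr
          exact h1.trans (by gcongr)
      _ = 2 * K^2 * r * (μ x * u x ^ 2) := by ring
      _ ≤ (4 + n) * K^4 * r * (μ x * u x ^ 2) := by
          gcongr
          · linarith [(Nat.cast_nonneg n : (0:ℝ) ≤ n)]
          · norm_num
  unfold HH
  rw [← integral_const_mul, abs_le, ← integral_neg]
  constructor
  · have := h.int_mono (f := fun x => -((4 + n) * K^4 * r * (μ x * u x ^ 2)))
      (g := fun x => u x ^ 2 * (dv (fun x => a x (b x)) x - n * μ x)) (by fun_prop) (by fun_prop) r 1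
      (fun x hx => (abs_le.mp (key x hx)).1)
    refine le_trans (le_of_eq ?_) this
    congr 1; ext x; ring
  · have := h.int_mono (g := fun x => ((4 + n) * K^4 * r * (μ x * u x ^ 2)))
      (f := fun x => u x ^ 2 * (dv (fun x => a x (b x)) x - n * μ x)) (by fun_prop) (by fun_prop) r 1
      (fun x hx => (abs_le.mp (key x hx)).2)
    refine le_trans this (le_of_eq ?_)
    congr 1; ext x; ring

lemma err3 {r : ℝ} (hr : 0 < r) (hrR : r ≤ R) :
    |DD a ρ u r - EN a ρ u r| ≤ (4 + n) * K^4 * r * HH μ ρ u r := by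
  have hcu := h.cu
  have hcμ := h.hμ
  have hcN := h.cdf
  have hce := h.cen
  have hK := h.K1
  have key : ∀ x, ρ x < r^2 → |u x * dv (flux a u) x| ≤ 2 * K * (μ x * u x ^ 2) := by
    intro x hx
    have hx' := h.lt_R hr hrR hx
    have h3 := h.u_le hx'
    rw [abs_mul]
    calc |u x| * |dv (flux a u) x| ≤ |u x| * (K * |u x|) := by gcongr; exact h.eqn x hx'
      _ = K * u x ^ 2 := by rw [← sq_abs]; ring
      _ ≤ K * (2 * (μ x * u x ^ 2)) := by gcongr
      _ = _ := by ring
  have hD : DD a ρ u r - EN a ρ u r = ∫ x, (u x * dv (flux a u) x) * WW ρ r x ^ 3 := by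
    unfold DD EN
    rw [← integral_sub (h.intg (by fun_prop) r 2) (h.intg (by fun_prop) r 2)]
    congr 1; ext x; ring
  have hH := h.HH_nonneg hr hrR
  have hfin : 2 * K * ∫ x, (μ x * u x ^ 2) * WW ρ r x ^ 3 ≤ (4 + n) * K^4 * r * HH μ ρ u r := by
    calc 2 * K * ∫ x, (μ x * u x ^ 2) * WW ρ r x ^ 3 ≤ 2 * K * (r^2 * HH μ ρ u r) := by
          gcongr; exact h.int3_le hr hrR
      _ = 2 * K^1 * (r * r) * HH μ ρ u r := by ring
      _ ≤ (4 + n) * K^4 * (r * 1) * HH μ ρ u r := by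
          gcongr
          · linarith [(Nat.cast_nonneg n : (0:ℝ) ≤ n)]
          · norm_num
          · exact hrR.trans h.R1
      _ = _ := by ring
  refine le_trans ?_ hfin
  rw [hD, ← integral_const_mul, abs_le, ← integral_neg]
  constructor
  · have := h.int_mono (f := fun x => -(2 * K * (μ x * u x ^ 2)))
      (g := fun x => u x * dv (flux a u) x) (by fun_prop) (by fun_prop) r 2
      (fun x hx => (abs_le.mp (key x hx)).1)
    refine le_trans (le_of_eq ?_) this
    congr 1; ext x; ring
  · have := h.int_mono (g := fun x => (2 * K * (μ x * u x ^ 2)))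
      (f := fun x => u x * dv (flux a u) x) (by fun_prop) (by fun_prop) r 2
      (fun x hx => (abs_le.mp (key x hx)).2)
    refine le_trans this (le_of_eq ?_)
    congr 1; ext x; ring

lemma flux_le (x : EE n) : ‖flux a u x‖ ≤ K * ‖gradient u x‖ :=
  ((a x).le_opNorm _).trans (by gcongr; exact h.bda x)

lemma dv_rell_ge {r : ℝ} (hr : 0 < r) (hrR : r ≤ R) {x : EE n} (hx : ρ x < r^2) :
    (n - 2) * en a u x - (4 + n) * K^4 * r * (en a u x + μ x * u x ^ 2) ≤ dv (rell a u Z) x := by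
  have hx' := h.lt_R hr hrR hx
  have hK := h.K1
  have hK0 := h.K0
  have hn := h.norm_le hr hx
  have he := h.en_nonneg x
  have hg := h.grad_le x
  set g := gradient u x with hgdef
  have hZ : ‖Z x‖ ≤ K^2 * r := (h.Zle x hx').trans (by nlinarith)
  have hdZ : ‖fderiv ℝ Z x - ContinuousLinearMap.id ℝ (EE n)‖ ≤ K^2 * r :=
    (h.dZ x hx').trans (by nlinarith)
  have hg0 := norm_nonneg g
  rw [dv_rell h.ha h.hu h.sym h.hZ]
  rw [← hgdef]
  -- term 1
  have t1 : -(K^4 * r * en a u x) ≤ ⟪fderiv ℝ a x (Z x) g, g⟫ := by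
    have : |⟪fderiv ℝ a x (Z x) g, g⟫| ≤ K^4 * r * en a u x := by
      calc |⟪fderiv ℝ a x (Z x) g, g⟫| ≤ ‖fderiv ℝ a x (Z x) g‖ * ‖g‖ := abs_real_inner_le_norm _ _
        _ ≤ (‖fderiv ℝ a x (Z x)‖ * ‖g‖) * ‖g‖ := by gcongr; exact ContinuousLinearMap.le_opNorm _ _
        _ ≤ ((‖fderiv ℝ a x‖ * ‖Z x‖) * ‖g‖) * ‖g‖ := by
            gcongr; exact ContinuousLinearMap.le_opNorm _ _
        _ ≤ ((K * (K^2 * r)) * ‖g‖) * ‖g‖ := by gcongr; exact h.dab x hx'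
        _ = K^3 * r * ‖g‖^2 := by ring
        _ ≤ K^3 * r * (K * en a u x) := by gcongr
        _ = _ := by ring
    linarith [(abs_le.mp this).1]
  -- term 2
  have t2 : n * en a u x - n * K^4 * r * en a u x ≤ en a u x * dv Z x := by
    have h1 := abs_tr_le (fderiv ℝ Z x - ContinuousLinearMap.id ℝ (EE n))
    rw [tr_sub, tr_id, ← dv_eq_tr] at h1
    have h2 : n * ‖fderiv ℝ Z x - ContinuousLinearMap.id ℝ (EE n)‖ ≤ n * (K^4 * r) := by
      gcongr
      refine hdZ.trans ?_
      gcongr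
      norm_num
    have h3 := (abs_le.mp (h1.trans h2)).1
    nlinarith
  -- term 3
  have t3 : -2 * en a u x - 2 * (K^4 * r * en a u x) ≤ - 2 * ⟪fderiv ℝ Z x (flux a u x), g⟫ := by
    have e1 : ⟪fderiv ℝ Z x (flux a u x), g⟫ = en a u x +
        ⟪(fderiv ℝ Z x - ContinuousLinearMap.id ℝ (EE n)) (flux a u x), g⟫ := by
      have : (fderiv ℝ Z x - ContinuousLinearMap.id ℝ (EE n)) (flux a u x)
        = fderiv ℝ Z x (flux a u x) - flux a u x := rfl
      rw [this, inner_sub_left]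
      unfold en
      rw [← hgdef]; ring
    have : |⟪(fderiv ℝ Z x - ContinuousLinearMap.id ℝ (EE n)) (flux a u x), g⟫| ≤ K^4 * r * en a u x := by
      calc _ ≤ ‖(fderiv ℝ Z x - ContinuousLinearMap.id ℝ (EE n)) (flux a u x)‖ * ‖g‖ :=
            abs_real_inner_le_norm _ _
        _ ≤ (‖fderiv ℝ Z x - ContinuousLinearMap.id ℝ (EE n)‖ * ‖flux a u x‖) * ‖g‖ := by
            gcongr; exact ContinuousLinearMap.le_opNorm _ _
        _ ≤ ((K^2 * r) * (K * ‖g‖)) * ‖g‖ := by gcongr; exact h.flux_le x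
        _ = K^3 * r * ‖g‖^2 := by ring
        _ ≤ K^3 * r * (K * en a u x) := by gcongr
        _ = _ := by ring
    linarith [(abs_le.mp this).2]
  -- term 4
  have t4 : -(K^4 * r * en a u x) - 2 * (K^4 * r * (μ x * u x ^ 2)) ≤ - (2 * ⟪Z x, g⟫ * dv (flux a u) x) := by
    have : |2 * ⟪Z x, g⟫ * dv (flux a u) x| ≤ K^4 * r * en a u x + 2 * (K^4 * r * (μ x * u x ^ 2)) := by
      rw [abs_mul, abs_mul, abs_two]
      calc 2 * |⟪Z x, g⟫| * |dv (flux a u) x| ≤ 2 * ((K^2 * r) * ‖g‖) * (K * |u x|) := by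
            gcongr
            · exact (abs_real_inner_le_norm _ _).trans (by gcongr)
            · exact h.eqn x hx'
        _ = K^3 * r * (2 * ‖g‖ * |u x|) := by ring
        _ ≤ K^3 * r * (‖g‖^2 + |u x|^2) := by gcongr; exact two_mul_le_add_sq _ _
        _ ≤ K^3 * r * (K * en a u x + 2 * (μ x * u x ^ 2)) := by
            gcongr; rw [sq_abs]; exact h.u_le hx'
        _ = K^4 * r * en a u x + 2 * (K^3 * r * (μ x * u x ^ 2)) := by ring
        _ ≤ _ := by
            have hm : 0 ≤ μ x * u x ^ 2 := by have := h.mulow x hx'; positivity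
            gcongr
            norm_num
    linarith [(abs_le.mp this).2]
  have hm : 0 ≤ K^4 * r * (μ x * u x ^ 2) := by have := h.mulow x hx'; positivity
  have hm2 : 0 ≤ (n:ℝ) * (K^4 * r * (μ x * u x ^ 2)) := by positivity
  linarith

lemma err2 {r : ℝ} (hr : 0 < r) (hrR : r ≤ R) :
    (n - 2) * EN a ρ u r - (4 + n) * K^4 * r * (EN a ρ u r + HH μ ρ u r)
      ≤ ∫ x, dv (rell a u Z) x * WW ρ r x ^ 3 := by
  have hcu := h.cu
  have hcμ := h.hμ
  have hce := h.cen
  have hcr := continuous_dv (contDiff_rell h.ha h.hu h.hZ)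
  have := h.int_mono (f := fun x => (n - 2) * en a u x - (4 + n) * K^4 * r * (en a u x + μ x * u x ^ 2))
    (g := dv (rell a u Z)) (by fun_prop) hcr r 2 (fun x hx => h.dv_rell_ge hr hrR hx)
  refine le_trans ?_ this
  have e : ∀ x, ((n - 2) * en a u x - (4 + n) * K^4 * r * (en a u x + μ x * u x ^ 2)) * WW ρ r x ^ (2+1)
    = ((n - 2) - (4 + n) * K^4 * r) * (en a u x * WW ρ r x ^ 3) +
      (-((4 + n) * K^4 * r)) * ((μ x * u x ^ 2) * WW ρ r x ^ 3) := by intro x; ring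
  simp only [e]
  rw [integral_add ((h.intg (by fun_prop) r 2).const_mul _) ((h.intg (by fun_prop) r 2).const_mul _),
    integral_const_mul, integral_const_mul]
  have h3 : ∫ x, (μ x * u x ^ 2) * WW ρ r x ^ 3 ≤ HH μ ρ u r := by
    refine (h.int3_le hr hrR).trans ?_
    have hr1 := hrR.trans h.R1
    have : r^2 ≤ 1 := by nlinarith
    have := h.HH_nonneg hr hrR
    nlinarith
  have h4 : 0 ≤ (4 + n) * K^4 * r := by have := h.K0; positivity
  have : EN a ρ u r = ∫ x, en a u x * WW ρ r x ^ 3 := rfl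
  rw [← this]
  have e5 := mul_le_mul_of_nonneg_left h3 h4
  linarith

lemma CS {r : ℝ} (hr : 0 < r) (hrR : r ≤ R) : DD a ρ u r ^ 2 ≤ 36 * HH μ ρ u r * JJ Z μ ρ u r := by
  have hcu := h.cu
  have hcμ := h.hμ
  have hcZ := h.cZg
  rw [h.DD_eq]
  set P := ∫ x, (u x * (μ x * ⟪Z x, gradient u x⟫)) * WW ρ r x ^ 2 with hP
  have key : ∀ t : ℝ, 0 ≤ HH μ ρ u r * (t * t) + (2 * P) * t + JJ Z μ ρ u r := by
    intro t
    have h1 := h.int_mono (f := fun _ => 0) (g := fun x => μ x * (t * u x + ⟪Z x, gradient u x⟫)^2)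
      (by fun_prop) (by fun_prop) r 1
      (fun x hx => by have := h.mulow x (h.lt_R hr hrR hx); positivity)
    simp only [zero_mul, integral_zero] at h1
    refine h1.trans (le_of_eq ?_)
    have e : ∀ x, (μ x * (t * u x + ⟪Z x, gradient u x⟫)^2) * WW ρ r x ^ (1+1) =
      (t * t) * ((μ x * u x ^ 2) * WW ρ r x ^ 2)
      + (2 * t) * ((u x * (μ x * ⟪Z x, gradient u x⟫)) * WW ρ r x ^ 2)
      + (μ x * ⟪Z x, gradient u x⟫ ^ 2) * WW ρ r x ^ 2 := by intro x; ring
    simp only [e]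
    rw [integral_add3 ((h.intg (by fun_prop) r 1).const_mul _)
      ((h.intg (by fun_prop) r 1).const_mul _) (h.intg (by fun_prop) r 1),
      integral_const_mul, integral_const_mul]
    unfold HH JJ
    rw [hP]; ring
  have hd := discrim_le_zero key
  unfold discrim at hd
  nlinarith

end Fr


lemma ode_aux {H E : ℝ → ℝ} {m : ℕ} {C R : ℝ} (hR : 0 < R) (hR1 : R ≤ 1) (hC : 0 ≤ C)
    (hyp : ∀ r, 0 < r → r ≤ R → ∃ hh ee D J, HasDerivAt H hh r ∧ HasDerivAt E ee r ∧ 0 ≤ H r ∧ 0 ≤ E r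
      ∧ 0 ≤ J ∧ |r * hh - m * H r - D / 3| ≤ C * r * H r ∧ |D - E r| ≤ C * r * H r
      ∧ D^2 ≤ 36 * H r * J ∧ m * E r + 12 * J - C * r * (E r + H r) ≤ r * ee)
    (hHR : 0 < H R) {r s : ℝ} (hr : 0 < r) (hrs : r ≤ s) (hs : s ≤ R) {ε : ℝ} (hε : 0 < ε) :
    H s + ε * s^m ≤ (s/r) ^ (m + 2*C + (E R / H R + 1) * Real.exp (3*C)) * (H r + ε * r^m)
    ∧ E s ≤ ((E R / H R + 1) * Real.exp (3*C)) * (H s + ε * s^m) := by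
  set Γ := m + 2*C + (E R / H R + 1) * Real.exp (3*C) with hΓ
  choose! hh ee D J hH hE h1 h2 h3 h4 h5 h6 h7 using hyp
  set P : ℝ → ℝ := fun r => H r + ε * r^m with hP
  have Ppos : ∀ r, 0 < r → r ≤ R → 0 < P r := fun r h0 hr => by
    have := h1 r h0 hr
    have : 0 < ε * r^m := by positivity
    simp only [hP]; linarith
  have hHP : ∀ r, 0 < r → H r ≤ P r := fun r h0 => by
    have : 0 < ε * r^m := by positivity
    simp only [hP]; linarith
  have Pder : ∀ r, 0 < r → r ≤ R → HasDerivAt P (hh r + ε * (m * r^(m-1))) r := fun r h0 hr =>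
    (hH r h0 hr).add ((hasDerivAt_pow m r).const_mul ε)
  have Pder2 : ∀ r, 0 < r → r ≤ R → r * (hh r + ε * (m * r^(m-1))) = m * P r + (r * hh r - m * H r) := by
    intro r h0 hr
    have : (m:ℝ) * r^(m-1) * r = m * r^m := by
      rcases Nat.eq_zero_or_pos m with h | h
      · simp [h]
      · rw [mul_assoc, ← pow_succ, Nat.sub_add_cancel h]
    simp only [hP]
    linear_combination ε * this
  -- frequency
  set Q : ℝ → ℝ := fun r => (E r / P r + 1) * Real.exp (3*C*r) with hQ
  have Qder : ∀ r, 0 < r → r ≤ R → HasDerivAt Q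
      (((ee r * P r - E r * (hh r + ε * (m * r^(m-1)))) / P r ^ 2) * Real.exp (3*C*r)
        + (E r / P r + 1) * (Real.exp (3*C*r) * (3 * C))) r := by
    intro r h0 hr
    have e1 := ((hE r h0 hr).div (Pder r h0 hr) (Ppos r h0 hr).ne').add_const 1
    have e2 : HasDerivAt (fun r => Real.exp (3*C*r)) (Real.exp (3*C*r) * (3*C)) r := by
      have := ((hasDerivAt_id r).const_mul (3*C)).exp
      simpa using this
    exact e1.mul e2
  have Qnn : ∀ r, 0 < r → r ≤ R → 0 ≤ (((ee r * P r - E r * (hh r + ε * (m * r^(m-1)))) / P r ^ 2) * Real.exp (3*C*r)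
        + (E r / P r + 1) * (Real.exp (3*C*r) * (3 * C))) := by
    intro r h0 hr
    have hp := Ppos r h0 hr
    have hhp := hHP r h0
    have g1 := h1 r h0 hr
    have g2 := h2 r h0 hr
    have g3 := h3 r h0 hr
    have g4 := abs_le.mp (h4 r h0 hr)
    have g5 := abs_le.mp (h5 r h0 hr)
    have g6 := h6 r h0 hr
    have g7 := h7 r h0 hr
    have hd := Pder2 r h0 hr
    set pp := hh r + ε * (m * r^(m-1))
    have key : -(3 * C * (E r + P r) * P r) * r ≤ (ee r * P r - E r * pp) * r := by
      have k1 : (m * E r + 12 * J r - C * r * (E r + H r)) * P r ≤ r * ee r * P r := by gcongr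
      have k2 : E r * (r * pp) ≤ E r * (m * P r + C * r * H r + D r / 3) := by
        gcongr
        linarith [g4.2]
      have k3 : 12 * J r * H r ≤ 12 * J r * P r := by gcongr
      have k4 : - (C * r * H r) * E r ≤ (D r - E r) * E r :=
        mul_le_mul_of_nonneg_right g5.1 g2
      have k5 : 0 ≤ C * r := by positivity
      have k6 : C * r * (E r * H r) ≤ C * r * (E r * P r) := by gcongr
      have k7 : C * r * (H r * P r) ≤ C * r * (P r * P r) := by gcongr
      have k8 : 0 ≤ C * r * (E r * P r) := by positivity
      have k9 : 0 ≤ C * r * (P r * P r) := by positivity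
      nlinarith [sq_nonneg (D r - E r)]
    have key2 : -(3 * C * (E r + P r) * P r) ≤ (ee r * P r - E r * pp) := le_of_mul_le_mul_right key h0
    have : ((ee r * P r - E r * pp) / P r ^ 2) * Real.exp (3*C*r)
        + (E r / P r + 1) * (Real.exp (3*C*r) * (3 * C)) =
        Real.exp (3*C*r) / P r ^ 2 * ((ee r * P r - E r * pp) + 3 * C * (E r + P r) * P r) := by
      field_simp
    rw [this]
    apply mul_nonneg (by positivity)
    linarith
  have Qmono : MonotoneOn Q (Ioc 0 R) := by
    apply monotoneOn_of_deriv_nonneg (convex_Ioc 0 R)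
    · intro r hr; exact (Qder r hr.1 hr.2).continuousAt.continuousWithinAt
    · intro r hr; rw [interior_Ioc] at hr
      exact (Qder r hr.1 hr.2.le).differentiableAt.differentiableWithinAt
    · intro r hr; rw [interior_Ioc] at hr
      rw [(Qder r hr.1 hr.2.le).deriv]; exact Qnn r hr.1 hr.2.le
  have Nle : ∀ r, 0 < r → r ≤ R → E r / P r ≤ (E R / H R + 1) * Real.exp (3*C) := by
    intro r h0 hr
    have := Qmono ⟨h0, hr⟩ ⟨hR, le_rfl⟩ hr
    simp only [hQ] at this
    have n1 : 0 ≤ E r / P r := div_nonneg (h2 r h0 hr) (Ppos r h0 hr).le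
    have n2 : (1:ℝ) ≤ Real.exp (3*C*r) := Real.one_le_exp (by positivity)
    have n3 : E R / P R ≤ E R / H R := by
      gcongr
      · exact h2 R hR le_rfl
      · exact hHP R hR
    have n4 : Real.exp (3*C*R) ≤ Real.exp (3*C) := by
      apply Real.exp_le_exp.mpr; nlinarith
    have n5 : 0 ≤ E R / H R := div_nonneg (h2 R hR le_rfl) hHR.le
    calc E r / P r ≤ (E r / P r + 1) * Real.exp (3*C*r) := by nlinarith
      _ ≤ _ := this
      _ ≤ (E R / H R + 1) * Real.exp (3*C) := by gcongr
  -- doubling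
  set T : ℝ → ℝ := fun r => P r * r ^ (-Γ) with hT
  have Tder : ∀ r, 0 < r → r ≤ R → HasDerivAt T
      ((hh r + ε * (m * r^(m-1))) * r ^ (-Γ) + P r * (-Γ * r ^ (-Γ - 1))) r := by
    intro r h0 hr
    exact (Pder r h0 hr).mul (Real.hasDerivAt_rpow_const (Or.inl h0.ne'))
  have Tnp : ∀ r, 0 < r → r ≤ R →
      ((hh r + ε * (m * r^(m-1))) * r ^ (-Γ) + P r * (-Γ * r ^ (-Γ - 1))) ≤ 0 := by
    intro r h0 hr
    have hp := Ppos r h0 hr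
    have hhp := hHP r h0
    have g1 := h1 r h0 hr
    have g2 := h2 r h0 hr
    have g4 := abs_le.mp (h4 r h0 hr)
    have g5 := abs_le.mp (h5 r h0 hr)
    have hd := Pder2 r h0 hr
    have hN := Nle r h0 hr
    rw [div_le_iff₀ hp] at hN
    set pp := hh r + ε * (m * r^(m-1))
    have e1 : r ^ (-Γ) = r * r ^ (-Γ - 1) := by
      rw [Real.rpow_sub_one h0.ne']; field_simp
    rw [e1]
    have : 0 < r ^ (-Γ - 1) := Real.rpow_pos_of_pos h0 _
    have k : r * pp ≤ Γ * P r := by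
      have k1 : C * r * H r ≤ C * 1 * P r := by gcongr; linarith
      have : 0 ≤ C * P r := by positivity
      rw [hΓ]
      nlinarith
    nlinarith
  have Tanti : AntitoneOn T (Ioc 0 R) := by
    apply antitoneOn_of_deriv_nonpos (convex_Ioc 0 R)
    · intro r hr; exact (Tder r hr.1 hr.2).continuousAt.continuousWithinAt
    · intro r hr; rw [interior_Ioc] at hr
      exact (Tder r hr.1 hr.2.le).differentiableAt.differentiableWithinAt
    · intro r hr; rw [interior_Ioc] at hr
      rw [(Tder r hr.1 hr.2.le).deriv]; exact Tnp r hr.1 hr.2.le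
  have hs0 : 0 < s := hr.trans_le hrs
  have := Tanti ⟨hr, hrs.trans hs⟩ ⟨hs0, hs⟩ hrs
  simp only [hT] at this
  rw [Real.rpow_neg hs0.le, Real.rpow_neg hr.le] at this
  rw [Real.div_rpow hs0.le hr.le]
  have p1 := Real.rpow_pos_of_pos hs0 Γ
  have p2 := Real.rpow_pos_of_pos hr Γ
  refine ⟨?_, by have := Nle s hs0 hs; rwa [div_le_iff₀ (Ppos s hs0 hs)] at this⟩
  calc P s = (P s * (s^Γ)⁻¹) * s^Γ := by field_simp
    _ ≤ (P r * (r^Γ)⁻¹) * s^Γ := by gcongr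
    _ = _ := by simp only [hP]; field_simp

lemma ode {H E : ℝ → ℝ} {m : ℕ} {C R : ℝ} (hR : 0 < R) (hR1 : R ≤ 1) (hC : 0 ≤ C)
    (hyp : ∀ r, 0 < r → r ≤ R → ∃ hh ee D J, HasDerivAt H hh r ∧ HasDerivAt E ee r ∧ 0 ≤ H r ∧ 0 ≤ E r
      ∧ 0 ≤ J ∧ |r * hh - m * H r - D / 3| ≤ C * r * H r ∧ |D - E r| ≤ C * r * H r
      ∧ D^2 ≤ 36 * H r * J ∧ m * E r + 12 * J - C * r * (E r + H r) ≤ r * ee)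
    (hHR : 0 < H R) {r s : ℝ} (hr : 0 < r) (hrs : r ≤ s) (hs : s ≤ R) :
    H s ≤ (s/r) ^ (m + 2*C + (E R / H R + 1) * Real.exp (3*C)) * H r := by
  set Γ := m + 2*C + (E R / H R + 1) * Real.exp (3*C) with hΓ
  have hs0 : 0 < s := hr.trans_le hrs
  have hG : 0 < (s/r)^Γ := Real.rpow_pos_of_pos (by positivity) _
  apply le_of_forall_pos_le_add
  intro δ hδ
  have hd : 0 < (s/r)^Γ * r^m := by positivity
  have := ode_aux hR hR1 hC hyp hHR hr hrs hs (ε := δ / ((s/r)^Γ * r^m)) (by positivity)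
  replace this := this.1
  rw [← hΓ, mul_add] at this
  have e : (s/r)^Γ * (δ / ((s/r)^Γ * r^m) * r^m) = δ := by field_simp
  rw [e] at this
  have : 0 ≤ δ / ((s/r)^Γ * r^m) * s^m := by positivity
  linarith

lemma ode2 {H E : ℝ → ℝ} {m : ℕ} {C R : ℝ} (hR : 0 < R) (hR1 : R ≤ 1) (hC : 0 ≤ C)
    (hyp : ∀ r, 0 < r → r ≤ R → ∃ hh ee D J, HasDerivAt H hh r ∧ HasDerivAt E ee r ∧ 0 ≤ H r ∧ 0 ≤ E r
      ∧ 0 ≤ J ∧ |r * hh - m * H r - D / 3| ≤ C * r * H r ∧ |D - E r| ≤ C * r * H r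
      ∧ D^2 ≤ 36 * H r * J ∧ m * E r + 12 * J - C * r * (E r + H r) ≤ r * ee)
    (hHR : 0 < H R) {s : ℝ} (hs0 : 0 < s) (hs : s ≤ R) :
    E s ≤ ((E R / H R + 1) * Real.exp (3*C)) * H s := by
  have hE0 : 0 ≤ E R := by
    obtain ⟨_, _, _, _, _, _, _, h, _⟩ := hyp R hR le_rfl
    exact h
  set M := (E R / H R + 1) * Real.exp (3*C) with hM
  have hM0 : 0 < M := by positivity
  apply le_of_forall_pos_le_add
  intro δ hδ
  have := (ode_aux hR hR1 hC hyp hHR hs0 le_rfl hs (ε := δ / (M * s^m)) (by positivity)).2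
  rw [← hM, mul_add] at this
  have e : M * (δ / (M * s^m) * s^m) = δ := by field_simp
  rwa [e] at this

namespace Fr
variable {n : ℕ} {a : EE n → EE n →L[ℝ] EE n} {b Z : EE n → EE n} {μ ρ u : EE n → ℝ} {K R : ℝ}
variable (h : Fr a b Z μ ρ u K R)
include h

lemma hyp {r : ℝ} (hr : 0 < r) (hrR : r ≤ R) : ∃ hh ee D J, HasDerivAt (HH μ ρ u) hh r ∧
    HasDerivAt (EN a ρ u) ee r ∧ 0 ≤ HH μ ρ u r ∧ 0 ≤ EN a ρ u r
      ∧ 0 ≤ J ∧ |r * hh - (4 + n : ℕ) * HH μ ρ u r - D / 3| ≤ (4+n)*K^4 * r * HH μ ρ u r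
      ∧ |D - EN a ρ u r| ≤ (4+n)*K^4 * r * HH μ ρ u r
      ∧ D^2 ≤ 36 * HH μ ρ u r * J ∧
      (4 + n : ℕ) * EN a ρ u r + 12 * J - (4+n)*K^4 * r * (EN a ρ u r + HH μ ρ u r) ≤ r * ee := by
  obtain ⟨hh, h1, h2⟩ := h.HH_deriv r
  obtain ⟨ee, h3, h4⟩ := h.EN_deriv r
  refine ⟨hh, ee, DD a ρ u r, JJ Z μ ρ u r, h1, h3, h.HH_nonneg hr hrR, h.EN_nonneg r, ?_, ?_,
    h.err3 hr hrR, h.CS hr hrR, ?_⟩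
  · have hcμ := h.hμ
    have hcZ := h.cZg
    have := h.int_mono (f := fun _ => 0) (g := fun x => μ x * ⟪Z x, gradient u x⟫ ^ 2) (by fun_prop) (by fun_prop) r 1
      (fun x hx => by
        have := h.mulow x (h.lt_R hr hrR hx)
        positivity)
    unfold JJ
    simpa using this
  · have := h.err1 hr hrR
    rw [h2]
    push_cast
    refine le_trans (le_of_eq ?_) this
    congr 1; ring
  · have := h.err2 hr hrR
    rw [h4]; push_cast; linarith

/-- frequency bound -/
lemma freq (hHR : 0 < HH μ ρ u R) {s : ℝ} (hs0 : 0 < s) (hs : s ≤ R) :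
    EN a ρ u s ≤ ((EN a ρ u R / HH μ ρ u R + 1) * Real.exp (3*((4+n)*K^4))) * HH μ ρ u s := by
  have hK0 := h.K0
  exact ode2 h.R0 h.R1 (by positivity) (fun r hr hrR => h.hyp hr hrR) hHR hs0 hs

lemma doubling (hHR : 0 < HH μ ρ u R) {r s : ℝ} (hr : 0 < r) (hrs : r ≤ s) (hs : s ≤ R) :
    HH μ ρ u s ≤ (s/r) ^ ((4+n:ℕ) + 2*((4+n)*K^4) + (EN a ρ u R / HH μ ρ u R + 1) * Real.exp (3*((4+n)*K^4)))
      * HH μ ρ u r := by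
  have hK0 := h.K0
  exact ode h.R0 h.R1 (by positivity) (fun r hr hrR => h.hyp hr hrR) hHR hr hrs hs

end Fr


lemma sob (n : ℕ) (hn : 2 ≤ n) : ∃ Cs : ℝ, 0 < Cs ∧ ∀ g : EE n → ℝ, ContDiff ℝ 1 g → HasCompactSupport g →
    (∀ x, 0 ≤ g x) → ∀ F : Set (EE n), volume F ≠ ⊤ →
    ∫ x in F, g x ≤ Cs * (volume.real F) ^ ((1:ℝ)/n) * ∫ x, ‖fderiv ℝ g x‖ := by
  have hn1 : (1:NNReal) < (n:NNReal) := by exact_mod_cast hn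
  set p := NNReal.conjExponent (n:NNReal) with hp
  have hc : NNReal.HolderConjugate (n:NNReal) p := NNReal.HolderConjugate.conjExponent hn1
  have hpge : (1:ENNReal) ≤ (p:ENNReal) := by exact_mod_cast hc.symm.lt.le
  have hfr : Module.finrank ℝ (EE n) = n := by simp
  set Cn := eLpNormLESNormFDerivOneConst (volume : Measure (EE n)) p with hCn
  refine ⟨Cn + 1, by positivity, ?_⟩
  intro g hg hgs hg0 F hF
  have h1 : eLpNorm g p volume ≤ Cn * eLpNorm (fderiv ℝ g) 1 volume :=
    eLpNorm_le_eLpNorm_fderiv_one (volume : Measure (EE n)) hg hgs (by rw [hfr]; exact hc)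
  have h2 : eLpNorm g 1 (volume.restrict F) ≤ eLpNorm g p (volume.restrict F) *
      (volume.restrict F) univ ^ (1 / (1:ENNReal).toReal - 1 / (p:ENNReal).toReal) :=
    eLpNorm_le_eLpNorm_mul_rpow_measure_univ hpge hg.continuous.aestronglyMeasurable
  have hexp : 1 / (1:ENNReal).toReal - 1 / (p:ENNReal).toReal = (1:ℝ)/n := by
    have := hc.inv_add_inv_eq_one
    have h' : ((n:ℝ))⁻¹ + (p:ℝ)⁻¹ = 1 := by simpa using congrArg NNReal.toReal this
    simp; linarith
  rw [hexp, Measure.restrict_apply_univ] at h2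
  have h3 : eLpNorm g 1 (volume.restrict F) ≤ (Cn * eLpNorm (fderiv ℝ g) 1 volume) * volume F ^ ((1:ℝ)/n) := by
    refine h2.trans ?_
    gcongr
    exact (eLpNorm_mono_measure _ Measure.restrict_le_self).trans h1
  have hfi : Integrable (fun x => ‖fderiv ℝ g x‖) := by
    apply Continuous.integrable_of_hasCompactSupport
    · exact (hg.continuous_fderiv (by norm_num)).norm
    · exact (hgs.fderiv (𝕜 := ℝ)).norm
  have hgi : Integrable g := hg.continuous.integrable_of_hasCompactSupport hgs
  have e1 : ∫ x in F, g x = (eLpNorm g 1 (volume.restrict F)).toReal := by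
    rw [eLpNorm_one_eq_lintegral_enorm, ← integral_norm_eq_lintegral_enorm hg.continuous.aestronglyMeasurable]
    congr 1; ext x; rw [Real.norm_of_nonneg (hg0 x)]
  have e2 : ∫ x, ‖fderiv ℝ g x‖ = (eLpNorm (fderiv ℝ g) 1 volume).toReal := by
    rw [eLpNorm_one_eq_lintegral_enorm, ← integral_norm_eq_lintegral_enorm
      (hg.continuous_fderiv (by norm_num)).aestronglyMeasurable]
  have fin1 : eLpNorm (fderiv ℝ g) 1 volume ≠ ⊤ := by
    have : Integrable (fderiv ℝ g) := (integrable_norm_iff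
      (hg.continuous_fderiv (by norm_num)).aestronglyMeasurable).mp hfi
    exact (memLp_one_iff_integrable.mpr this).2.ne
  have fin2 : volume F ^ ((1:ℝ)/n) ≠ ⊤ := ENNReal.rpow_ne_top_of_nonneg (by positivity) hF
  rw [e1, e2]
  have h4 := ENNReal.toReal_mono (by finiteness) h3
  rw [ENNReal.toReal_mul, ENNReal.toReal_mul, ← ENNReal.toReal_rpow] at h4
  refine h4.trans ?_
  have : (0:ℝ) ≤ (eLpNorm (fderiv ℝ g) 1 volume).toReal := ENNReal.toReal_nonneg
  have h5 : (0:ℝ) ≤ (volume F).toReal ^ ((1:ℝ)/n) := by positivity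
  calc _ = (Cn:ℝ) * (volume F).toReal ^ ((1:ℝ)/n) * (eLpNorm (fderiv ℝ g) 1 volume).toReal := by
        simp only [ENNReal.coe_toReal]; ring
    _ ≤ _ := by
        gcongr
        · linarith
        · exact le_rfl

namespace Fr
variable {n : ℕ} {a : EE n → EE n →L[ℝ] EE n} {b Z : EE n → EE n} {μ ρ u : EE n → ℝ} {K R : ℝ}
variable (h : Fr a b Z μ ρ u K R)
include h

lemma grad_est {s : ℝ} (hs : 0 < s) (hsR : s ≤ R) :
    ∫ x, ‖fderiv ℝ (fun x => u x ^ 2 * WW ρ s x ^ 4) x‖ ≤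
      s^3 * (K * EN a ρ u s + 18 * K^2 * HH μ ρ u s) := by
  have hK := h.K1
  have hK0 := h.K0
  have hcu := h.cu
  have hcμ := h.hμ
  have hce := h.cen
  have hg : ContDiff ℝ 1 (fun x => u x ^ 2 * WW ρ s x ^ 4) :=
    ((h.hu.of_le (by norm_num)).pow 2).mul (contDiff_WW h.hρ s 2)
  have hgs : HasCompactSupport (fun x => u x ^ 2 * WW ρ s x ^ 4) :=
    (hasCompactSupport_WW h.ρlow h.K0 s 3).mul_left
  have pt : ∀ x, ‖fderiv ℝ (fun x => u x ^ 2 * WW ρ s x ^ 4) x‖ ≤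
      (s^3 * K) * (en a u x * WW ρ s x ^ 3) + (s^3 * (18 * K^2)) * ((μ x * u x ^ 2) * WW ρ s x ^ 2) := by
    intro x
    have hw0 := WW_nonneg (ρ := ρ) s x
    have hws := WW_le (r := s) (h.ρnn x)
    have hfd : ∀ v, fderiv ℝ (fun x => u x ^ 2 * WW ρ s x ^ 4) x v =
        2 * u x * WW ρ s x ^ 4 * ⟪gradient u x, v⟫ - 8 * u x ^ 2 * WW ρ s x ^ 3 * ⟪b x, v⟫ := by
      intro v
      have hud := h.hu.differentiable (by norm_num) x
      have h1 := ((hud.hasFDerivAt.pow 2).mul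
        ((contDiff_WW h.hρ s 2).differentiable (by norm_num) x).hasFDerivAt).fderiv
      have h2 : fderiv ℝ (fun x => u x ^ 2 * WW ρ s x ^ 4) x = _ := h1
      rw [h2]
      have h3 := fderiv_WW h.hρ s 2 x v
      rw [h.dρ] at h3
      simp only [add_apply, smul_apply, smul_eq_mul]
      rw [h3, ← h.grad_inner]
      push_cast; simp; ring
    have hop : ‖fderiv ℝ (fun x => u x ^ 2 * WW ρ s x ^ 4) x‖ ≤
        2 * |u x| * WW ρ s x ^ 4 * ‖gradient u x‖ + 8 * u x ^ 2 * WW ρ s x ^ 3 * ‖b x‖ := by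
      apply ContinuousLinearMap.opNorm_le_bound _ (by positivity)
      intro v
      rw [hfd v]
      refine (norm_sub_le _ _).trans ?_
      rw [norm_mul, norm_mul, Real.norm_eq_abs, Real.norm_eq_abs, Real.norm_eq_abs, Real.norm_eq_abs,
        abs_mul, abs_mul, abs_of_nonneg (show 0 ≤ 8 * u x ^ 2 * WW ρ s x ^ 3 by positivity), abs_two,
        abs_of_nonneg (show 0 ≤ WW ρ s x ^ 4 by positivity), add_mul]
      have i1 := abs_real_inner_le_norm (gradient u x) v
      have i2 := abs_real_inner_le_norm (b x) v
      have : 0 ≤ 2 * |u x| * WW ρ s x ^ 4 := by positivity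
      have : 0 ≤ 8 * u x ^ 2 * WW ρ s x ^ 3 := by positivity
      nlinarith
    refine hop.trans ?_
    by_cases hx : ρ x < s^2
    swap
    · simp [WW_eq_zero (not_lt.mp hx)]
    have hx' := h.lt_R hs hsR hx
    have hb : ‖b x‖ ≤ K^2 * s := (h.ble x).trans (by nlinarith [h.norm_le hs hx])
    have hu2 := h.u_le hx'
    have hm : 0 ≤ μ x * u x ^ 2 := by have := h.mulow x hx'; positivity
    have hgr := h.grad_le x
    set w := WW ρ s x
    set g := ‖gradient u x‖
    have t1 : 2 * |u x| * w ^ 4 * g ≤ s^3 * (g^2 * w^3) + s^3 * (u x^2 * w^2) := by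
      have i1 : 2 * (g * s) * |u x| ≤ (g*s)^2 + |u x|^2 := two_mul_le_add_sq _ _
      rw [sq_abs] at i1
      have i2 : 2 * |u x| * w^4 * g ≤ 2 * |u x| * w^3 * s^2 * g := by
        have : 2 * |u x| * w^4 * g = 2 * |u x| * w^3 * w * g := by ring
        rw [this]; gcongr
      have i3 : 2 * |u x| * w^3 * s^2 * g = (2 * (g * s) * |u x|) * (w^3 * s) := by ring
      have i4 : (2 * (g * s) * |u x|) * (w^3 * s) ≤ ((g*s)^2 + u x^2) * (w^3 * s) := by gcongr
      have i5 : u x^2 * (w^3 * s) ≤ u x^2 * (w^2 * s^2 * s) := by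
        have : w^3 = w^2 * w := by ring
        rw [this]; gcongr
      nlinarith
    have t2 : 8 * u x ^ 2 * w ^ 3 * ‖b x‖ ≤ s^3 * (8 * K^2) * (u x ^ 2 * w^2) := by
      calc 8 * u x ^ 2 * w ^ 3 * ‖b x‖ = 8 * u x^2 * w^2 * w * ‖b x‖ := by ring
        _ ≤ 8 * u x^2 * w^2 * s^2 * (K^2 * s) := by gcongr
        _ = _ := by ring
    have t3 : s^3 * (g^2 * w^3) ≤ s^3 * ((K * en a u x) * w^3) := by gcongr
    have t4 : u x^2 * w^2 ≤ 2 * (μ x * u x^2) * w^2 := by gcongr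
    have t5 : s^3 * (1 + 8 * K^2) * (u x ^ 2 * w^2) ≤ s^3 * (9 * K^2) * (2 * (μ x * u x^2) * w^2) := by
      gcongr
      nlinarith
    linarith
  calc ∫ x, ‖fderiv ℝ (fun x => u x ^ 2 * WW ρ s x ^ 4) x‖ ≤ ∫ x, ((s^3 * K) * (en a u x * WW ρ s x ^ 3) +
        (s^3 * (18 * K^2)) * ((μ x * u x ^ 2) * WW ρ s x ^ 2)) := by
        apply integral_mono _ _ pt
        · apply Continuous.integrable_of_hasCompactSupport
          · exact (hg.continuous_fderiv (by norm_num)).norm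
          · exact (hgs.fderiv (𝕜 := ℝ)).norm
        · exact ((h.intg (by fun_prop) s 2).const_mul _).add ((h.intg (by fun_prop) s 1).const_mul _)
    _ = _ := by
        rw [integral_add ((h.intg (by fun_prop) s 2).const_mul _) ((h.intg (by fun_prop) s 1).const_mul _),
          integral_const_mul, integral_const_mul]
        unfold EN HH; ring

/-- upper bound of `HH` by the mass on a ball -/
lemma HH_le {t : ℝ} (ht : 0 < t) (htR : t ≤ R) :
    HH μ ρ u t ≤ 2 * t^4 * ∫ x in ball (0:EE n) (K * t), u x ^ 2 := by
  have hK0 := h.K0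
  have hcu := h.cu
  have hcμ := h.hμ
  have hu2int : IntegrableOn (fun x => u x ^ 2) (ball (0:EE n) (K * t)) :=
    ((hcu.pow 2).continuousOn.integrableOn_compact (isCompact_closedBall 0 (K*t))).mono_set ball_subset_closedBall
  rw [← integral_const_mul, ← integral_indicator measurableSet_ball]
  unfold HH
  apply integral_mono (h.intg (by fun_prop) t 1)
  · rw [integrable_indicator_iff measurableSet_ball]
    exact hu2int.const_mul _
  intro x
  simp only
  by_cases hx : ρ x < t^2
  · have hb : x ∈ ball (0:EE n) (K*t) := by
      rw [mem_ball_zero_iff]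
      apply lt_of_pow_lt_pow_left₀ 2 (by positivity)
      calc ‖x‖^2 ≤ K * ρ x := h.ρlow x
        _ < K * t^2 := by gcongr
        _ ≤ (K * t)^2 := by
          have := mul_nonneg (mul_nonneg (sub_nonneg.mpr h.K1) hK0.le) (sq_nonneg t)
          nlinarith
    rw [indicator_of_mem hb]
    have hw0 := WW_nonneg (ρ := ρ) t x
    have hws := WW_le (r := t) (h.ρnn x)
    calc μ x * u x ^ 2 * WW ρ t x ^ 2 ≤ 2 * u x ^ 2 * (t^2)^2 := by
          gcongr; exact h.muup x (h.lt_R ht htR hx)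
      _ = _ := by ring
  · rw [WW_eq_zero (not_lt.mp hx)]
    rw [zero_pow two_ne_zero, mul_zero]
    apply indicator_nonneg
    intro y _
    positivity

lemma low_aux {r : ℝ} (hr : 0 < r) {F : Set (EE n)} (hFm : MeasurableSet F) (hF : F ⊆ ball 0 r) :
    ((2 * K * r)^8/16) * ∫ x in F, u x ^ 2 ≤ ∫ x in F, u x ^ 2 * WW ρ (2 * K * r) x ^ 4 := by
  have hK := h.K1
  have hK0 := h.K0
  have hcu := h.cu
  obtain ⟨s, hs⟩ : ∃ s, s = 2 * K * r := ⟨_, rfl⟩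
  rw [← hs]
  have hu2int : IntegrableOn (fun x => u x ^ 2) F :=
  ((hcu.pow 2).continuousOn.integrableOn_compact (isCompact_closedBall 0 r)).mono_set
    (hF.trans ball_subset_closedBall)
  rw [← integral_const_mul]
  apply setIntegral_mono_on (hu2int.const_mul _) (h.intg (by fun_prop) s 3).integrableOn hFm
  intro x hx
  have hx1 : ‖x‖ < r := by simpa using hF hx
  have h1 : s^2 / 2 ≤ WW ρ s x := by
    refine le_trans ?_ (le_max_left (s^2 - ρ x) 0)
    have h2 := h.ρup x
    have h3 : K * ‖x‖^2 ≤ K * r^2 := by gcongr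
    have h4 : K * r^2 ≤ K * r^2 * K := le_mul_of_one_le_right (by positivity) hK
    have h5 : s^2 = 4 * (K * r^2 * K) := by rw [hs]; ring
    nlinarith
  calc s^8/16 * u x^2 = u x^2 * (s^2/2)^4 := by ring
    _ ≤ u x ^ 2 * WW ρ s x ^ 4 := by gcongr

set_option maxHeartbeats 400000 in
/-- the main scale-invariant estimate -/
lemma main_est {Cs : ℝ} (hCs : 0 < Cs) (hsob : ∀ g : EE n → ℝ, ContDiff ℝ 1 g → HasCompactSupport g →
    (∀ x, 0 ≤ g x) → ∀ F : Set (EE n), volume F ≠ ⊤ →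
    ∫ x in F, g x ≤ Cs * (volume.real F) ^ ((1:ℝ)/n) * ∫ x, ‖fderiv ℝ g x‖) (hn : 0 < n)
    {M : ℝ} (hHR : 0 < HH μ ρ u R) (hM : EN a ρ u R / HH μ ρ u R ≤ M)
    {r : ℝ} (hr : 0 < r) (hrR : 2 * K * r ≤ R) {F : Set (EE n)} (hFm : MeasurableSet F) (hF : F ⊆ ball 0 r) :
    ∫ x in F, u x ^ 2 ≤ 16 * Cs * (K * ((M + 1) * Real.exp (3*((4+n)*K^4))) + 18 * K^2) *
      (2 * (8 * n * K^2) ^ ((4+n:ℕ) + 2*((4+n)*K^4) + (M + 1) * Real.exp (3*((4+n)*K^4))))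
      * (volume.real F) ^ ((1:ℝ)/n) * r⁻¹ * ∫ x in ball (0:EE n) (r / (4*n)), u x ^ 2 := by
  have hK := h.K1
  have hK0 := h.K0
  have hcu := h.cu
  have hn' : (1:ℝ) ≤ n := by exact_mod_cast hn
  have hlow := h.low_aux hr hFm hF
  obtain ⟨s, hs⟩ : ∃ s, s = 2 * K * r := ⟨_, rfl⟩
  rw [← hs] at hrR hlow
  have hs0 : 0 < s := by rw [hs]; positivity
  obtain ⟨t, ht⟩ : ∃ t, t = r / (4 * n * K) := ⟨_, rfl⟩
  have ht0 : 0 < t := by rw [ht]; positivity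
  have hts : t ≤ s := by
    rw [ht, hs, div_le_iff₀ (by positivity)]
    have : 1 ≤ 2 * K * (4 * n * K) := by nlinarith [mul_le_mul hK hK zero_le_one hK0.le]
    nlinarith
  set A := (M + 1) * Real.exp (3*((4+n)*K^4)) with hA
  set Γ := (4+n:ℕ) + 2*((4+n)*K^4) + A with hΓ
  have hEN := h.freq hHR hs0 hrR
  have hdb := h.doubling hHR ht0 hts hrR
  have hH0 := h.HH_nonneg hs0 hrR
  have hHt0 := h.HH_nonneg ht0 (hts.trans hrR)
  have hA' : (EN a ρ u R / HH μ ρ u R + 1) * Real.exp (3*((4+n)*K^4)) ≤ A := by rw [hA]; gcongr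
  have hEN' : EN a ρ u s ≤ A * HH μ ρ u s := hEN.trans (by gcongr)
  have hM0 : 0 ≤ M := le_trans (div_nonneg (h.EN_nonneg R) hHR.le) hM
  have hst : s / t = 8 * n * K^2 := by rw [hs, ht]; field_simp; ring
  have hdb' : HH μ ρ u s ≤ (8 * n * K^2) ^ Γ * HH μ ρ u t := by
    refine hdb.trans ?_
    rw [hst]
    gcongr
    · have : 1 ≤ (n:ℝ) * K^2 := one_le_mul_of_one_le_of_one_le hn' (one_le_pow₀ hK)
      nlinarith
    · rw [hΓ]; linarith
  have hHt := h.HH_le ht0 (hts.trans hrR)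
  have hKt : K * t = r / (4 * n) := by rw [ht]; field_simp
  rw [hKt] at hHt
  set I := ∫ x in ball (0:EE n) (r / (4*n)), u x ^ 2 with hI
  have hI0 : 0 ≤ I := integral_nonneg fun x => sq_nonneg _
  have hvF : volume F ≠ ⊤ := ((measure_mono hF).trans_lt measure_ball_lt_top).ne
  have hS1 : ContDiff ℝ 1 (fun x => u x ^ 2 * WW ρ s x ^ 4) :=
    ((h.hu.of_le (by norm_num)).pow 2).mul (contDiff_WW h.hρ s 2)
  have hS2 : HasCompactSupport (fun x => u x ^ 2 * WW ρ s x ^ 4) :=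
    (hasCompactSupport_WW h.ρlow h.K0 s 3).mul_left
  have hS3 : ∀ x, 0 ≤ u x ^ 2 * WW ρ s x ^ 4 :=
    fun x => mul_nonneg (sq_nonneg _) (pow_nonneg (WW_nonneg s x) _)
  have hS := hsob (fun x => u x ^ 2 * WW ρ s x ^ 4) hS1 hS2 hS3 F hvF
  have hG := h.grad_est hs0 hrR
  set V := (volume.real F) ^ ((1:ℝ)/n) with hV
  have hV0 : 0 ≤ V := by positivity
  have hA0 : 0 ≤ A := by positivity
  have c1 : (s^8/16) * ∫ x in F, u x ^ 2 ≤ Cs * V * (s^3 * ((K * A + 18 * K^2) * HH μ ρ u s)) := by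
    refine hlow.trans (hS.trans ?_)
    gcongr
    refine hG.trans ?_
    gcongr
    nlinarith
  have c2 : HH μ ρ u s ≤ (8 * n * K^2) ^ Γ * (2 * s^4 * I) := by
    refine hdb'.trans ?_
    gcongr
    refine hHt.trans ?_
    gcongr
  have c3 : (s^8/16) * ∫ x in F, u x ^ 2 ≤ Cs * V * (s^3 * ((K * A + 18 * K^2) * ((8 * n * K^2) ^ Γ * (2 * s^4 * I)))) := by
    refine c1.trans ?_
    gcongr
  have c4 : ∫ x in F, u x ^ 2 ≤ 16 * Cs * (K * A + 18 * K^2) * (2 * (8 * n * K^2) ^ Γ) * V * s⁻¹ * I := by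
    have : ∫ x in F, u x ^ 2 = (16 / s^8) * ((s^8/16) * ∫ x in F, u x ^ 2) := by field_simp
    rw [this]
    calc _ ≤ (16 / s^8) * (Cs * V * (s^3 * ((K * A + 18 * K^2) * ((8 * n * K^2) ^ Γ * (2 * s^4 * I))))) := by gcongr
      _ = _ := by field_simp
  refine c4.trans ?_
  have : s⁻¹ ≤ r⁻¹ := by
    gcongr; rw [hs]; nlinarith
  gcongr
end Fr


structure Coef {n : ℕ} (a : EE n → EE n →L[ℝ] EE n) (L : ℝ) : Prop where
  L1 : 1 ≤ L
  ha : ContDiff ℝ 1 a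
  sym : ∀ x v w, ⟪a x v, w⟫ = ⟪v, a x w⟫
  ell : ∀ x v, ‖v‖^2 ≤ L * ⟪a x v, v⟫
  bda : ∀ x, ‖a x‖ ≤ L
  dab : ∀ x, ‖fderiv ℝ a x‖ ≤ L

namespace Coef
variable {n : ℕ} {a : EE n → EE n →L[ℝ] EE n} {L : ℝ} (h : Coef a L)
include h

lemma L0 : 0 < L := lt_of_lt_of_le one_pos h.L1

lemma translate (y : EE n) : Coef (fun x => a (x + y)) L where
  L1 := h.L1
  ha := h.ha.comp (contDiff_id.add contDiff_const)
  sym x := h.sym _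
  ell x := h.ell _
  bda x := h.bda _
  dab x := by rw [fderiv_comp_add_right]; exact h.dab _

lemma lip (x : EE n) : ‖a x - a 0‖ ≤ L * ‖x‖ := by
  have := Convex.norm_image_sub_le_of_norm_fderiv_le (f := a) (𝕜 := ℝ) (s := univ) (x := 0) (y := x)
    (fun z _ => h.ha.differentiable (by norm_num) z) (fun z _ => h.dab z) convex_univ (mem_univ _) (mem_univ _)
  simpa using this

lemma inv_le (v : EE n) : ‖v‖ ≤ L * ‖a 0 v‖ := by
  have h1 := h.ell 0 v
  have h2 := real_inner_le_norm (a 0 v) v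
  rcases eq_or_lt_of_le (norm_nonneg v) with hv | hv
  · rw [← hv]; have := h.L0; positivity
  · have : ‖v‖ * ‖v‖ ≤ (L * ‖a 0 v‖) * ‖v‖ := by nlinarith [h.L0]
    exact le_of_mul_le_mul_right this hv

lemma exists_inv : ∃ G : EE n →L[ℝ] EE n, ∀ v, a 0 (G v) = v := by
  have hinj : Function.Injective (a 0 : EE n →ₗ[ℝ] EE n) := by
    rw [injective_iff_map_eq_zero]
    intro v hv
    have := h.inv_le v
    have hv' : a 0 v = 0 := hv
    rw [hv'] at this
    simpa using this
  set e := LinearEquiv.ofInjectiveEndo _ hinj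
  refine ⟨LinearMap.toContinuousLinearMap (e.symm : EE n →ₗ[ℝ] EE n), fun v => ?_⟩
  exact e.apply_symm_apply v

end Coef

structure Gm {n : ℕ} (a : EE n → EE n →L[ℝ] EE n) (L : ℝ) (G : EE n →L[ℝ] EE n) : Prop where
  co : Coef a L
  inv : ∀ v, a 0 (G v) = v

namespace Gm
variable {n : ℕ} {a : EE n → EE n →L[ℝ] EE n} {L : ℝ} {G : EE n →L[ℝ] EE n} (h : Gm a L G)

def rh (G : EE n →L[ℝ] EE n) (x : EE n) : ℝ := ⟪G x, x⟫
def NN (a : EE n → EE n →L[ℝ] EE n) (G : EE n →L[ℝ] EE n) (x : EE n) : EE n := a x (G x)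
def mm (a : EE n → EE n →L[ℝ] EE n) (G : EE n →L[ℝ] EE n) (x : EE n) : ℝ := ⟪NN a G x, G x⟫
def ZZ (a : EE n → EE n →L[ℝ] EE n) (G : EE n →L[ℝ] EE n) (x : EE n) : EE n :=
  (rh G x / mm a G x) • NN a G x
open Classical in
def mu (a : EE n → EE n →L[ℝ] EE n) (G : EE n →L[ℝ] EE n) (x : EE n) : ℝ :=
  if x = 0 then 1 else mm a G x / rh G x

include h

lemma Gle (v : EE n) : ‖G v‖ ≤ L * ‖v‖ := by
  have := h.co.inv_le (G v); rwa [h.inv] at this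

lemma leG (v : EE n) : ‖v‖ ≤ L * ‖G v‖ := by
  have := (a 0).le_opNorm (G v)
  rw [h.inv] at this
  exact this.trans (by gcongr; exact h.co.bda 0)

lemma Gsym (v w : EE n) : ⟪G v, w⟫ = ⟪v, G w⟫ := by
  calc ⟪G v, w⟫ = ⟪G v, a 0 (G w)⟫ := by rw [h.inv]
    _ = ⟪a 0 (G v), G w⟫ := (h.co.sym 0 _ _).symm
    _ = _ := by rw [h.inv]

lemma sq_le (x : EE n) : ‖x‖^2 ≤ L^2 * ‖G x‖^2 := by
  have := h.leG x
  calc ‖x‖^2 ≤ (L * ‖G x‖)^2 := by gcongr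
    _ = _ := by ring

lemma rh_low (x : EE n) : ‖x‖^2 ≤ L^3 * rh G x := by
  have h1 := h.co.ell 0 (G x)
  rw [h.inv, real_inner_comm] at h1
  have := h.sq_le x
  have hL := h.co.L0
  calc ‖x‖^2 ≤ L^2 * ‖G x‖^2 := this
    _ ≤ L^2 * (L * rh G x) := by gcongr; exact h1
    _ = _ := by ring

lemma mm_low (x : EE n) : ‖x‖^2 ≤ L^3 * mm a G x := by
  have h1 := h.co.ell x (G x)
  have := h.sq_le x
  have hL := h.co.L0
  calc ‖x‖^2 ≤ L^2 * ‖G x‖^2 := this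
    _ ≤ L^2 * (L * mm a G x) := by gcongr; exact h1
    _ = _ := by ring

lemma rh_up (x : EE n) : rh G x ≤ L * ‖x‖^2 := by
  have := real_inner_le_norm (G x) x
  have h2 := h.Gle x
  unfold rh
  nlinarith [norm_nonneg x]

lemma rh_nn (x : EE n) : 0 ≤ rh G x :=
  nonneg_of_mul_nonneg_right ((sq_nonneg _).trans (h.rh_low x)) (pow_pos h.co.L0 3)

lemma mm_pos {x : EE n} (hx : x ≠ 0) : 0 < mm a G x :=
  pos_of_mul_pos_right ((pow_pos (norm_pos_iff.mpr hx) 2).trans_le (h.mm_low x)) (pow_pos h.co.L0 3).le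

lemma rh_pos {x : EE n} (hx : x ≠ 0) : 0 < rh G x :=
  pos_of_mul_pos_right ((pow_pos (norm_pos_iff.mpr hx) 2).trans_le (h.rh_low x)) (pow_pos h.co.L0 3).le

lemma N_sub (x : EE n) : ‖NN a G x - x‖ ≤ L^2 * ‖x‖^2 := by
  have : NN a G x - x = (a x - a 0) (G x) := by
    simp [NN, h.inv]
  rw [this]
  calc _ ≤ ‖a x - a 0‖ * ‖G x‖ := ContinuousLinearMap.le_opNorm _ _
    _ ≤ (L * ‖x‖) * (L * ‖x‖) := by
      have := h.co.L0
      gcongr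
      · exact h.co.lip x
      · exact h.Gle x
    _ = _ := by ring

lemma N_le (x : EE n) : ‖NN a G x‖ ≤ L^2 * ‖x‖ := by
  have := h.co.L0
  calc ‖NN a G x‖ ≤ ‖a x‖ * ‖G x‖ := ContinuousLinearMap.le_opNorm _ _
    _ ≤ L * (L * ‖x‖) := by
      gcongr
      · exact h.co.bda x
      · exact h.Gle x
    _ = _ := by ring

lemma m_sub (x : EE n) : |mm a G x - rh G x| ≤ L^3 * ‖x‖^3 := by
  have : mm a G x - rh G x = ⟪NN a G x - x, G x⟫ := by
    unfold mm rh; rw [inner_sub_left, real_inner_comm x]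
  rw [this]
  have := h.co.L0
  calc _ ≤ ‖NN a G x - x‖ * ‖G x‖ := abs_real_inner_le_norm _ _
    _ ≤ (L^2 * ‖x‖^2) * (L * ‖x‖) := by
      gcongr
      · exact h.N_sub x
      · exact h.Gle x
    _ = _ := by ring

lemma c_sub {x : EE n} (hx : x ≠ 0) : |rh G x / mm a G x - 1| ≤ L^6 * ‖x‖ := by
  have hm := h.mm_pos hx
  have hL := h.co.L0
  have e : rh G x / mm a G x - 1 = (rh G x - mm a G x) / mm a G x := by field_simp
  rw [e, abs_div, abs_of_pos hm, div_le_iff₀ hm, abs_sub_comm]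
  calc _ ≤ L^3 * ‖x‖^3 := h.m_sub x
    _ = L^3 * ‖x‖ * ‖x‖^2 := by ring
    _ ≤ L^3 * ‖x‖ * (L^3 * mm a G x) := by gcongr; exact h.mm_low x
    _ = _ := by ring

lemma c_le {x : EE n} (hx : x ≠ 0) : rh G x / mm a G x ≤ L^4 := by
  have hm := h.mm_pos hx
  have hL := h.co.L0
  rw [div_le_iff₀ hm]
  calc _ ≤ L * ‖x‖^2 := h.rh_up x
    _ ≤ L * (L^3 * mm a G x) := by gcongr; exact h.mm_low x
    _ = _ := by ring

lemma c_nn {x : EE n} (hx : x ≠ 0) : 0 ≤ rh G x / mm a G x :=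
  div_nonneg (h.rh_nn x) (h.mm_pos hx).le

lemma mu_sub (x : EE n) : |mu a G x - 1| ≤ L^6 * ‖x‖ := by
  have hL := h.co.L0
  unfold mu
  split_ifs with hx
  · simp; positivity
  have hm := h.rh_pos hx
  have e : mm a G x / rh G x - 1 = (mm a G x - rh G x) / rh G x := by field_simp
  rw [e, abs_div, abs_of_pos hm, div_le_iff₀ hm]
  calc _ ≤ L^3 * ‖x‖^3 := h.m_sub x
    _ = L^3 * ‖x‖ * ‖x‖^2 := by ring
    _ ≤ L^3 * ‖x‖ * (L^3 * rh G x) := by gcongr; exact h.rh_low x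
    _ = _ := by ring

lemma N_zero : NN a G 0 = 0 := by simp [NN]

lemma Z_le (x : EE n) : ‖ZZ a G x‖ ≤ L^6 * ‖x‖ := by
  have hL := h.co.L0
  by_cases hx : x = 0
  · subst hx; simp [ZZ, h.N_zero]
  · unfold ZZ
    rw [norm_smul, Real.norm_of_nonneg (h.c_nn hx)]
    calc _ ≤ L^4 * (L^2 * ‖x‖) := by
          gcongr
          · exact h.c_le hx
          · exact h.N_le x
      _ = _ := by ring

lemma Z_sub (x : EE n) : ‖ZZ a G x - x‖ ≤ 2 * L^6 * ‖x‖^2 := by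
  have hL := h.co.L0
  by_cases hx : x = 0
  · subst hx; simp [ZZ, h.N_zero]
  · have : ZZ a G x - x = (rh G x / mm a G x) • (NN a G x - x) + (rh G x / mm a G x - 1) • x := by
      unfold ZZ; module
    rw [this]
    refine (norm_add_le _ _).trans ?_
    rw [norm_smul, norm_smul, Real.norm_of_nonneg (h.c_nn hx), Real.norm_eq_abs]
    calc _ ≤ L^4 * (L^2 * ‖x‖^2) + (L^6 * ‖x‖) * ‖x‖ := by
          gcongr
          · exact h.c_le hx
          · exact h.N_sub x
          · exact h.c_sub hx
      _ = _ := by ring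

lemma cd_N : ContDiff ℝ 1 (NN a G) := h.co.ha.clm_apply G.contDiff
lemma cd_m : ContDiff ℝ 1 (mm a G) := h.cd_N.inner ℝ G.contDiff
omit h in
lemma cd_r : ContDiff ℝ 1 (rh G) := G.contDiff.inner ℝ contDiff_id

lemma d_r (x v : EE n) : fderiv ℝ (rh G) x v = 2 * ⟪G x, v⟫ := by
  have h1 := (G.hasFDerivAt (x := x)).inner ℝ (hasFDerivAt_id x)
  have h2 : HasFDerivAt (rh G) _ x := h1
  rw [h2.fderiv]
  simp
  rw [h.Gsym v x, real_inner_comm v]; ring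

lemma d_N (x v : EE n) : fderiv ℝ (NN a G) x v = fderiv ℝ a x v (G x) + a x (G v) := by
  have h1 := ((h.co.ha.differentiable (by norm_num) x).hasFDerivAt).clm_apply (G.hasFDerivAt (x := x))
  have h2 : HasFDerivAt (NN a G) _ x := h1
  rw [h2.fderiv]
  simp [add_comm]

lemma d_N_sub (x v : EE n) : ‖fderiv ℝ (NN a G) x v - v‖ ≤ 2 * L^2 * ‖x‖ * ‖v‖ := by
  have hL := h.co.L0
  have : fderiv ℝ (NN a G) x v - v = fderiv ℝ a x v (G x) + (a x - a 0) (G v) := by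
    rw [h.d_N]; simp [h.inv]; abel
  rw [this]
  refine (norm_add_le _ _).trans ?_
  have i1 : ‖fderiv ℝ a x v (G x)‖ ≤ (L * ‖v‖) * (L * ‖x‖) := by
    calc _ ≤ ‖fderiv ℝ a x v‖ * ‖G x‖ := ContinuousLinearMap.le_opNorm _ _
      _ ≤ (‖fderiv ℝ a x‖ * ‖v‖) * (L * ‖x‖) := by
        gcongr
        · exact ContinuousLinearMap.le_opNorm _ _
        · exact h.Gle x
      _ ≤ _ := by gcongr; exact h.co.dab x
  have i2 : ‖(a x - a 0) (G v)‖ ≤ (L * ‖x‖) * (L * ‖v‖) := by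
    calc _ ≤ ‖a x - a 0‖ * ‖G v‖ := ContinuousLinearMap.le_opNorm _ _
      _ ≤ _ := by
        gcongr
        · exact h.co.lip x
        · exact h.Gle v
  linarith

lemma d_m (x v : EE n) : fderiv ℝ (mm a G) x v = ⟪NN a G x, G v⟫ + ⟪fderiv ℝ (NN a G) x v, G x⟫ := by
  have h1 := ((h.cd_N.differentiable (by norm_num) x).hasFDerivAt).inner ℝ (G.hasFDerivAt (x := x))
  have h2 : HasFDerivAt (mm a G) _ x := h1
  rw [h2.fderiv]
  simp

lemma d_Z {x : EE n} (hx : x ≠ 0) (v : EE n) : HasFDerivAt (ZZ a G) ((rh G x / mm a G x) • fderiv ℝ (NN a G) x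
    + ((mm a G x ^ 2)⁻¹ • (mm a G x • fderiv ℝ (rh G) x - rh G x • fderiv ℝ (mm a G) x)).smulRight (NN a G x)) x := by
  have h1 := (cd_r (G := G)).differentiable (by norm_num) x |>.hasFDerivAt
  have h2 := h.cd_m.differentiable (by norm_num) x |>.hasFDerivAt
  have h3 := h.cd_N.differentiable (by norm_num) x |>.hasFDerivAt
  have hm := (h.mm_pos hx).ne'
  have h4 := (h1.mul ((hasDerivAt_inv hm).comp_hasFDerivAt x h2)).smul h3
  have h5 : HasFDerivAt (ZZ a G) _ x := h4
  refine h5.congr_fderiv ?_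
  ext1 w
  simp only [add_apply, smul_apply, sub_apply, ContinuousLinearMap.smulRight_apply, smul_eq_mul,
    Function.comp_apply, Pi.mul_apply, div_eq_mul_inv]
  congr 2
  field_simp
  ring

lemma d_Z_sub {x : EE n} (hx : x ≠ 0) :
    ‖fderiv ℝ (ZZ a G) x - ContinuousLinearMap.id ℝ (EE n)‖ ≤ 8 * L^12 * ‖x‖ := by
  have hL := h.co.L0
  have hL1 := h.co.L1
  apply ContinuousLinearMap.opNorm_le_bound _ (by positivity)
  intro v
  rw [(h.d_Z hx v).fderiv]
  have hm := h.mm_pos hx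
  set c := rh G x / mm a G x with hc
  have e1 : (c • fderiv ℝ (NN a G) x
    + ((mm a G x ^ 2)⁻¹ • (mm a G x • fderiv ℝ (rh G) x - rh G x • fderiv ℝ (mm a G) x)).smulRight (NN a G x)
    - ContinuousLinearMap.id ℝ (EE n)) v = c • (fderiv ℝ (NN a G) x v - v) + (c - 1) • v +
    ((mm a G x ^ 2)⁻¹ * (mm a G x * fderiv ℝ (rh G) x v - rh G x * fderiv ℝ (mm a G) x v)) • NN a G x := by
    simp; module
  rw [e1]
  have b1 : ‖c • (fderiv ℝ (NN a G) x v - v)‖ ≤ L^4 * (2 * L^2 * ‖x‖ * ‖v‖) := by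
    rw [norm_smul, Real.norm_of_nonneg (h.c_nn hx)]
    gcongr
    · exact h.c_le hx
    · exact h.d_N_sub x v
  have b2 : ‖(c - 1) • v‖ ≤ L^6 * ‖x‖ * ‖v‖ := by
    rw [norm_smul, Real.norm_eq_abs]
    gcongr; exact h.c_sub hx
  have b3 : |mm a G x * fderiv ℝ (rh G) x v - rh G x * fderiv ℝ (mm a G) x v| ≤ 5 * L^4 * ‖x‖^4 * ‖v‖ := by
    have e2 : mm a G x * fderiv ℝ (rh G) x v - rh G x * fderiv ℝ (mm a G) x v =
      (mm a G x - rh G x) * (2 * ⟪G x, v⟫) - rh G x * (⟪fderiv ℝ (NN a G) x v - v, G x⟫ + ⟪NN a G x - x, G v⟫) := by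
      rw [h.d_r, h.d_m, inner_sub_left, inner_sub_left, ← h.Gsym x v, real_inner_comm v (G x)]; ring
    rw [e2]
    refine (abs_sub _ _).trans ?_
    rw [abs_mul, abs_mul, abs_mul, abs_two, abs_of_nonneg (h.rh_nn x)]
    have j1 : |⟪G x, v⟫| ≤ L * ‖x‖ * ‖v‖ := (abs_real_inner_le_norm _ _).trans (by gcongr; exact h.Gle x)
    have j2 : |⟪fderiv ℝ (NN a G) x v - v, G x⟫ + ⟪NN a G x - x, G v⟫| ≤ (2 * L^2 * ‖x‖ * ‖v‖) * (L * ‖x‖)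
        + (L^2 * ‖x‖^2) * (L * ‖v‖) := by
      refine (abs_add_le _ _).trans ?_
      gcongr
      · refine (abs_real_inner_le_norm _ _).trans ?_
        gcongr
        · exact h.d_N_sub x v
        · exact h.Gle x
      · refine (abs_real_inner_le_norm _ _).trans ?_
        gcongr
        · exact h.N_sub x
        · exact h.Gle v
    calc _ ≤ (L^3 * ‖x‖^3) * (2 * (L * ‖x‖ * ‖v‖)) + (L * ‖x‖^2) * ((2 * L^2 * ‖x‖ * ‖v‖) * (L * ‖x‖)
        + (L^2 * ‖x‖^2) * (L * ‖v‖)) := by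
          gcongr
          · exact h.m_sub x
          · exact h.rh_up x
      _ = _ := by ring
  have b4 : (mm a G x ^ 2)⁻¹ * ‖x‖^4 ≤ L^6 := by
    rw [inv_mul_le_iff₀ (by positivity)]
    calc ‖x‖^4 = (‖x‖^2)^2 := by ring
      _ ≤ (L^3 * mm a G x)^2 := by gcongr; exact h.mm_low x
      _ = _ := by ring
  have b5 : ‖((mm a G x ^ 2)⁻¹ * (mm a G x * fderiv ℝ (rh G) x v - rh G x * fderiv ℝ (mm a G) x v)) • NN a G x‖
      ≤ 5 * L^12 * ‖x‖ * ‖v‖ := by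
    rw [norm_smul, Real.norm_eq_abs, abs_mul, abs_of_nonneg (show 0 ≤ (mm a G x ^ 2)⁻¹ by positivity)]
    calc _ ≤ ((mm a G x ^ 2)⁻¹ * (5 * L^4 * ‖x‖^4 * ‖v‖)) * (L^2 * ‖x‖) := by
          gcongr; exact h.N_le x
      _ = ((mm a G x ^ 2)⁻¹ * ‖x‖^4) * (5 * L^4 * ‖v‖) * (L^2 * ‖x‖) := by ring
      _ ≤ L^6 * (5 * L^4 * ‖v‖) * (L^2 * ‖x‖) := by gcongr
      _ = _ := by ring
  have b6 : L^6 * (‖x‖ * ‖v‖) ≤ L^12 * (‖x‖ * ‖v‖) := by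
    gcongr; norm_num
  calc _ ≤ _ := norm_add₃_le
    _ ≤ L^4 * (2 * L^2 * ‖x‖ * ‖v‖) + L^6 * ‖x‖ * ‖v‖ + 5 * L^12 * ‖x‖ * ‖v‖ := by gcongr
    _ ≤ _ := by linarith

lemma d_Z0 : HasFDerivAt (ZZ a G) (ContinuousLinearMap.id ℝ (EE n)) 0 := by
  rw [hasFDerivAt_iff_isLittleO_nhds_zero]
  have h0 : ZZ a G 0 = 0 := by simp [ZZ, h.N_zero]
  have : (fun x => ZZ a G (0 + x) - ZZ a G 0 - (ContinuousLinearMap.id ℝ (EE n)) x) =O[nhds 0] fun x => ‖x‖^2 := by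
    apply Asymptotics.IsBigO.of_bound (2 * L^6)
    refine Filter.Eventually.of_forall fun x => ?_
    simpa [h0] using h.Z_sub x
  refine this.trans_isLittleO ?_
  exact Asymptotics.isLittleO_norm_pow_id one_lt_two

lemma d_Z_sub' (x : EE n) :
    ‖fderiv ℝ (ZZ a G) x - ContinuousLinearMap.id ℝ (EE n)‖ ≤ 8 * L^12 * ‖x‖ := by
  by_cases hx : x = 0
  · subst hx; rw [h.d_Z0.fderiv]; simp
  · exact h.d_Z_sub hx

lemma cd_Z : ContDiff ℝ 1 (ZZ a G) := by
  rw [contDiff_one_iff_fderiv]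
  constructor
  · intro x
    by_cases hx : x = 0
    · subst hx; exact h.d_Z0.differentiableAt
    · exact (h.d_Z hx 0).differentiableAt
  · rw [continuous_iff_continuousAt]
    intro x
    by_cases hx : x = 0
    · subst hx
      unfold ContinuousAt
      rw [h.d_Z0.fderiv, tendsto_iff_norm_sub_tendsto_zero]
      refine squeeze_zero (fun _ => norm_nonneg _) h.d_Z_sub' ?_
      have : Continuous fun x : EE n => 8 * L^12 * ‖x‖ := by fun_prop
      simpa using this.tendsto 0
    · have : ContDiffAt ℝ 1 (ZZ a G) x :=
        ((cd_r.contDiffAt).div h.cd_m.contDiffAt (h.mm_pos hx).ne').smul h.cd_N.contDiffAt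
      exact this.continuousAt_fderiv (by norm_num)

lemma c_mu : Continuous (mu a G) := by
  rw [continuous_iff_continuousAt]
  intro x
  by_cases hx : x = 0
  · subst hx
    have h0 : mu a G 0 = 1 := by simp [mu]
    unfold ContinuousAt
    rw [h0, tendsto_iff_norm_sub_tendsto_zero]
    refine squeeze_zero (fun _ => norm_nonneg _) h.mu_sub ?_
    have : Continuous fun x : EE n => L^6 * ‖x‖ := by fun_prop
    simpa using this.tendsto 0
  · have h1 : ContinuousAt (fun x => mm a G x / rh G x) x :=
      (h.cd_m.continuous.continuousAt).div cd_r.continuous.continuousAt (h.rh_pos hx).ne'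
    refine h1.congr ?_
    filter_upwards [isOpen_ne.mem_nhds hx] with y hy
    simp only [mu]
    rw [if_neg hy]

def KK (n : ℕ) (L Λ : ℝ) : ℝ := (8 + 3 * n) * L^12 + Λ

lemma fr {Λ : ℝ} (hΛ : 0 ≤ Λ) {u : EE n → ℝ} (hu : ContDiff ℝ 2 u) {R : ℝ} (hR : 0 < R)
    (hRK : 2 * (KK n L Λ)^2 * R ≤ 1)
    (eqn : ∀ x, ‖x‖ ≤ KK n L Λ * R → |dv (flux a u) x| ≤ Λ * |u x|) :
    Fr a (fun x => G x) (ZZ a G) (mu a G) (rh G) u (KK n L Λ) R := by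
  have hL := h.co.L0
  have hL1 := h.co.L1
  set K := KK n L Λ with hK
  have kn : (0:ℝ) ≤ n * L^12 := by positivity
  have k12 : 8 * L^12 ≤ K := by rw [hK]; unfold KK; linarith
  have k12n : 3 * n * L^12 ≤ K := by rw [hK]; unfold KK; nlinarith [pow_pos hL 12]
  have one12 : 1 ≤ L^12 := one_le_pow₀ hL1
  have hp : ∀ k ≤ 12, L^k ≤ K := fun k hk => by
    have : L^k ≤ L^12 := by gcongr
    linarith
  have hK1 : 1 ≤ K := by linarith
  have hK0 : 0 < K := by linarith
  have hΛK : Λ ≤ K := by rw [hK]; unfold KK; linarith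
  have hnorm : ∀ x, rh G x < R^2 → ‖x‖ ≤ K * R := by
    intro x hx
    apply le_of_sq_le_sq _ (by positivity)
    calc ‖x‖^2 ≤ L^3 * rh G x := h.rh_low x
      _ ≤ K * R^2 := by
        have := h.rh_nn x
        gcongr; exact hp 3 (by norm_num)
      _ ≤ (K*R)^2 := by nlinarith [mul_nonneg (mul_nonneg (sub_nonneg.mpr hK1) hK0.le) (sq_nonneg R)]
  have hmu : ∀ x, rh G x < R^2 → |mu a G x - 1| ≤ 1/2 := by
    intro x hx
    have h1 := h.mu_sub x
    have h2 := hnorm x hx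
    calc _ ≤ L^6 * ‖x‖ := h1
      _ ≤ K * (K * R) := by gcongr; exact hp 6 (by norm_num)
      _ ≤ 1/2 := by linarith
  refine ⟨hK1, hR, ?_, h.co.ha, hu, h.cd_N, h.cd_Z, G.continuous, h.c_mu, cd_r, h.d_r, ?_, ?_, h.co.sym, ?_, ?_,
    ?_, ?_, ?_, ?_, ?_, ?_, ?_, ?_, ?_, ?_⟩
  · nlinarith [mul_le_mul hK1 hK1 zero_le_one hK0.le]
  · intro x
    exact (h.rh_low x).trans (mul_le_mul_of_nonneg_right (hp 3 (by norm_num)) (h.rh_nn x))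
  · intro x
    have := hp 1 (by norm_num)
    rw [pow_one] at this
    exact (h.rh_up x).trans (by gcongr)
  · intro x v
    have := hp 1 (by norm_num)
    rw [pow_one] at this
    have h1 := h.co.ell x v
    have h2 : 0 ≤ ⟪a x v, v⟫ := nonneg_of_mul_nonneg_right ((sq_nonneg _).trans h1) hL
    exact h1.trans (by gcongr)
  · intro x
    have := hp 1 (by norm_num)
    rw [pow_one] at this
    exact (h.co.bda x).trans this
  · intro x
    by_cases hx : x = 0
    · subst hx; simp [ZZ, NN]
    · simp only [ZZ, mu, if_neg hx, smul_smul]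
      rw [div_mul_div_cancel₀ (h.rh_pos hx).ne', div_self (h.mm_pos hx).ne', one_smul]
      rfl
  · intro x
    by_cases hx : x = 0
    · subst hx; simp [ZZ, NN, rh]
    · simp only [ZZ]
      rw [inner_smul_left]
      exact div_mul_cancel₀ _ (h.mm_pos hx).ne'
  · intro x _
    have := hp 1 (by norm_num)
    rw [pow_one] at this
    exact (h.co.dab x).trans this
  · intro x hx
    exact (eqn x (hnorm x hx)).trans (by gcongr)
  · intro x hx
    linarith [(abs_le.mp (hmu x hx)).1]
  · intro x hx
    linarith [(abs_le.mp (hmu x hx)).2]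
  · intro x hx
    have h1 : ‖fderiv ℝ (NN a G) x - ContinuousLinearMap.id ℝ (EE n)‖ ≤ 2 * L^2 * ‖x‖ := by
      apply ContinuousLinearMap.opNorm_le_bound _ (by positivity)
      intro v
      exact h.d_N_sub x v
    have h2 := abs_tr_le (fderiv ℝ (NN a G) x - ContinuousLinearMap.id ℝ (EE n))
    rw [tr_sub, tr_id, ← dv_eq_tr] at h2
    have h3 := h.mu_sub x
    have e : dv (fun x => a x (G x)) x - n * mu a G x = (dv (NN a G) x - n) - n * (mu a G x - 1) := by
      have : dv (fun x => a x (G x)) x = dv (NN a G) x := rfl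
      rw [this]; ring
    rw [e]
    refine (abs_sub _ _).trans ?_
    rw [abs_mul, Nat.abs_cast]
    calc _ ≤ n * (2 * L^2 * ‖x‖) + n * (L^6 * ‖x‖) := by
          gcongr
          exact h2.trans (by gcongr)
      _ ≤ n * (2 * L^12 * ‖x‖) + n * (L^12 * ‖x‖) := by
          gcongr <;> first | exact hL1 | norm_num
      _ = 3 * n * L^12 * ‖x‖ := by ring
      _ ≤ _ := by gcongr
  · intro x hx
    exact (h.d_Z_sub' x).trans (by gcongr)
  · intro x hx
    exact (h.Z_le x).trans (by gcongr; exact hp 6 (by norm_num))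
  · intro x
    have := hp 1 (by norm_num)
    rw [pow_one] at this
    exact (h.Gle x).trans (by gcongr)
end Gm

section
variable {n : ℕ}

lemma gradient_translate (u : EE n → ℝ) (y x : EE n) :
    gradient (fun x => u (x + y)) x = gradient u (x + y) := by
  unfold gradient
  rw [fderiv_comp_add_right]

lemma flux_translate (a : EE n → EE n →L[ℝ] EE n) (u : EE n → ℝ) (y : EE n) :
    flux (fun x => a (x + y)) (fun x => u (x + y)) = fun x => flux a u (x + y) := by
  ext1 x
  unfold flux
  rw [gradient_translate]

lemma dv_translate (X : EE n → EE n) (y x : EE n) : dv (fun x => X (x + y)) x = dv X (x + y) := by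
  unfold dv
  rw [fderiv_comp_add_right]

lemma setIntegral_translate (f : EE n → ℝ) (y : EE n) (s : Set (EE n)) :
    ∫ x in (fun x => x + y) ⁻¹' s, f (x + y) = ∫ x in s, f x :=
  (measurePreserving_add_right volume y).setIntegral_preimage_emb
    (measurableEmbedding_addRight y) f s

lemma preim_ball (x0 y : EE n) (r : ℝ) : (fun x => x + y) ⁻¹' (ball x0 r) = ball (x0 - y) r := by
  ext x; simp [mem_ball, dist_eq_norm]

lemma setIntegral_pos {u : EE n → ℝ} (hu : Continuous u) {x : EE n} {r : ℝ} (hx : ∃ z ∈ ball x r, u z ≠ 0) :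
    0 < ∫ z in ball x r, u z ^ 2 := by
  have hu2int : IntegrableOn (fun x => u x ^ 2) (ball x r) :=
    ((hu.pow 2).continuousOn.integrableOn_compact (isCompact_closedBall x r)).mono_set ball_subset_closedBall
  rw [setIntegral_pos_iff_support_of_nonneg_ae (Filter.Eventually.of_forall fun z => sq_nonneg _) hu2int]
  obtain ⟨z, hz, hz0⟩ := hx
  apply IsOpen.measure_pos
  · exact ((hu.pow 2).isOpen_support).inter isOpen_ball
  · exact ⟨z, by simpa using hz0, hz⟩

end

namespace Fr
variable {n : ℕ} {a : EE n → EE n →L[ℝ] EE n} {b Z : EE n → EE n} {μ ρ u : EE n → ℝ} {K R : ℝ}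
variable (h : Fr a b Z μ ρ u K R)
include h

lemma HH_ge : R^4 / 8 * ∫ x in ball (0:EE n) (R / (2*K)), u x ^ 2 ≤ HH μ ρ u R := by
  have hK0 := h.K0
  have hK1 := h.K1
  have hcu := h.cu
  have hcμ := h.hμ
  have hR := h.R0
  have hu2int : IntegrableOn (fun x => u x ^ 2) (ball (0:EE n) (R / (2*K))) :=
    ((hcu.pow 2).continuousOn.integrableOn_compact (isCompact_closedBall 0 (R / (2*K)))).mono_set ball_subset_closedBall
  rw [← integral_const_mul, ← integral_indicator measurableSet_ball]
  unfold HH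
  apply integral_mono _ (h.intg (by fun_prop) R 1)
  · intro x
    simp only
    by_cases hx : x ∈ ball (0:EE n) (R / (2*K))
    · rw [indicator_of_mem hx]
      rw [mem_ball_zero_iff] at hx
      have h1 : ρ x ≤ R^2 / 4 := by
        calc ρ x ≤ K * ‖x‖^2 := h.ρup x
          _ ≤ K * (R / (2*K))^2 := by gcongr
          _ = R^2 / 4 * (1 / K) := by field_simp; ring
          _ ≤ R^2/4 * 1 := by gcongr; rw [div_le_one hK0]; exact hK1
          _ = _ := by ring
      have h2 : R^2 / 2 ≤ WW ρ R x := by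
        refine le_trans ?_ (le_max_left (R^2 - ρ x) 0)
        nlinarith
      have h3 := h.mulow x (by nlinarith)
      calc R^4 / 8 * u x ^ 2 = 1/2 * u x ^ 2 * (R^2/2)^2 := by ring
        _ ≤ μ x * u x ^ 2 * WW ρ R x ^ 2 := by gcongr
    · rw [indicator_of_notMem hx]
      by_cases hx : ρ x < R^2
      · have h3 := h.mulow x hx
        have h4 : 0 ≤ μ x := by linarith
        have h5 := WW_nonneg (ρ := ρ) R x
        exact mul_nonneg (mul_nonneg h4 (sq_nonneg _)) (pow_nonneg h5 _)
      · simp [WW_eq_zero (not_lt.mp hx)]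
  · rw [integrable_indicator_iff measurableSet_ball]
    exact hu2int.const_mul _

lemma EN_le {B : EE n → ℝ} (hB : ∀ x, en a u x ≤ B x) (hBi : Integrable B) :
    EN a ρ u R ≤ R^6 * ∫ x, B x := by
  have hce := h.cen
  rw [← integral_const_mul]
  unfold EN
  apply integral_mono (h.intg (by fun_prop) R 2) (hBi.const_mul _)
  intro x
  have hw0 := WW_nonneg (ρ := ρ) R x
  have hws := WW_le (r := R) (h.ρnn x)
  have := h.en_nonneg x
  calc en a u x * WW ρ R x ^ 3 ≤ B x * (R^2)^3 := by
        gcongr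
        · exact this.trans (hB x)
        · exact hB x
    _ = _ := by ring
end Fr

section
variable {n : ℕ} {a : EE n → EE n →L[ℝ] EE n} {L Λ δ : ℝ} {u : EE n → ℝ} {x0 : EE n}

def RR (n : ℕ) (L Λ δ : ℝ) : ℝ := min (1 / (2 * (Gm.KK n L Λ)^2)) (δ / (4 * Gm.KK n L Λ))

lemma KK_one (hL : 1 ≤ L) (hΛ : 0 ≤ Λ) : 1 ≤ Gm.KK n L Λ := by
  unfold Gm.KK
  have : 1 ≤ L^12 := one_le_pow₀ hL
  have : (0:ℝ) ≤ n * L^12 := by positivity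
  nlinarith

lemma RR_pos (hL : 1 ≤ L) (hΛ : 0 ≤ Λ) (hδ : 0 < δ) : 0 < RR n L Λ δ := by
  have := KK_one (n := n) hL hΛ
  unfold RR
  apply lt_min <;> positivity

lemma exists_fr (hc : Coef a L) (hu : ContDiff ℝ 2 u) (hΛ : 0 ≤ Λ) (hδ : 0 < δ)
    (eqn : ∀ x ∈ ball x0 δ, |dv (flux a u) x| ≤ Λ * |u x|) {y : EE n} (hy : y ∈ ball x0 (δ/2)) :
    ∃ b Z μ ρ, Fr (fun x => a (x + y)) b Z μ ρ (fun x => u (x + y)) (Gm.KK n L Λ) (RR n L Λ δ) := by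
  have hc' := hc.translate y
  obtain ⟨G, hG⟩ := hc'.exists_inv
  have hK := KK_one (n := n) hc.L1 hΛ
  have hu' : ContDiff ℝ 2 (fun x => u (x + y)) := hu.comp (contDiff_id.add contDiff_const)
  refine ⟨_, _, _, _, Gm.fr ⟨hc', hG⟩ hΛ hu' (RR_pos hc.L1 hΛ hδ) ?_ ?_⟩
  · have : RR n L Λ δ ≤ 1 / (2 * (Gm.KK n L Λ)^2) := min_le_left _ _
    rwa [le_div_iff₀ (by positivity), mul_comm] at this
  · intro x hx
    rw [flux_translate, dv_translate]
    apply eqn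
    have h1 : RR n L Λ δ ≤ δ / (4 * Gm.KK n L Λ) := min_le_right _ _
    have h2 : Gm.KK n L Λ * RR n L Λ δ ≤ δ / 4 := by
      calc _ ≤ Gm.KK n L Λ * (δ / (4 * Gm.KK n L Λ)) := by gcongr
        _ = _ := by field_simp
    rw [mem_ball, dist_eq_norm] at hy ⊢
    calc ‖x + y - x0‖ = ‖x + (y - x0)‖ := by congr 1; abel
      _ ≤ ‖x‖ + ‖y - x0‖ := norm_add_le _ _
      _ < δ := by linarith

lemma ucp_local (hc : Coef a L) (hu : ContDiff ℝ 2 u) (hΛ : 0 ≤ Λ) (hδ : 0 < δ)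
    (eqn : ∀ x ∈ ball x0 δ, |dv (flux a u) x| ≤ Λ * |u x|) :
    ∃ η > 0, ∀ y ∈ ball x0 η, (∀ᶠ z in nhds y, u z = 0) → ∀ᶠ z in nhds x0, u z = 0 := by
  have hK := KK_one (n := n) hc.L1 hΛ
  have hR := RR_pos (n := n) hc.L1 hΛ hδ
  set K := Gm.KK n L Λ with hKdef
  set R := RR n L Λ δ with hRdef
  refine ⟨min (δ/2) (R / (4*K)), lt_min (by positivity) (by positivity), ?_⟩
  intro y hy hy0
  have hy1 : y ∈ ball x0 (δ/2) := ball_subset_ball (min_le_left _ _) hy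
  have hy2 : y ∈ ball x0 (R / (4*K)) := ball_subset_ball (min_le_right _ _) hy
  obtain ⟨b, Z, μ, ρ, h⟩ := exists_fr hc hu hΛ hδ eqn hy1
  rw [← hKdef, ← hRdef] at h
  have hHR : ¬ 0 < HH μ ρ (fun x => u (x + y)) R := by
    intro hpos
    obtain ⟨ε, hε, hε2⟩ := Metric.eventually_nhds_iff.mp hy0
    set r := min R (ε / K) with hr
    have hr0 : 0 < r := lt_min hR (by positivity)
    have hrR : r ≤ R := min_le_left _ _
    have h1 := h.doubling hpos hr0 hrR le_rfl
    have h2 := h.HH_le hr0 hrR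
    have h3 : ∫ x in ball (0:EE n) (K * r), u (x + y) ^ 2 = 0 := by
      rw [setIntegral_eq_zero_of_forall_eq_zero]
      intro x hx
      rw [mem_ball_zero_iff] at hx
      have : u (x + y) = 0 := by
        apply hε2
        rw [dist_eq_norm, add_sub_cancel_right]
        have : K * r ≤ K * (ε / K) := by gcongr; exact min_le_right _ _
        have e : K * (ε / K) = ε := by field_simp
        linarith
      rw [this]; simp
    rw [h3, mul_zero] at h2
    have h4 := h.HH_nonneg hr0 hrR
    have h5 : HH μ ρ (fun x => u (x + y)) r = 0 := le_antisymm h2 h4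
    rw [h5, mul_zero] at h1
    linarith
  have hge := h.HH_ge
  by_contra hcon
  apply hHR
  refine lt_of_lt_of_le ?_ hge
  apply mul_pos (by positivity)
  apply setIntegral_pos h.cu
  have : ∃ z ∈ ball x0 (R / (4*K)), u z ≠ 0 := by
    by_contra hne
    push Not at hne
    exact hcon (Filter.mem_of_superset (ball_mem_nhds x0 (by positivity)) hne)
  obtain ⟨z, hz, hz0⟩ := this
  refine ⟨z - y, ?_, by simpa using hz0⟩
  rw [mem_ball_zero_iff]
  rw [mem_ball, dist_eq_norm] at hz hy2
  calc ‖z - y‖ = ‖(z - x0) - (y - x0)‖ := by congr 1; abel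
    _ ≤ ‖z - x0‖ + ‖y - x0‖ := norm_sub_le _ _
    _ < R / (4*K) + R / (4*K) := by gcongr
    _ = _ := by field_simp; ring

lemma star (hn : 2 ≤ n) (hc : Coef a L) (hu : ContDiff ℝ 2 u) (hus : HasCompactSupport u) (hΛ : 0 ≤ Λ) (hδ : 0 < δ)
    (eqn : ∀ x ∈ ball x0 δ, |dv (flux a u) x| ≤ Λ * |u x|) (hne : ¬ ∀ᶠ z in nhds x0, u z = 0) :
    ∃ η > 0, ∃ C > 0, ∀ y ∈ ball x0 η, ∀ r, 0 < r → r ≤ η → ∀ F : Set (EE n), MeasurableSet F → F ⊆ ball y r →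
      ∫ x in F, u x ^ 2 ≤ C * (volume.real F) ^ ((1:ℝ)/n) * r⁻¹ * ∫ x in ball y (r / (4*n)), u x ^ 2 := by
  have hK := KK_one (n := n) hc.L1 hΛ
  have hR := RR_pos (n := n) hc.L1 hΛ hδ
  set K := Gm.KK n L Λ with hKdef
  set R := RR n L Λ δ with hRdef
  obtain ⟨Cs, hCs, hsob⟩ := sob n hn
  have hn0 : 0 < n := by omega
  have hL := hc.L0
  set c0 := ∫ z in ball x0 (R / (4*K)), u z ^ 2 with hc0
  have hc0pos : 0 < c0 := by
    apply setIntegral_pos hu.continuous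
    by_contra hne'
    push Not at hne'
    exact hne (Filter.mem_of_superset (ball_mem_nhds x0 (by positivity)) hne')
  set B : ℝ := R^6 * ∫ x, L * ‖gradient u x‖^2 with hB
  have hB0 : 0 ≤ B := mul_nonneg (by positivity) (integral_nonneg fun x => by positivity)
  set M := B / (R^4 / 8 * c0) with hM
  have hM0 : 0 ≤ M := by positivity
  have hcg : Continuous (gradient u) := (contDiff_gradient hu).continuous
  have hgi : Integrable (fun x => L * ‖gradient u x‖^2) := by
    apply Integrable.const_mul
    apply Continuous.integrable_of_hasCompactSupport
    · fun_prop
    · have : HasCompactSupport (gradient u) := by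
        have h1 := hus.fderiv (𝕜 := ℝ)
        refine h1.comp_left (g := fun f => (InnerProductSpace.toDual ℝ (EE n)).symm f) (by simp)
      exact this.comp_left (g := fun v => ‖v‖^2) (by simp)
  refine ⟨min (δ/2) (R / (4*K)), lt_min (by positivity) (by positivity),
    16 * Cs * (K * ((M + 1) * Real.exp (3*((4+n)*K^4))) + 18 * K^2) *
      (2 * (8 * n * K^2) ^ ((4+n:ℕ) + 2*((4+n)*K^4) + (M + 1) * Real.exp (3*((4+n)*K^4)))), by positivity, ?_⟩
  intro y hy r hr hrη F hFm hF
  have hy1 : y ∈ ball x0 (δ/2) := ball_subset_ball (min_le_left _ _) hy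
  have hy2 : y ∈ ball x0 (R / (4*K)) := ball_subset_ball (min_le_right _ _) hy
  obtain ⟨b, Z, μ, ρ, h⟩ := exists_fr hc hu hΛ hδ eqn hy1
  rw [← hKdef, ← hRdef] at h
  have hEN : EN (fun x => a (x + y)) ρ (fun x => u (x + y)) R ≤ B := by
    have := h.EN_le (B := fun x => L * ‖gradient u (x + y)‖^2) (fun x => ?_) (hgi.comp_add_right y)
    · rw [integral_add_right_eq_self (fun x => L * ‖gradient u x‖^2) y] at this
      exact this
    · unfold en flux
      rw [gradient_translate]
      refine (real_inner_le_norm _ _).trans ?_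
      calc _ ≤ (‖a (x+y)‖ * ‖gradient u (x+y)‖) * ‖gradient u (x+y)‖ := by
            gcongr; exact ContinuousLinearMap.le_opNorm _ _
        _ ≤ (L * ‖gradient u (x+y)‖) * ‖gradient u (x+y)‖ := by gcongr; exact hc.bda _
        _ = _ := by ring
  have hHR : R^4 / 8 * c0 ≤ HH μ ρ (fun x => u (x + y)) R := by
    refine le_trans ?_ h.HH_ge
    gcongr
    rw [hc0, ← setIntegral_translate (fun x => u x ^ 2) y, preim_ball]
    apply setIntegral_mono_set
    · exact ((h.cu.pow 2).continuousOn.integrableOn_compact (isCompact_closedBall 0 (R / (2*K)))).mono_set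
        ball_subset_closedBall
    · exact Filter.Eventually.of_forall fun z => sq_nonneg _
    · apply HasSubset.Subset.eventuallyLE
      apply ball_subset_ball'
      rw [mem_ball, dist_eq_norm] at hy2
      rw [dist_eq_norm, sub_zero, norm_sub_rev]
      have : R / (4*K) + R / (4*K) = R / (2*K) := by field_simp; ring
      linarith
  have hHpos : 0 < HH μ ρ (fun x => u (x + y)) R := lt_of_lt_of_le (by positivity) hHR
  have hq : EN (fun x => a (x + y)) ρ (fun x => u (x + y)) R / HH μ ρ (fun x => u (x + y)) R ≤ M := by
    rw [hM]; gcongr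
  have hrR : 2 * K * r ≤ R := by
    have h1 : r ≤ R / (4*K) := hrη.trans (min_le_right _ _)
    calc 2 * K * r ≤ 2 * K * (R / (4*K)) := by gcongr
      _ = R / 2 := by field_simp; ring
      _ ≤ R := by linarith
  have hFt : (fun x => x + y) ⁻¹' F ⊆ ball 0 r := by
    have := preimage_mono (f := fun x => x + y) hF
    rwa [preim_ball, sub_self] at this
  have := h.main_est hCs hsob hn0 hHpos hq hr hrR (hFm.preimage (measurable_add_const y)) hFt
  have e1 := setIntegral_translate (fun x => u x ^ 2) y F
  have e2 := setIntegral_translate (fun x => u x ^ 2) y (ball y (r / (4*n)))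
  rw [preim_ball, sub_self] at e2
  rw [e1, e2] at this
  have e3 : volume.real ((fun x => x + y) ⁻¹' F) = volume.real F := by
    unfold Measure.real; rw [measure_preimage_add_right]
  rw [e3] at this
  exact this
end


section
variable {n : ℕ}

def Mat (A : Fin n → Fin n → EE n → ℝ) (x : EE n) : EE n →L[ℝ] EE n :=
  ∑ i, ∑ j, A i j x • ((EuclideanSpace.proj j : EE n →L[ℝ] ℝ).smulRight (EuclideanSpace.single i (1:ℝ)))

lemma Mat_apply (A : Fin n → Fin n → EE n → ℝ) (x v : EE n) (i : Fin n) :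
    (Mat A x v) i = ∑ j, A i j x * v j := by
  unfold Mat
  simp [Finset.sum_apply, Pi.single_apply]

lemma inner_Mat (A : Fin n → Fin n → EE n → ℝ) (x v w : EE n) :
    ⟪Mat A x v, w⟫ = ∑ i, ∑ j, A i j x * v j * w i := by
  rw [PiLp.inner_apply]
  refine Finset.sum_congr rfl fun i _ => ?_
  rw [Mat_apply]
  simp only [RCLike.inner_apply, conj_trivial]
  rw [Finset.mul_sum]
  refine Finset.sum_congr rfl fun j _ => ?_
  ring

lemma contDiff_cut {F : Type*} [NormedAddCommGroup F] [NormedSpace ℝ F] {k : WithTop ℕ∞} {Ω : Set (EE n)} (hΩ : IsOpen Ω)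
    {x0 : EE n} (χ : ContDiffBump x0) (hχ : closedBall x0 χ.rOut ⊆ Ω) (hk : ContDiff ℝ k χ) {g : EE n → F}
    (hg : ContDiffOn ℝ k g Ω) : ContDiff ℝ k (fun x => χ x • g x) := by
  rw [contDiff_iff_contDiffAt]
  intro x
  by_cases this : x ∈ tsupport χ
  swap
  · rw [notMem_tsupport_iff_eventuallyEq] at this
    apply (contDiffAt_const (c := (0:F))).congr_of_eventuallyEq
    filter_upwards [this] with y hy
    simp [hy]
  rw [χ.tsupport_eq] at this
  exact hk.contDiffAt.smul (hg.contDiffAt (hΩ.mem_nhds (hχ this)))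

lemma hcs_cut {F : Type*} [NormedAddCommGroup F] [NormedSpace ℝ F] 
    {x0 : EE n} (χ : ContDiffBump x0) {g : EE n → F}
     : HasCompactSupport (fun x => χ x • g x) := 
  χ.hasCompactSupport.smul_right (f' := g)

lemma bound_cs {F : Type*} [NormedAddCommGroup F] [NormedSpace ℝ F] {h : EE n → F} (hh : ContDiff ℝ 1 h)
    (hc : HasCompactSupport h) : ∃ C : ℝ, ∀ x, ‖h x‖ ≤ C :=
  hc.exists_bound_of_continuous hh.continuous

lemma bound_fd {F : Type*} [NormedAddCommGroup F] [NormedSpace ℝ F] {h : EE n → F} (hh : ContDiff ℝ 1 h)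
    (hc : HasCompactSupport h) : ∃ C : ℝ, ∀ x, ‖fderiv ℝ h x‖ ≤ C :=
  (hc.fderiv (𝕜 := ℝ)).exists_bound_of_continuous (hh.continuous_fderiv (by norm_num))

lemma gradient_coord (u : EE n → ℝ) (x : EE n) (j : Fin n) : (gradient u x) j = pd j u x := by
  have : ⟪gradient u x, EuclideanSpace.single j (1:ℝ)⟫ = pd j u x := by
    unfold gradient pd
    rw [InnerProductSpace.toDual_symm_apply]
  rw [← this, EuclideanSpace.inner_single_right]
  simp

lemma localize {Ω : Set (EE n)} (hΩo : IsOpen Ω) {A : Fin n → Fin n → EE n → ℝ} (hA : EllipticSym Ω A)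
    {q u : EE n → ℝ} (hqb : ∃ Λ : ℝ, ∀ x ∈ Ω, |q x| ≤ Λ) (hu2 : ContDiffOn ℝ 2 u Ω)
    (hsol : IsSolution A q u Ω) {x0 : EE n} (hx0 : x0 ∈ Ω) :
    ∃ (a : EE n → EE n →L[ℝ] EE n) (v : EE n → ℝ) (L Λ δ : ℝ), Coef a L ∧ ContDiff ℝ 2 v ∧
      HasCompactSupport v ∧ 0 ≤ Λ ∧ 0 < δ ∧ ball x0 δ ⊆ Ω ∧ (∀ x ∈ ball x0 δ, v x = u x) ∧
      (∀ x ∈ ball x0 δ, |dv (flux a v) x| ≤ Λ * |v x|) := by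
  obtain ⟨hsym, hC, lam, hlam, hell⟩ := hA
  obtain ⟨Λ, hΛ⟩ := hqb
  obtain ⟨ε, hε, hεΩ⟩ := Metric.nhds_basis_closedBall.mem_iff.mp (hΩo.mem_nhds hx0)
  obtain ⟨χ, hχ1, hχ2⟩ : ∃ χ : ContDiffBump x0, χ.rIn = ε/2 ∧ χ.rOut = ε :=
    ⟨⟨ε/2, ε, by positivity, by linarith⟩, rfl, rfl⟩
  have hχΩ : closedBall x0 χ.rOut ⊆ Ω := by rwa [hχ2]
  have hχ0 : ∀ x, x ∉ Ω → χ x = 0 := by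
    intro x hx
    by_contra h
    exact hx (hχΩ (by rw [← χ.tsupport_eq]; exact subset_tsupport _ h))
  have hCΩ : ∀ i j, ContDiffOn ℝ 1 (A i j) Ω := fun i j => (hC i j).mono subset_closure
  have hM : ContDiffOn ℝ 1 (fun x => Mat A x - ContinuousLinearMap.id ℝ (EE n)) Ω := by
    unfold Mat
    refine ContDiffOn.sub (ContDiffOn.sum fun i _ => ContDiffOn.sum fun j _ => (hCΩ i j).smul contDiffOn_const) contDiffOn_const
  have hh := contDiff_cut (k := 1) hΩo χ hχΩ (by exact_mod_cast χ.contDiff (n := 1)) hM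
  have hhc := hcs_cut χ (g := fun x => Mat A x - ContinuousLinearMap.id ℝ (EE n))
  obtain ⟨h, hhd⟩ : ∃ h : EE n → EE n →L[ℝ] EE n, h = fun x => χ x • (Mat A x - ContinuousLinearMap.id ℝ (EE n)) := ⟨_, rfl⟩
  rw [← hhd] at hh hhc
  obtain ⟨C1, hC1⟩ := bound_cs hh hhc
  obtain ⟨C2, hC2⟩ := bound_fd hh hhc
  obtain ⟨a, had⟩ : ∃ a : EE n → EE n →L[ℝ] EE n, a = fun x => ContinuousLinearMap.id ℝ (EE n) + h x := ⟨_, rfl⟩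
  have hav : ∀ x v w, ⟪a x v, w⟫ = (1 - χ x) * ⟪v, w⟫ + χ x * ⟪Mat A x v, w⟫ := by
    intro x v w
    simp only [had, hhd, add_apply, smul_apply, sub_apply, ContinuousLinearMap.id_apply, inner_add_left, inner_smul_left, inner_sub_left, conj_trivial]
    ring
  have hca : ContDiff ℝ 1 a := by rw [had]; exact contDiff_const.add hh
  have hcv : ContDiff ℝ 2 (fun x => χ x * u x) := contDiff_cut (k := 2) hΩo χ hχΩ (by exact_mod_cast χ.contDiff (n := 2)) hu2
  have hball : ball x0 (ε/2) ⊆ Ω := (ball_subset_closedBall.trans (closedBall_subset_closedBall (by linarith))).trans hεΩ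
  have hχone : ∀ x ∈ ball x0 (ε/2), χ x = 1 := fun x hx => χ.one_of_mem_closedBall (by rw [hχ1]; exact ball_subset_closedBall hx)
  obtain ⟨L, hL1, hL2, hL3, hL4⟩ : ∃ L : ℝ, 1 ≤ L ∧ 1 ≤ L * lam ∧ 1 + C1 ≤ L ∧ C2 ≤ L := by
    refine ⟨max (max 1 (1/lam)) (max (1 + C1) C2), ?_, ?_, ?_, ?_⟩
    · simp
    · rw [← div_le_iff₀ hlam]; simp
    · simp
    · simp
  refine ⟨a, fun x => χ x * u x, L, max Λ 0, ε/2, ?_, hcv, hcs_cut χ (g := u), le_max_right _ _, by positivity, hball, ?_, ?_⟩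
  · refine ⟨hL1, hca, ?_, ?_, ?_, ?_⟩
    · intro x v w
      rw [hav, ← real_inner_comm v (a x w), hav, real_inner_comm v w]
      by_cases hx : x ∈ Ω
      · congr 2
        rw [inner_Mat, inner_Mat, Finset.sum_comm]
        refine Finset.sum_congr rfl fun i _ => Finset.sum_congr rfl fun j _ => ?_
        rw [hsym j i x (subset_closure hx)]; ring
      · rw [hχ0 x hx]; simp
    · intro x v
      rw [hav, real_inner_self_eq_norm_sq]
      by_cases hx : x ∈ Ω
      · have h1 := hell x hx v
        have h2 : lam * ‖v‖^2 ≤ ⟪Mat A x v, v⟫ := by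
          rw [inner_Mat]
          refine h1.trans (le_of_eq ?_)
          refine Finset.sum_congr rfl fun i _ => Finset.sum_congr rfl fun j _ => ?_
          ring
        have h3 := χ.nonneg (x := x)
        have h4 := χ.le_one (x := x)
        have h5 := sq_nonneg ‖v‖
        calc ‖v‖^2 = (1 - χ x) * (1 * ‖v‖^2) + χ x * (1 * ‖v‖^2) := by ring
          _ ≤ (1 - χ x) * (L * ‖v‖^2) + χ x * (L * lam * ‖v‖^2) := by
            have : 0 ≤ 1 - χ x := by linarith
            gcongr
          _ = L * ((1 - χ x) * ‖v‖^2 + χ x * (lam * ‖v‖^2)) := by ring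
          _ ≤ _ := by gcongr
      · rw [hχ0 x hx]; simp; nlinarith [sq_nonneg ‖v‖]
    · intro x
      rw [had]
      refine (norm_add_le _ _).trans (le_trans ?_ hL3)
      gcongr
      · exact ContinuousLinearMap.norm_id_le
      · exact hC1 x
    · intro x
      rw [had, fderiv_const_add]
      exact (hC2 x).trans hL4
  · intro x hx
    simp [hχone x hx]
  · intro x hx
    have hxΩ := hball hx
    have hfd : DifferentiableAt ℝ (flux a (fun x => χ x * u x)) x :=
      (contDiff_flux hca hcv).differentiable (by norm_num) x
    have key : dv (flux a (fun x => χ x * u x)) x = ∑ i, ∑ j, pd i (fun y => A i j y * pd j u y) x := by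
      unfold dv
      refine Finset.sum_congr rfl fun i _ => ?_
      have e1 : (fderiv ℝ (flux a (fun x => χ x * u x)) x (EuclideanSpace.single i 1)) i =
          fderiv ℝ (fun y => (flux a (fun x => χ x * u x) y) i) x (EuclideanSpace.single i 1) := by
        have := ((EuclideanSpace.proj i : EE n →L[ℝ] ℝ).hasFDerivAt.comp x hfd.hasFDerivAt).fderiv
        have e : (fun y => (flux a (fun x => χ x * u x) y) i) = (EuclideanSpace.proj i : EE n →L[ℝ] ℝ) ∘ (flux a (fun x => χ x * u x)) := rfl
        rw [e, this]; rfl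
      rw [e1]
      have e2 : (fun y => (flux a (fun x => χ x * u x) y) i) =ᶠ[nhds x] fun y => ∑ j, A i j y * pd j u y := by
        filter_upwards [isOpen_ball.mem_nhds hx] with y hy
        have f1 : a y = Mat A y := by
          simp [had, hhd, hχone y hy]
        have f2 : (fun x => χ x * u x) =ᶠ[nhds y] u := by
          filter_upwards [isOpen_ball.mem_nhds hy] with z hz
          simp [hχone z hz]
        have f3 : gradient (fun x => χ x * u x) y = gradient u y := by
          unfold gradient; rw [f2.fderiv_eq]
        unfold flux
        rw [f1, f3, Mat_apply]
        refine Finset.sum_congr rfl fun j _ => ?_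
        rw [gradient_coord]
      rw [e2.fderiv_eq, fderiv_fun_sum]
      · simp [pd]
      · intro j _
        have g1 : DifferentiableAt ℝ (A i j) x := ((hCΩ i j).contDiffAt (hΩo.mem_nhds hxΩ)).differentiableAt (by norm_num)
        have g2 : DifferentiableAt ℝ (fderiv ℝ u) x :=
          ((hu2.contDiffAt (hΩo.mem_nhds hxΩ)).fderiv_right (m := 1) (by norm_num)).differentiableAt (by norm_num)
        exact g1.mul (g2.clm_apply (differentiableAt_const _))
    rw [key]
    have h1 := hsol x hxΩ
    have h2 : ∑ i, ∑ j, pd i (fun y => A i j y * pd j u y) x = - (q x * u x) := by linarith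
    simp only
    rw [h2, abs_neg, abs_mul, hχone x hx, one_mul]
    gcongr
    exact (hΛ x hxΩ).trans (le_max_left _ _)

lemma ucp {Ω : Set (EE n)} (hΩo : IsOpen Ω) (hΩc : IsConnected Ω) {A : Fin n → Fin n → EE n → ℝ} (hA : EllipticSym Ω A)
    {q u : EE n → ℝ} (hqb : ∃ Λ : ℝ, ∀ x ∈ Ω, |q x| ≤ Λ) (hu2 : ContDiffOn ℝ 2 u Ω)
    (hsol : IsSolution A q u Ω) (hu0 : ∃ x ∈ Ω, u x ≠ 0) {x0 : EE n} (hx0 : x0 ∈ Ω) :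
    ¬ ∀ᶠ z in nhds x0, u z = 0 := by
  intro h0
  have ho : IsOpen {y | ∀ᶠ z in nhds y, u z = 0} := isOpen_setOfPred_eventually_nhds
  have hsub : Ω ⊆ {y | ∀ᶠ z in nhds y, u z = 0} := by
    apply hΩc.isPreconnected.subset_of_closure_inter_subset ho ⟨x0, hx0, h0⟩
    rintro x ⟨hx, hxΩ⟩
    obtain ⟨a, v, L, Λ, δ, hc, hv, -, hΛ, hδ, hb, hvu, eqn⟩ := localize hΩo hA hqb hu2 hsol hxΩ
    obtain ⟨η, hη, H⟩ := ucp_local hc hv hΛ hδ eqn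
    obtain ⟨y, hy1, hy2⟩ := Metric.mem_closure_iff.mp hx (min η δ) (lt_min hη hδ)
    have hy3 : y ∈ ball x η := by rw [mem_ball']; exact hy2.trans_le (min_le_left _ _)
    have hy4 : y ∈ ball x δ := by rw [mem_ball']; exact hy2.trans_le (min_le_right _ _)
    have := H y hy3 (by
      filter_upwards [hy1, isOpen_ball.mem_nhds hy4] with z h1 h2
      rw [hvu z h2, h1])
    filter_upwards [this, ball_mem_nhds x hδ] with z h1 h2
    rw [← hvu z h2, h1]
  obtain ⟨x, hx, hx2⟩ := hu0
  exact hx2 (hsub hx).self_of_nhds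
end

open scoped ENNReal in
lemma comp_union {X κι : Type*} [MeasurableSpace X] [Countable κι] {α β : Measure X} {c : ℝ≥0∞} (V : κι → Set X)
    (hV : ∀ i, MeasurableSet (V i)) (hd : Pairwise (Function.onFun Disjoint V)) (H : ∀ i, α (V i) ≤ c * β (V i)) :
    α (⋃ i, V i) ≤ c * β (⋃ i, V i) := by
  calc α (⋃ i, V i) ≤ ∑' i, α (V i) := measure_iUnion_le _
    _ ≤ ∑' i, c * β (V i) := ENNReal.tsum_le_tsum H
    _ = c * β (⋃ i, V i) := by rw [ENNReal.tsum_mul_left, measure_iUnion hd hV]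

/-- dyadic structure -/
structure Dy {X ι : Type*} [MeasurableSpace X] [MeasurableSpace ι] (μ ν : Measure X) (w : X → ENNReal)
    (idx : ℕ → X → ι) (o : X) (ε θ c : ENNReal) : Prop where
  meas : ∀ k, Measurable (idx k)
  nest : ∀ k x y, idx (k+1) x = idx (k+1) y → idx k x = idx k y
  μ0 : ∀ k x, μ (idx k ⁻¹' {idx k x}) ≠ 0
  μt : ∀ k x, μ (idx k ⁻¹' {idx k x}) ≠ ⊤
  νt : ∀ k x, ν (idx k ⁻¹' {idx k x}) ≠ ⊤
  A : ∀ k x, idx 0 x = idx 0 o → ∀ F, MeasurableSet F → F ⊆ idx k ⁻¹' {idx k x} →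
    μ F ≤ ε * μ (idx k ⁻¹' {idx k x}) → 2 * ν F ≤ ν (idx k ⁻¹' {idx k x})
  D : ∀ k x, idx 0 x = idx 0 o → c * ν (idx k ⁻¹' {idx k x}) ≤ ν (idx (k+1) ⁻¹' {idx (k+1) x})
  df : ∀ k x t, (∀ m, k ≤ m → t * μ (idx m ⁻¹' {idx m x}) ≤ ν (idx m ⁻¹' {idx m x})) → t ≤ w x
  εθ : ε + θ = 1

namespace Dy
open scoped ENNReal
variable {X ι : Type*} [MeasurableSpace X] [MeasurableSpace ι] [Countable ι] [DiscreteMeasurableSpace ι]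
  {μ ν : Measure X} {w : X → ENNReal}
    {idx : ℕ → X → ι} {o : X} {ε θ c : ENNReal} (h : Dy μ ν w idx o ε θ c)
include h

omit [Countable ι] [DiscreteMeasurableSpace ι] in
lemma nest' {l m : ℕ} (hlm : l ≤ m) {x y : X} (hxy : idx m x = idx m y) : idx l x = idx l y := by
  induction m, hlm using Nat.le_induction with
  | base => exact hxy
  | succ m _ ih => exact ih (h.nest m x y hxy)

lemma mcube (k : ℕ) (i : ι) : MeasurableSet (idx k ⁻¹' {i}) := h.meas k (MeasurableSet.of_discrete)

lemma shrink {k : ℕ} {x : X} (hx : idx 0 x = idx 0 o) {S : Set X} (hS : MeasurableSet S)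
    (hSQ : S ⊆ idx k ⁻¹' {idx k x}) (hν : ν (idx k ⁻¹' {idx k x}) ≠ 0) (hs : 4 * ν S ≤ ν (idx k ⁻¹' {idx k x})) :
    μ S ≤ θ * μ (idx k ⁻¹' {idx k x}) := by
  have hA := h.A k x hx (idx k ⁻¹' {idx k x} \ S) ((h.mcube k _).diff hS) sdiff_subset
  have hμt := h.μt k x
  have hνt := h.νt k x
  have hεθ := h.εθ
  obtain ⟨Q, hQ⟩ : ∃ Q, Q = idx k ⁻¹' {idx k x} := ⟨_, rfl⟩
  rw [← hQ] at hSQ hν hs hA hμt hνt ⊢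
  have hμ : μ S + μ (Q \ S) = μ Q := by
    rw [← measure_inter_add_sdiff Q hS, inter_eq_self_of_subset_right hSQ]
  have hνe : ν S + ν (Q \ S) = ν Q := by
    rw [← measure_inter_add_sdiff Q hS, inter_eq_self_of_subset_right hSQ]
  by_contra hcon
  push Not at hcon
  have h1 : μ (Q \ S) ≤ ε * μ Q := by
    by_contra h2
    push Not at h2
    have : ε * μ Q + θ * μ Q < μ (Q \ S) + μ S := ENNReal.add_lt_add h2 hcon
    rw [← add_mul, hεθ, one_mul, add_comm, hμ] at this
    exact lt_irrefl _ this
  have h2 := hA h1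
  have h3 : ν S ≠ ⊤ := ne_top_of_le_ne_top hνt (measure_mono hSQ)
  have h4 : ν (Q \ S) ≠ ⊤ := ne_top_of_le_ne_top hνt (measure_mono sdiff_subset)
  lift ν S to NNReal using h3 with s
  lift ν (Q \ S) to NNReal using h4 with t
  lift ν Q to NNReal using hνt with r
  norm_cast at *
  have h5 := NNReal.coe_le_coe.mpr hs
  have h6 := NNReal.coe_le_coe.mpr h2
  have h7 : (s:ℝ) + t = r := by exact_mod_cast hνe
  have h8 : (0:ℝ) < r := by exact_mod_cast (pos_iff_ne_zero.mpr hν)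
  push_cast at h5 h6
  linarith

lemma decay (hc1 : c ≤ 1) (j : ℕ) : ∀ (k : ℕ) (x : X) (a : ℝ≥0∞), idx 0 x = idx 0 o → a ≠ ⊤ →
    a * μ (idx k ⁻¹' {idx k x}) ≤ ν (idx k ⁻¹' {idx k x}) →
    μ (idx k ⁻¹' {idx k x} ∩ {y | w y < (c * 4⁻¹)^j * a}) ≤ θ^j * μ (idx k ⁻¹' {idx k x}) := by
  induction j with
  | zero => intro k x a _ _ _; simpa using measure_mono inter_subset_left
  | succ j ih =>
    intro k x a hx hat ha
    by_cases ha0 : a = 0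
    · simp [ha0]
    have hκ : (c * 4⁻¹ : ℝ≥0∞) ≤ 4⁻¹ := by
      calc (c * 4⁻¹ : ℝ≥0∞) ≤ 1 * 4⁻¹ := by gcongr
        _ = _ := one_mul _
    have h41 : (4⁻¹ : ℝ≥0∞) ≤ 1 := by rw [ENNReal.inv_le_one]; norm_num
    have hκ1 := hκ.trans h41
    have hct : c ≠ ⊤ := ne_top_of_le_ne_top (by simp) hc1
    -- bad sets
    obtain ⟨B, hB⟩ : ∃ B : ℕ → Set X, B = fun l => {y | k ≤ l ∧ ν (idx l ⁻¹' {idx l y}) < 4⁻¹ * a * μ (idx l ⁻¹' {idx l y})} := ⟨_, rfl⟩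
    have hBm : ∀ l, MeasurableSet (B l) := by
      intro l
      have : B l = idx l ⁻¹' {i | k ≤ l ∧ ν (idx l ⁻¹' {i}) < 4⁻¹ * a * μ (idx l ⁻¹' {i})} := by rw [hB]; rfl
      rw [this]
      exact h.meas l (MeasurableSet.of_discrete)
    have hBc : ∀ l m y z, l ≤ m → idx m y = idx m z → y ∈ B l → z ∈ B l := by
      intro l m y z hlm hyz hy
      have := h.nest' hlm hyz
      rw [hB] at hy ⊢
      simp only [mem_ofPred_eq] at hy ⊢
      rwa [← this]
    obtain ⟨V, hV⟩ : ∃ V : ℕ × ι → Set X, V = fun p => (idx k ⁻¹' {idx k x}) ∩ (B p.1 \ ⋃ l < p.1, B l) ∩ idx p.1 ⁻¹' {p.2} := ⟨_, rfl⟩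
    have hVm : ∀ p, MeasurableSet (V p) := by
      intro p
      rw [hV]
      exact ((h.mcube _ _).inter ((hBm _).diff (MeasurableSet.iUnion fun l => MeasurableSet.iUnion fun _ => hBm l))).inter (h.mcube _ _)
    have hVmem : ∀ p y, y ∈ V p ↔ idx k y = idx k x ∧ y ∈ B p.1 ∧ (∀ l < p.1, y ∉ B l) ∧ idx p.1 y = p.2 := by
      intro p y
      rw [hV]
      simp [and_assoc]
    have hVd : Pairwise (Function.onFun Disjoint V) := by
      rintro ⟨m, i⟩ ⟨m', i'⟩ hne
      rw [Function.onFun, Set.disjoint_left]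
      intro y hy hy'
      rw [hVmem] at hy hy'
      simp only at hy hy'
      obtain ⟨-, h1, h2, h3⟩ := hy
      obtain ⟨-, h1', h2', h3'⟩ := hy'
      rcases lt_trichotomy m m' with hm | hm | hm
      · exact h2' m hm h1
      · subst hm; exact hne (by rw [← h3, ← h3'])
      · exact h2 m' hm h1'
    -- nonempty V p is a cube
    have hVQ : ∀ p y, y ∈ V p → V p = idx p.1 ⁻¹' {idx p.1 y} := by
      intro p y hy
      rw [hVmem] at hy
      obtain ⟨h1, h2, h3, h4⟩ := hy
      have hk : k ≤ p.1 := by rw [hB] at h2; exact h2.1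
      ext z
      rw [hVmem, mem_preimage, mem_singleton_iff]
      constructor
      · rintro ⟨-, -, -, h5⟩; rw [h5, h4]
      · intro hz
        exact ⟨(h.nest' hk hz).trans h1, hBc _ _ _ _ le_rfl hz.symm h2,
          fun l hl hzl => h3 l hl (hBc _ _ _ _ hl.le hz hzl), hz.trans h4⟩
    have hS : (⋃ p, V p) ⊆ idx k ⁻¹' {idx k x} := by
      intro y hy
      obtain ⟨p, hp⟩ := mem_iUnion.mp hy
      exact ((hVmem _ _).mp hp).1
    have hνS : ν (⋃ p, V p) ≤ (4⁻¹ * a) * μ (⋃ p, V p) := by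
      apply comp_union V hVm hVd
      intro p
      rcases (V p).eq_empty_or_nonempty with he | ⟨y, hy⟩
      · simp [he]
      · rw [hVQ p y hy]
        have := ((hVmem _ _).mp hy).2.1
        rw [hB] at this
        exact this.2.le
    have hG : μ.restrict {y | w y < (c * 4⁻¹)^(j+1) * a} (⋃ p, V p) ≤ θ^j * μ (⋃ p, V p) := by
      apply comp_union V hVm hVd
      intro p
      rcases (V p).eq_empty_or_nonempty with he | ⟨y, hy⟩
      · simp [he]
      · have hVe := hVQ p y hy
        rw [Measure.restrict_apply (hVm p), hVe]
        obtain ⟨h1, h2, h3, h4⟩ := (hVmem _ _).mp hy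
        have hkp : k ≤ p.1 := by rw [hB] at h2; exact h2.1
        have hyo : idx 0 y = idx 0 o := (h.nest' (Nat.zero_le k) h1).trans hx
        have hkne : k ≠ p.1 := by
          intro e
          rw [← e, hB] at h2
          have h5 := h2.2
          rw [h1] at h5
          refine absurd (h5.trans_le ?_) (not_lt.mpr ha)
          calc 4⁻¹ * a * μ (idx k ⁻¹' {idx k x}) ≤ 1 * a * μ (idx k ⁻¹' {idx k x}) := by gcongr
            _ = _ := by rw [one_mul]
        obtain ⟨m, hm⟩ : ∃ m, p.1 = m + 1 := ⟨p.1 - 1, by omega⟩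
        have hkm : k ≤ m := by omega
        have h5 := h3 m (by omega)
        rw [hB] at h5
        simp only [mem_ofPred_eq, not_and, not_lt] at h5
        have h6 := h5 hkm
        have h7 := h.D m y hyo
        have h8 : (c * 4⁻¹) * a * μ (idx p.1 ⁻¹' {idx p.1 y}) ≤ ν (idx p.1 ⁻¹' {idx p.1 y}) := by
          rw [hm]
          calc (c * 4⁻¹) * a * μ (idx (m+1) ⁻¹' {idx (m+1) y}) ≤ (c * 4⁻¹) * a * μ (idx m ⁻¹' {idx m y}) := by
                gcongr
                intro z hz
                exact h.nest m z y hz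
            _ = c * (4⁻¹ * a * μ (idx m ⁻¹' {idx m y})) := by ring
            _ ≤ c * ν (idx m ⁻¹' {idx m y}) := by gcongr
            _ ≤ _ := h7
        have h9 := ih p.1 y (c * 4⁻¹ * a) hyo (ENNReal.mul_ne_top (ne_top_of_le_ne_top (by simp) hκ1) hat) h8
        have e : (c * 4⁻¹)^j * (c * 4⁻¹ * a) = (c * 4⁻¹)^(j+1) * a := by ring
        rwa [e] at h9
    have hsub : idx k ⁻¹' {idx k x} ∩ {y | w y < (c * 4⁻¹)^(j+1) * a} ⊆ ⋃ p, V p := by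
      rintro y ⟨hy1, hy2⟩
      have h1 : ∃ m, y ∈ B m := by
        by_contra hno
        push Not at hno
        have := h.df k y (4⁻¹ * a) (by
          intro m hm
          have := hno m
          rw [hB] at this
          simp only [mem_ofPred_eq, not_and, not_lt] at this
          exact this hm)
        refine absurd (hy2.trans_le ?_) (not_lt.mpr this)
        gcongr
        rw [pow_succ]
        calc (c * 4⁻¹)^j * (c * 4⁻¹) ≤ 1^j * 4⁻¹ := by gcongr
          _ = _ := by simp
      classical
      rw [mem_iUnion]
      refine ⟨(Nat.find h1, idx (Nat.find h1) y), ?_⟩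
      rw [hVmem]
      exact ⟨hy1, Nat.find_spec h1, fun l hl => Nat.find_min h1 hl, rfl⟩
    have hUm : MeasurableSet (⋃ p, V p) := MeasurableSet.iUnion hVm
    have hshr := h.shrink hx hUm hS (by
        intro h0
        rw [h0] at ha
        have := h.μ0 k x
        simp_all) (by
        calc 4 * ν (⋃ p, V p) ≤ 4 * (4⁻¹ * a * μ (⋃ p, V p)) := by gcongr
          _ = (4 * 4⁻¹) * (a * μ (⋃ p, V p)) := by ring
          _ = a * μ (⋃ p, V p) := by rw [ENNReal.mul_inv_cancel (by norm_num) (by norm_num), one_mul]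
          _ ≤ a * μ (idx k ⁻¹' {idx k x}) := by gcongr
          _ ≤ _ := ha)
    calc μ (idx k ⁻¹' {idx k x} ∩ {y | w y < (c * 4⁻¹)^(j+1) * a})
        ≤ μ ((⋃ p, V p) ∩ {y | w y < (c * 4⁻¹)^(j+1) * a}) := measure_mono fun y hy => ⟨hsub hy, hy.2⟩
      _ = μ.restrict {y | w y < (c * 4⁻¹)^(j+1) * a} (⋃ p, V p) := (Measure.restrict_apply hUm).symm
      _ ≤ θ^j * μ (⋃ p, V p) := hG
      _ ≤ θ^j * (θ * μ (idx k ⁻¹' {idx k x})) := by gcongr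
      _ = _ := by ring
end Dy

section
open scoped ENNReal

lemma exists_s {κ θ : ℝ≥0∞} (hκ0 : κ ≠ 0) (hκ1 : κ < 1) (hθ : θ < 1) :
    ∃ s : ℝ, 0 < s ∧ κ ^ (-s) * θ < 1 := by
  have hκt : κ ≠ ⊤ := ne_top_of_lt hκ1
  have hθt : θ ≠ ⊤ := ne_top_of_lt hθ
  lift κ to NNReal using hκt with k
  lift θ to NNReal using hθt with t
  have hk : (0:ℝ) < k := by exact_mod_cast (pos_iff_ne_zero.mpr (by simpa using hκ0))
  have ht : (t:ℝ) < 1 := by exact_mod_cast hθ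
  have hcont : Filter.Tendsto (fun s : ℝ => (k:ℝ)^(-s) * t) (nhdsWithin 0 (Ioi 0)) (nhds ((k:ℝ)^(-(0:ℝ)) * t)) := by
    apply Filter.Tendsto.mono_left _ nhdsWithin_le_nhds
    apply Continuous.tendsto
    exact ((Real.continuous_const_rpow hk.ne').comp continuous_neg).mul continuous_const
  have h1 := hcont.eventually_lt_const (u := 1) (by simpa using ht)
  obtain ⟨s, hs1, hs2⟩ := (h1.and self_mem_nhdsWithin).exists
  refine ⟨s, hs2, ?_⟩
  have hk0 : k ≠ 0 := by simpa using hκ0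
  rw [← ENNReal.coe_rpow_of_ne_zero hk0]
  exact_mod_cast hs1

lemma rpow_neg_anti {x y : ℝ≥0∞} {s : ℝ} (hs : 0 ≤ s) (h : x ≤ y) : y ^ (-s) ≤ x ^ (-s) := by
  rw [ENNReal.rpow_neg, ENNReal.rpow_neg]
  exact ENNReal.inv_le_inv.mpr (ENNReal.rpow_le_rpow h hs)

lemma lint {X : Type*} [MeasurableSpace X] {μ : Measure X} {Q : Set X} (hQ : MeasurableSet Q) (hQt : μ Q ≠ ⊤)
    {w : X → ℝ≥0∞} (hw : Measurable w)
    {κ θ a : ℝ≥0∞} (hκ0 : κ ≠ 0) (hκ1 : κ < 1) (hθ : θ < 1) (ha0 : a ≠ 0) (hat : a ≠ ⊤)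
    (H : ∀ j, μ (Q ∩ {y | w y < κ^j * a}) ≤ θ^j * μ Q) : ∃ s : ℝ, 0 < s ∧ ∫⁻ x in Q, w x ^ (-s) ∂μ < ⊤ := by
  obtain ⟨s, hs, hρθ⟩ := exists_s hκ0 hκ1 hθ
  refine ⟨s, hs, ?_⟩
  have hκt : κ ≠ ⊤ := ne_top_of_lt hκ1
  obtain ⟨ρ, hρ⟩ : ∃ ρ, ρ = κ ^ (-s) := ⟨_, rfl⟩
  rw [← hρ] at hρθ
  have hρ1 : 1 ≤ ρ := by
    have := rpow_neg_anti hs.le hκ1.le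
    rwa [ENNReal.one_rpow, ← hρ] at this
  have hρt : ρ ≠ ⊤ := by rw [hρ]; exact ENNReal.rpow_ne_top_of_ne_zero hκ0 hκt
  have hast : a ^ (-s) ≠ ⊤ := ENNReal.rpow_ne_top_of_ne_zero ha0 hat
  have has0 : a ^ (-s) ≠ 0 := by simp [ENNReal.rpow_eq_zero_iff, ha0, hat]
  have hm : ∀ j : ℕ, MeasurableSet {y | w y < κ^j * a} := fun j => measurableSet_lt hw measurable_const
  have hpt : ∀ x, w x ^ (-s) ≤ a ^ (-s) * (1 + ∑' j : ℕ, {y | w y < κ^j * a}.indicator (fun _ => ρ^(j+1)) x) := by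
    intro x
    by_cases h1 : ∃ j : ℕ, κ^j * a ≤ w x
    · classical
      obtain ⟨j, hj, hmin⟩ : ∃ j : ℕ, κ^j * a ≤ w x ∧ ∀ l < j, ¬ κ^l * a ≤ w x :=
        ⟨Nat.find h1, Nat.find_spec h1, fun l hl => Nat.find_min h1 hl⟩
      cases j with
      | zero =>
        calc w x ^ (-s) ≤ a ^ (-s) := rpow_neg_anti hs.le (by simpa using hj)
          _ = a ^ (-s) * 1 := (mul_one _).symm
          _ ≤ _ := by gcongr; exact le_self_add
      | succ m =>
        have h2 : w x < κ^m * a := not_le.mp (hmin m (by omega))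
        calc w x ^ (-s) ≤ (κ^(m+1) * a) ^ (-s) := rpow_neg_anti hs.le hj
          _ = a ^ (-s) * ρ^(m+1) := by
            rw [ENNReal.mul_rpow_of_ne_top (by finiteness) hat, mul_comm, hρ]
            congr 1
            rw [← ENNReal.rpow_natCast, ← ENNReal.rpow_natCast, ← ENNReal.rpow_mul, ← ENNReal.rpow_mul, mul_comm]
          _ = a ^ (-s) * {y | w y < κ^m * a}.indicator (fun _ => ρ^(m+1)) x := by
            rw [indicator_of_mem]; exact h2
          _ ≤ _ := by
            gcongr
            refine le_trans ?_ le_add_self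
            exact ENNReal.le_tsum (f := fun j : ℕ => {y | w y < κ^j * a}.indicator (fun _ => ρ^(j+1)) x) m
    · push Not at h1
      have : ∑' j : ℕ, {y | w y < κ^j * a}.indicator (fun _ => ρ^(j+1)) x = ⊤ := by
        rw [eq_top_iff]
        calc ⊤ = ∑' j : ℕ, (1:ℝ≥0∞) := by rw [ENNReal.tsum_const_eq_top_of_ne_zero one_ne_zero]
          _ ≤ _ := by
            apply ENNReal.tsum_le_tsum
            intro j
            rw [indicator_of_mem (show x ∈ {y | w y < κ^j * a} from h1 j)]
            exact one_le_pow₀ hρ1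
      rw [this]
      simp [ENNReal.mul_top has0]
  calc ∫⁻ x in Q, w x ^ (-s) ∂μ ≤ ∫⁻ x in Q, a ^ (-s) * (1 + ∑' j : ℕ, {y | w y < κ^j * a}.indicator (fun _ => ρ^(j+1)) x) ∂μ :=
        lintegral_mono hpt
    _ = a ^ (-s) * (μ Q + ∑' j : ℕ, ρ^(j+1) * μ (Q ∩ {y | w y < κ^j * a})) := by
        rw [lintegral_const_mul' _ _ hast, lintegral_add_left measurable_const, lintegral_tsum]
        · congr 2
          · simp
          · congr 1; ext j
            rw [lintegral_indicator (hm j), setLIntegral_const, Measure.restrict_apply (hm j), inter_comm]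
        · intro j
          exact (measurable_const.indicator (hm j)).aemeasurable
    _ ≤ a ^ (-s) * (μ Q + ∑' j : ℕ, (ρ * θ)^j * (ρ * μ Q)) := by
        refine mul_le_mul' le_rfl (add_le_add le_rfl (ENNReal.tsum_le_tsum fun j => ?_))
        calc ρ^(j+1) * μ (Q ∩ {y | w y < κ^j * a}) ≤ ρ^(j+1) * (θ^j * μ Q) := by gcongr; exact H j
          _ = (ρ * θ)^j * (ρ * μ Q) := by ring
    _ = a ^ (-s) * (μ Q + (1 - ρ * θ)⁻¹ * (ρ * μ Q)) := by
        rw [ENNReal.tsum_mul_right, ENNReal.tsum_geometric]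
    _ < ⊤ := by
        have : (1 - ρ * θ)⁻¹ ≠ ⊤ := by
          rw [ENNReal.inv_ne_top]
          exact (tsub_pos_of_lt hρθ).ne'
        exact (ENNReal.mul_ne_top hast (ENNReal.add_ne_top.mpr ⟨hQt, ENNReal.mul_ne_top this (ENNReal.mul_ne_top hρt hQt)⟩)).lt_top
end

section
variable {n : ℕ}

lemma norm_lt_of_coord (hn : 0 < n) {v : EE n} {b : ℝ} (h : ∀ i, |v i| < b) : ‖v‖ < n * b := by
  calc ‖v‖ = ‖∑ i, v i • (EuclideanSpace.single i (1:ℝ) : EE n)‖ := by rw [sum_single]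
    _ ≤ ∑ i, ‖v i • (EuclideanSpace.single i (1:ℝ) : EE n)‖ := norm_sum_le _ _
    _ = ∑ i, |v i| := by simp [norm_smul]
    _ < ∑ i : Fin n, b := by
      apply Finset.sum_lt_sum_of_nonempty
      · exact ⟨⟨0, hn⟩, Finset.mem_univ _⟩
      · intro i _; exact h i
    _ = n * b := by simp

def ix (o : EE n) (s : ℝ) (k : ℕ) (x : EE n) : Fin n → ℤ := fun i => ⌊2^k * ((x i - o i) / s)⌋

def cen (o : EE n) (s : ℝ) (k : ℕ) (z : Fin n → ℤ) : EE n := WithLp.toLp 2 fun i => o i + (z i + 1/2) * (s / 2^k)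

lemma ix_meas (o : EE n) (s : ℝ) (k : ℕ) : Measurable (ix o s k) := by
  rw [measurable_pi_iff]
  intro i
  apply Measurable.floor
  have : Measurable fun x : EE n => x i := (EuclideanSpace.proj i : EE n →L[ℝ] ℝ).continuous.measurable
  fun_prop

lemma floor_half {v w : ℝ} (h : ⌊2 * v⌋ = ⌊2 * w⌋) : ⌊v⌋ = ⌊w⌋ := by
  have key : ∀ v : ℝ, ⌊v⌋ = ⌊2 * v⌋ / 2 := by
    intro v
    have h1 := Int.floor_le (2 * v)
    have h2 := Int.lt_floor_add_one (2 * v)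
    rw [Int.floor_eq_iff]
    have h3 : 2 * (⌊2*v⌋ / 2) ≤ ⌊2*v⌋ := by omega
    have h4 : ⌊2*v⌋ + 1 ≤ 2 * (⌊2*v⌋ / 2) + 2 := by omega
    have h3' : (2:ℝ) * ((⌊2*v⌋ / 2 : ℤ) : ℝ) ≤ ⌊2*v⌋ := by exact_mod_cast h3
    have h4' : (⌊2*v⌋ : ℝ) + 1 ≤ 2 * ((⌊2*v⌋ / 2 : ℤ) : ℝ) + 2 := by exact_mod_cast h4
    constructor <;> linarith
  rw [key v, key w, h]

lemma ix_nest (o : EE n) (s : ℝ) (k : ℕ) (x y : EE n) (h : ix o s (k+1) x = ix o s (k+1) y) :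
    ix o s k x = ix o s k y := by
  ext i
  have := congrFun h i
  unfold ix at this ⊢
  apply floor_half
  rw [pow_succ'] at this
  simpa only [mul_assoc] using this

lemma ix_diff {o : EE n} {s : ℝ} (hs : 0 < s) {k : ℕ} {x y : EE n} (h : ix o s k x = ix o s k y) (i : Fin n) :
    |x i - y i| < s / 2^k := by
  have h1 := congrFun h i
  unfold ix at h1
  have h2 := Int.abs_sub_lt_one_of_floor_eq_floor h1
  have e : 2^k * ((x i - o i) / s) - 2^k * ((y i - o i) / s) = (2^k / s) * (x i - y i) := by field_simp; ring
  rw [e, abs_mul, abs_of_pos (by positivity)] at h2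
  rw [lt_div_iff₀ (by positivity)]
  calc |x i - y i| * 2^k = (2^k / s * |x i - y i|) * s := by field_simp
    _ < 1 * s := by gcongr
    _ = s := one_mul s

lemma ball_cen {o : EE n} {s : ℝ} (hs : 0 < s) (k : ℕ) (z : Fin n → ℤ) :
    ball (cen o s k z) (s / 2^k / 2) ⊆ ix o s k ⁻¹' {z} := by
  intro x hx
  rw [mem_ball, dist_eq_norm] at hx
  rw [mem_preimage, mem_singleton_iff]
  ext i
  have h1 : |(x - cen o s k z) i| < s / 2^k / 2 := lt_of_le_of_lt (PiLp.norm_apply_le (x - cen o s k z) i) hx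
  have h2 : (x - cen o s k z) i = x i - (o i + (z i + 1/2) * (s / 2^k)) := rfl
  rw [h2, abs_lt] at h1
  unfold ix
  rw [Int.floor_eq_iff]
  obtain ⟨h3, h4⟩ := h1
  have e : 2^k * ((x i - o i) / s) = (x i - o i) / (s / 2^k) := by field_simp
  rw [e]
  have hp : 0 < s / 2^k := by positivity
  rw [le_div_iff₀ hp, div_lt_iff₀ hp]
  constructor <;> nlinarith

lemma ix_cen {o : EE n} {s : ℝ} (hs : 0 < s) (k : ℕ) (z : Fin n → ℤ) : ix o s k (cen o s k z) = z :=
  ball_cen hs k z (mem_ball_self (by positivity))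

lemma cube_sub {o : EE n} (hn : 0 < n) {s : ℝ} (hs : 0 < s) {k : ℕ} {y : EE n} {z : Fin n → ℤ} (hy : ix o s k y = z) :
    ix o s k ⁻¹' {z} ⊆ ball y (n * (s / 2^k)) := by
  intro x hx
  rw [mem_ball, dist_eq_norm]
  apply norm_lt_of_coord hn
  intro i
  exact ix_diff hs (k := k) (o := o) (by rw [hy]; exact hx) i
end

section
open scoped ENNReal
variable {n : ℕ} {u : EE n → ℝ} {x0 : EE n}

def nuu (u : EE n → ℝ) : Measure (EE n) := volume.withDensity fun x => ENNReal.ofReal (u x ^ 2)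

lemma nuu_apply (hu : Continuous u) (hus : HasCompactSupport u) {F : Set (EE n)} (hF : MeasurableSet F) :
    nuu u F = ENNReal.ofReal (∫ x in F, u x ^ 2) := by
  have hu2int : Integrable (fun x => u x ^ 2) := (hu.pow 2).integrable_of_hasCompactSupport (by
    have := hus.comp_left (g := fun t : ℝ => t^2) (by norm_num)
    exact this)
  rw [nuu, withDensity_apply _ hF, ofReal_integral_eq_lintegral_ofReal hu2int.integrableOn]
  exact Filter.Eventually.of_forall fun x => sq_nonneg _

lemma star_sc (hn : 0 < n) {η C : ℝ} (hC : 0 < C)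
    (H : ∀ y ∈ ball x0 η, ∀ r, 0 < r → r ≤ η → ∀ F, MeasurableSet F → F ⊆ ball y r →
      ∫ x in F, u x ^ 2 ≤ C * (volume.real F) ^ ((1:ℝ)/n) * r⁻¹ * ∫ x in ball y (r / (4*n)), u x ^ 2)
    {y : EE n} (hy : y ∈ ball x0 η) {r : ℝ} (hr : 0 < r) (hrη : r ≤ η) {F : Set (EE n)} (hF : MeasurableSet F)
    (hFb : F ⊆ ball y r) {t : ℝ} (ht : 0 ≤ t) (hFt : volume.real F ≤ t * r^n) :
    ∫ x in F, u x ^ 2 ≤ C * t ^ ((1:ℝ)/n) * ∫ x in ball y (r / (4*n)), u x ^ 2 := by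
  refine (H y hy r hr hrη F hF hFb).trans ?_
  have h0 : 0 ≤ ∫ x in ball y (r / (4*n)), u x ^ 2 := integral_nonneg fun x => sq_nonneg _
  refine mul_le_mul_of_nonneg_right ?_ h0
  have hn' : (n:ℝ) ≠ 0 := by positivity
  have h1 : (volume.real F) ^ ((1:ℝ)/n) ≤ t ^ ((1:ℝ)/n) * r := by
    calc (volume.real F) ^ ((1:ℝ)/n) ≤ (t * r^n) ^ ((1:ℝ)/n) := by gcongr
      _ = t ^ ((1:ℝ)/n) * r := by
        rw [Real.mul_rpow ht (by positivity), ← Real.rpow_natCast, ← Real.rpow_mul hr.le, mul_one_div_cancel hn', Real.rpow_one]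
  calc C * (volume.real F) ^ ((1:ℝ)/n) * r⁻¹ ≤ C * (t ^ ((1:ℝ)/n) * r) * r⁻¹ := by gcongr
    _ = _ := by field_simp

lemma df_cont (hn : 0 < n) {s : ℝ} (hs : 0 < s) (hu : Continuous u) (o : EE n) (k : ℕ) (x : EE n) (t : ℝ≥0∞)
    (hμ0 : ∀ k x, volume (ix o s k ⁻¹' {ix o s k x}) ≠ 0) (hμt : ∀ k x, volume (ix o s k ⁻¹' {ix o s k x}) ≠ ⊤)
    (H : ∀ m, k ≤ m → t * volume (ix o s m ⁻¹' {ix o s m x}) ≤ nuu u (ix o s m ⁻¹' {ix o s m x})) :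
    t ≤ ENNReal.ofReal (u x ^ 2) := by
  by_contra hlt
  push Not at hlt
  obtain ⟨t', h1, h2⟩ := exists_between hlt
  have hcont : Continuous fun x => ENNReal.ofReal (u x ^ 2) := ENNReal.continuous_ofReal.comp (hu.pow 2)
  have hev : ∀ᶠ y in nhds x, ENNReal.ofReal (u y ^ 2) < t' := hcont.continuousAt.eventually_lt_const h1
  obtain ⟨e, he, heb⟩ := Metric.eventually_nhds_iff_ball.mp hev
  have ht : Filter.Tendsto (fun m : ℕ => n * (s / 2^m)) Filter.atTop (nhds 0) := by
    have := (tendsto_pow_atTop_nhds_zero_of_lt_one (r := (1/2:ℝ)) (by norm_num) (by norm_num)).const_mul (n * s)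
    rw [mul_zero] at this
    refine this.congr fun m => ?_
    rw [one_div, inv_pow]; field_simp
  obtain ⟨m, hm1, hm2⟩ := ((ht.eventually_lt_const he).and (Filter.eventually_ge_atTop k)).exists
  have hsub : ix o s m ⁻¹' {ix o s m x} ⊆ ball x e := (cube_sub hn hs rfl).trans (ball_subset_ball hm1.le)
  have hm : MeasurableSet (ix o s m ⁻¹' {ix o s m x}) := ix_meas o s m (MeasurableSet.of_discrete)
  have h3 : nuu u (ix o s m ⁻¹' {ix o s m x}) ≤ t' * volume (ix o s m ⁻¹' {ix o s m x}) := by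
    rw [nuu, withDensity_apply _ hm, ← setLIntegral_const]
    exact setLIntegral_mono' hm fun y hy => (heb y (hsub hy)).le
  have h4 := (H m hm2).trans h3
  have h5 : t' * volume (ix o s m ⁻¹' {ix o s m x}) < t * volume (ix o s m ⁻¹' {ix o s m x}) :=
    (ENNReal.mul_lt_mul_iff_left (hμ0 m x) (hμt m x)).mpr h2
  exact absurd h5 (not_lt.mpr h4)

lemma star_dy (hn : 0 < n) (hu : Continuous u) (hus : HasCompactSupport u)
    (hne : ¬ ∀ᶠ z in nhds x0, u z = 0) {η C : ℝ} (hη : 0 < η) (hC : 0 < C)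
    (H : ∀ y ∈ ball x0 η, ∀ r, 0 < r → r ≤ η → ∀ F, MeasurableSet F → F ⊆ ball y r →
      ∫ x in F, u x ^ 2 ≤ C * (volume.real F) ^ ((1:ℝ)/n) * r⁻¹ * ∫ x in ball y (r / (4*n)), u x ^ 2) :
    ∃ r : ℝ, 0 < r ∧ ∃ U ∈ nhds x0, ∫⁻ x in U, ENNReal.ofReal |u x| ^ (-(2 * r)) < ⊤ := by
  have hn' : (0:ℝ) < n := by positivity
  obtain ⟨s, hs⟩ : ∃ s, s = η / (2*n) := ⟨_, rfl⟩
  have hs0 : 0 < s := by rw [hs]; positivity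
  have hsη : 2 * n * s = η := by rw [hs]; field_simp
  obtain ⟨o, ho⟩ : ∃ o : EE n, o = WithLp.toLp 2 fun i => x0 i - s/2 := ⟨_, rfl⟩
  have hcen : cen o s 0 0 = x0 := by
    ext i; simp [cen, ho]; ring
  have hx0 : ix o s 0 x0 = 0 := by
    have := ix_cen (o := o) hs0 0 0
    rwa [hcen] at this
  obtain ⟨B, hB⟩ : ∃ B, B = volume.real (ball (0:EE n) 1) := ⟨_, rfl⟩
  have hB0 : 0 < B := by
    rw [hB]; exact ENNReal.toReal_pos (measure_ball_pos _ _ one_pos).ne' measure_ball_lt_top.ne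
  have hvb : ∀ (y : EE n) r, 0 < r → volume.real (ball y r) = B * r^n := by
    intro y r hr
    rw [hB, measureReal_def, Measure.addHaar_ball_of_pos _ _ hr, ENNReal.toReal_mul, ENNReal.toReal_ofReal (by positivity), measureReal_def]
    simp [mul_comm]
  have hQm : ∀ k z, MeasurableSet (ix o s k ⁻¹' {z}) := fun k z => ix_meas o s k (MeasurableSet.of_discrete)
  have hμ0 : ∀ k x, volume (ix o s k ⁻¹' {ix o s k x}) ≠ 0 := by
    intro k x
    exact ((measure_ball_pos _ _ (by positivity)).trans_le (measure_mono (ball_cen hs0 k _))).ne'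
  have hμt : ∀ k x, volume (ix o s k ⁻¹' {ix o s k x}) ≠ ⊤ := by
    intro k x
    exact ((measure_mono (cube_sub hn hs0 rfl)).trans_lt measure_ball_lt_top).ne
  -- key
  have key : ∀ k x, ix o s 0 x = ix o s 0 x0 → ∀ F, MeasurableSet F → F ⊆ ball (cen o s k (ix o s k x)) (2*n*(s/2^k)) →
      ∀ t, 0 ≤ t → volume.real F ≤ t * (2*n*(s/2^k))^n →
      ∫ x in F, u x ^ 2 ≤ C * t ^ ((1:ℝ)/n) * ∫ x in ix o s k ⁻¹' {ix o s k x}, u x ^ 2 := by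
    intro k x hx F hF hFb t ht hFt
    have h2 : (1:ℝ) ≤ 2^k := one_le_pow₀ (by norm_num)
    have hle : s / 2^k ≤ s := div_le_self hs0.le h2
    have hy : cen o s k (ix o s k x) ∈ ball x0 η := by
      have h3 : ix o s 0 (cen o s k (ix o s k x)) = ix o s 0 x := by
        have : ix o s k (cen o s k (ix o s k x)) = ix o s k x := ix_cen hs0 k _
        clear hFb hFt
        have gen : ∀ m, ∀ y z : EE n, ix o s m y = ix o s m z → ix o s 0 y = ix o s 0 z := by
          intro m
          induction m with
          | zero => intro y z h; exact h
          | succ m ih => intro y z h; exact ih y z (ix_nest o s m y z h)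
        exact gen k _ _ this
      have h4 := cube_sub (k := 0) hn hs0 (o := o) (y := x0) rfl (h3.trans hx)
      refine ball_subset_ball ?_ h4
      rw [← hsη]; simp; nlinarith
    have h5 := star_sc hn hC H hy (r := 2*n*(s/2^k)) (by positivity) (by rw [← hsη]; gcongr) hF hFb ht hFt
    have e : 2 * n * (s/2^k) / (4 * n) = s / 2^k / 2 := by field_simp; norm_num
    rw [e] at h5
    refine h5.trans ?_
    refine mul_le_mul_of_nonneg_left ?_ (by positivity)
    apply setIntegral_mono_set
    · have hu2int : Integrable (fun x => u x ^ 2) := (hu.pow 2).integrable_of_hasCompactSupport (by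
        have := hus.comp_left (g := fun t : ℝ => t^2) (by norm_num)
        exact this)
      exact hu2int.integrableOn
    · exact Filter.Eventually.of_forall fun x => sq_nonneg _
    · exact LE.le.eventuallyLE (ball_cen hs0 k _)
  have hQb : ∀ k x, ix o s k ⁻¹' {ix o s k x} ⊆ ball (cen o s k (ix o s k x)) (2*n*(s/2^k)) := by
    intro k x
    refine (cube_sub hn hs0 (ix_cen hs0 k _)).trans (ball_subset_ball ?_)
    have : 0 < s / 2^k := by positivity
    nlinarith
  have hPb : ∀ k x, ix o s k ⁻¹' {ix o s k x} ⊆ ball (cen o s (k+1) (ix o s (k+1) x)) (2*n*(s/2^(k+1))) := by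
    intro k x
    have h1 : ix o s k (cen o s (k+1) (ix o s (k+1) x)) = ix o s k x := ix_nest _ _ _ _ _ (ix_cen hs0 (k+1) _)
    refine (cube_sub hn hs0 h1).trans (ball_subset_ball (le_of_eq ?_))
    rw [pow_succ]; field_simp
  have hvol : ∀ (F : Set (EE n)) (y : EE n) r, 0 < r → F ⊆ ball y r → volume.real F ≤ B * r^n := by
    intro F y r hr hF
    rw [← hvb y r hr]
    exact measureReal_mono hF measure_ball_lt_top.ne
  -- constants
  obtain ⟨ε, hε⟩ : ∃ ε, ε = min (1/2) ((1/(2*C))^n / B) := ⟨_, rfl⟩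
  have hε0 : 0 < ε := by rw [hε]; apply lt_min <;> positivity
  have hε1 : ε ≤ 1/2 := by rw [hε]; exact min_le_left _ _
  have hεC : C * (ε * B) ^ ((1:ℝ)/n) ≤ 1/2 := by
    have h1 : ε * B ≤ (1/(2*C))^n := by
      rw [← le_div_iff₀ hB0, hε]; exact min_le_right _ _
    calc C * (ε * B) ^ ((1:ℝ)/n) ≤ C * ((1/(2*C))^n) ^ ((1:ℝ)/n) := by gcongr
      _ = C * (1/(2*C)) := by
        rw [← Real.rpow_natCast, ← Real.rpow_mul (by positivity), mul_one_div_cancel hn'.ne', Real.rpow_one]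
      _ = 1/2 := by field_simp
  obtain ⟨D, hD⟩ : ∃ D, D = C * B ^ ((1:ℝ)/n) := ⟨_, rfl⟩
  have hD0 : 0 < D := by rw [hD]; positivity
  have hdy : Dy volume (nuu u) (fun x => ENNReal.ofReal (u x ^ 2)) (ix o s) x0 (ENNReal.ofReal ε) (ENNReal.ofReal (1-ε))
      (ENNReal.ofReal (1/(1+D))) := by
    refine ⟨ix_meas o s, ix_nest o s, hμ0, hμt, ?_, ?_, ?_, ?_, ?_⟩
    · intro k x
      rw [nuu_apply hu hus (hQm _ _)]; exact ENNReal.ofReal_ne_top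
    · intro k x hx F hF hFQ hle
      have hFt : volume F ≠ ⊤ := ne_top_of_le_ne_top (hμt k x) (measure_mono hFQ)
      have h1 : volume.real F ≤ ε * volume.real (ix o s k ⁻¹' {ix o s k x}) := by
        have := ENNReal.toReal_mono (ENNReal.mul_ne_top ENNReal.ofReal_ne_top (hμt k x)) hle
        rwa [ENNReal.toReal_mul, ENNReal.toReal_ofReal hε0.le] at this
      have h2 := hvol _ _ _ (by positivity) (hQb k x)
      have htwo : ∀ t : ℝ≥0∞, 2 * t = ENNReal.ofReal 2 * t := by intro t; simp
      have h3 := key k x hx F hF (hFQ.trans (hQb k x)) (ε * B) (by positivity) (by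
        calc _ ≤ _ := h1
          _ ≤ ε * (B * (2*n*(s/2^k))^n) := by gcongr
          _ = _ := by ring)
      rw [nuu_apply hu hus (hQm _ _), nuu_apply hu hus hF, htwo, ← ENNReal.ofReal_mul (by norm_num)]
      apply ENNReal.ofReal_le_ofReal
      have h0 : 0 ≤ ∫ x in ix o s k ⁻¹' {ix o s k x}, u x ^ 2 := integral_nonneg fun x => sq_nonneg _
      nlinarith
    · intro k x hx
      have h3 := key (k+1) x hx (ix o s k ⁻¹' {ix o s k x}) (hQm _ _) (hPb k x) B hB0.le (hvol _ _ _ (by positivity) (hPb k x))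
      rw [nuu_apply hu hus (hQm _ _), nuu_apply hu hus (hQm _ _), ← ENNReal.ofReal_mul (by positivity)]
      apply ENNReal.ofReal_le_ofReal
      rw [← hD] at h3
      have h0 : 0 ≤ ∫ x in ix o s (k+1) ⁻¹' {ix o s (k+1) x}, u x ^ 2 := integral_nonneg fun x => sq_nonneg _
      rw [one_div, inv_mul_le_iff₀ (by positivity)]
      nlinarith
    · intro k x t hH
      exact df_cont hn hs0 hu o k x t hμ0 hμt hH
    · rw [← ENNReal.ofReal_add hε0.le (by linarith)]; simp
  obtain ⟨Q, hQ⟩ : ∃ Q, Q = ix o s 0 ⁻¹' {ix o s 0 x0} := ⟨_, rfl⟩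
  have hQnhds : Q ∈ nhds x0 := by
    have h1 := ball_cen (o := o) hs0 0 (ix o s 0 x0)
    rw [hx0, hcen] at h1
    rw [hQ, hx0]
    exact Filter.mem_of_superset (ball_mem_nhds x0 (by positivity)) h1
  have hQt : volume Q ≠ ⊤ := by rw [hQ]; exact hμt 0 x0
  have hQ0 : volume Q ≠ 0 := by rw [hQ]; exact hμ0 0 x0
  have hνt : nuu u Q ≠ ⊤ := by rw [hQ]; exact hdy.νt 0 x0
  have hν0 : nuu u Q ≠ 0 := by
    obtain ⟨e, he, heb⟩ := Metric.mem_nhds_iff.mp hQnhds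
    have h1 : ∃ z ∈ ball x0 e, u z ≠ 0 := by
      by_contra hno
      push Not at hno
      exact hne (Filter.mem_of_superset (ball_mem_nhds x0 he) hno)
    have h2 := setIntegral_pos hu h1
    have h3 : nuu u (ball x0 e) ≠ 0 := by
      rw [nuu_apply hu hus measurableSet_ball]
      simpa using h2
    exact fun h0 => h3 (measure_mono_null heb h0)
  obtain ⟨a, ha⟩ : ∃ a, a = nuu u Q / volume Q := ⟨_, rfl⟩
  have hat : a ≠ ⊤ := by rw [ha]; exact ENNReal.div_ne_top hνt hQ0
  have ha0 : a ≠ 0 := by rw [ha]; exact ENNReal.div_ne_zero.mpr ⟨hν0, hQt⟩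
  have hc1 : ENNReal.ofReal (1/(1+D)) ≤ 1 := by
    rw [← ENNReal.ofReal_one]
    apply ENNReal.ofReal_le_ofReal
    rw [div_le_one (by positivity)]; linarith
  have hdec := fun j => hdy.decay hc1 j 0 x0 a rfl hat (by
    rw [← hQ, ha]; rw [ENNReal.div_mul_cancel hQ0 hQt])
  rw [← hQ] at hdec
  have hκ0 : ENNReal.ofReal (1/(1+D)) * 4⁻¹ ≠ 0 := by
    apply mul_ne_zero
    · simp; positivity
    · simp
  have hκ1 : ENNReal.ofReal (1/(1+D)) * 4⁻¹ < 1 := by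
    calc ENNReal.ofReal (1/(1+D)) * 4⁻¹ ≤ 1 * 4⁻¹ := by gcongr
      _ < 1 := by rw [one_mul, ENNReal.inv_lt_one]; norm_num
  have hθ : ENNReal.ofReal (1-ε) < 1 := by
    rw [← ENNReal.ofReal_one]
    exact (ENNReal.ofReal_lt_ofReal_iff one_pos).mpr (by linarith)
  obtain ⟨r, hr, hfin⟩ := lint (Q := Q) (μ := volume) (by rw [hQ]; exact hQm _ _) hQt
    (w := fun x => ENNReal.ofReal (u x ^ 2)) (by fun_prop) hκ0 hκ1 hθ ha0 hat hdec
  refine ⟨r, hr, Q, hQnhds, ?_⟩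
  convert hfin using 3 with x
  rw [← sq_abs, ENNReal.ofReal_pow (abs_nonneg _), ← ENNReal.rpow_natCast, ← ENNReal.rpow_mul]
  congr 1; push_cast; ring
end

lemma rpow_neg_le_add {t : ENNReal} {r r' : ℝ} (hr' : 0 ≤ r') (h : r' ≤ r) :
    t ^ (-(2 * r')) ≤ 1 + t ^ (-(2 * r)) := by
  rcases le_total 1 t with ht | ht
  · have := rpow_neg_anti (s := 2 * r') (by linarith) ht
    rw [ENNReal.one_rpow] at this
    exact this.trans le_self_add
  · refine le_trans ?_ le_add_self
    exact ENNReal.rpow_le_rpow_of_exponent_ge ht (by linarith)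

theorem stmt_2 {n : ℕ} (hn : n = 2 ∨ n = 3)
    (Ω : Set (EuclideanSpace ℝ (Fin n)))
    (hΩo : IsOpen Ω) (hΩb : Bornology.IsBounded Ω) (hΩc : IsConnected Ω)
    (A : Fin n → Fin n → EuclideanSpace ℝ (Fin n) → ℝ) (hA : EllipticSym Ω A)
    (q u : EuclideanSpace ℝ (Fin n) → ℝ)
    (hqm : Measurable q) (hqb : ∃ Λ : ℝ, ∀ x ∈ Ω, |q x| ≤ Λ)
    (hu2 : ContDiffOn ℝ 2 u Ω) (hsol : IsSolution A q u Ω)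
    (hu0 : ∃ x ∈ Ω, u x ≠ 0) :
    ∀ K : Set (EuclideanSpace ℝ (Fin n)), IsCompact K → K ⊆ Ω →
      ∃ r > 0, (∫⁻ x in K, (ENNReal.ofReal |u x|) ^ (-(2 * r) : ℝ)) < ⊤ := by
  intro K hK hKΩ
  have hn2 : 2 ≤ n := by omega
  have hn0 : 0 < n := by omega
  have hloc : ∀ x0 ∈ Ω, ∃ r : ℝ, 0 < r ∧ ∃ U ∈ nhds x0, ∫⁻ x in U, ENNReal.ofReal |u x| ^ (-(2 * r)) < ⊤ := by
    intro x0 hx0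
    obtain ⟨a, v, L, Λ, δ, hc, hv, hvs, hΛ, hδ, hb, hvu, eqn⟩ := localize hΩo hA hqb hu2 hsol hx0
    have hne : ¬ ∀ᶠ z in nhds x0, v z = 0 := by
      intro h0
      apply ucp hΩo hΩc hA hqb hu2 hsol hu0 hx0
      filter_upwards [h0, ball_mem_nhds x0 hδ] with z h1 h2
      rw [← hvu z h2, h1]
    obtain ⟨η, hη, C, hC, H⟩ := star hn2 hc hv hvs hΛ hδ eqn hne
    obtain ⟨r, hr, U, hU, hfin⟩ := star_dy hn0 hv.continuous hvs hne hη hC H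
    refine ⟨r, hr, U ∩ ball x0 δ, Filter.inter_mem hU (ball_mem_nhds x0 hδ), ?_⟩
    refine lt_of_le_of_lt ?_ hfin
    have hm : Measurable (fun x => ENNReal.ofReal |v x| ^ (-(2 * r))) :=
      (ENNReal.measurable_ofReal.comp (continuous_abs.comp hv.continuous).measurable).pow_const _
    calc ∫⁻ x in U ∩ ball x0 δ, ENNReal.ofReal |u x| ^ (-(2 * r))
        = ∫⁻ x in U ∩ ball x0 δ, ENNReal.ofReal |v x| ^ (-(2 * r)) := by
          rw [inter_comm, ← Measure.restrict_restrict measurableSet_ball]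
          apply setLIntegral_congr_fun measurableSet_ball
          intro x hx
          simp only
          rw [hvu x hx]
      _ ≤ _ := lintegral_mono_set inter_subset_left
  suffices hs : ∃ r > 0, (∫⁻ x in K ∩ K, (ENNReal.ofReal |u x|) ^ (-(2 * r) : ℝ)) < ⊤ by
    rwa [inter_self] at hs
  refine hK.induction_on (p := fun S => ∃ r > 0, (∫⁻ x in K ∩ S, (ENNReal.ofReal |u x|) ^ (-(2 * r) : ℝ)) < ⊤) ?_ ?_ ?_ ?_
  · exact ⟨1, one_pos, by simp⟩
  · rintro s t hst ⟨r, hr, h⟩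
    exact ⟨r, hr, (lintegral_mono_set (inter_subset_inter_right K hst)).trans_lt h⟩
  · rintro s t ⟨r, hr, h⟩ ⟨r', hr', h'⟩
    have gen : ∀ (S : Set (EuclideanSpace ℝ (Fin n))) (ρ : ℝ), min r r' ≤ ρ → (∫⁻ x in K ∩ S, (ENNReal.ofReal |u x|) ^ (-(2 * ρ) : ℝ)) < ⊤ →
        (∫⁻ x in K ∩ S, (ENNReal.ofReal |u x|) ^ (-(2 * min r r') : ℝ)) < ⊤ := by
      intro S ρ hρ hS
      calc (∫⁻ x in K ∩ S, (ENNReal.ofReal |u x|) ^ (-(2 * min r r') : ℝ))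
          ≤ ∫⁻ x in K ∩ S, (1 + (ENNReal.ofReal |u x|) ^ (-(2 * ρ) : ℝ)) :=
            lintegral_mono fun x => rpow_neg_le_add (lt_min hr hr').le hρ
        _ = (∫⁻ x in K ∩ S, 1) + ∫⁻ x in K ∩ S, (ENNReal.ofReal |u x|) ^ (-(2 * ρ) : ℝ) :=
            lintegral_add_left measurable_const _
        _ < ⊤ := by
          rw [setLIntegral_one]
          exact ENNReal.add_lt_top.mpr ⟨(measure_mono inter_subset_left).trans_lt hK.measure_lt_top, hS⟩
    refine ⟨min r r', lt_min hr hr', ?_⟩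
    rw [inter_union_distrib_left]
    refine (lintegral_union_le _ _ _).trans_lt ?_
    exact ENNReal.add_lt_top.mpr ⟨gen s r (min_le_left _ _) h, gen t r' (min_le_right _ _) h'⟩
  · intro x hx
    obtain ⟨r, hr, U, hU, h⟩ := hloc x (hKΩ hx)
    exact ⟨U, mem_nhdsWithin_of_mem_nhds hU, r, hr, (lintegral_mono_set inter_subset_right).trans_lt h⟩
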